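/- Every triangle-free planar graph admits a forest storyplan: there exists a vertex order τ such that, at every step, the subgraph induced by the visible vertices is a forest. -/

import Mathlib

/-- `H` is a minor of `G`: disjoint connected branch sets, one per vertex of `H`,
with an edge of `G` between branch sets of adjacent vertices of `H`. -/
def SimpleGraph.IsMinorOf {W V : Type*} (H : SimpleGraph W) (G : SimpleGraph V) : Prop :=
  ∃ f : W → Set V,
    (∀ w, (G.induce (f w)).Connected) ∧
    (∀ w₁ w₂, w₁ ≠ w₂ → Disjoint (f w₁) (f w₂)) ∧
    (∀ w₁ w₂, H.Adj w₁ w₂ → ∃ a ∈ f w₁, ∃ b ∈ f w₂, G.Adj a b)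

/-- Planarity via Wagner's theorem: no `K₅` minor and no `K₃,₃` minor. -/
def SimpleGraph.IsPlanar {V : Type*} (G : SimpleGraph V) : Prop :=
  ¬ (completeGraph (Fin 5)).IsMinorOf G ∧
  ¬ (completeBipartiteGraph (Fin 3) (Fin 3)).IsMinorOf G

/-- Outerplanarity: no `K₄` minor and no `K₂,₃` minor. -/
def SimpleGraph.IsOuterplanar {V : Type*} (G : SimpleGraph V) : Prop :=
  ¬ (completeGraph (Fin 4)).IsMinorOf G ∧
  ¬ (completeBipartiteGraph (Fin 2) (Fin 3)).IsMinorOf G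

/-- Vertex `v` is visible at step `i`: `τ v ≤ i ≤ max_{u ∈ N[v]} τ u`. -/
def visibleAt {V : Type*} {n : ℕ} (G : SimpleGraph V) (τ : V ≃ Fin n) (v : V) (i : Fin n) :
    Prop :=
  τ v ≤ i ∧ ∃ u, (u = v ∨ G.Adj v u) ∧ i ≤ τ u

/-- The `i`-th frame: the subgraph induced by the vertices visible at step `i`. -/
def frame {V : Type*} {n : ℕ} (G : SimpleGraph V) (τ : V ≃ Fin n) (i : Fin n) :
    SimpleGraph {v : V // visibleAt G τ v i} :=
  G.induce {v | visibleAt G τ v i}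

def IsForestStoryplan {V : Type*} {n : ℕ} (G : SimpleGraph V) (τ : V ≃ Fin n) : Prop :=
  ∀ i : Fin n, (frame G τ i).IsAcyclic

def IsOuterplanarStoryplan {V : Type*} {n : ℕ} (G : SimpleGraph V) (τ : V ≃ Fin n) : Prop :=
  ∀ i : Fin n, (frame G τ i).IsOuterplanar

def IsPlanarStoryplan {V : Type*} {n : ℕ} (G : SimpleGraph V) (τ : V ≃ Fin n) : Prop :=
  ∀ i : Fin n, (frame G τ i).IsPlanar

/-! ### Cycles as periodic sequences -/

/-- A cycle of length `n`, given as an `n`-periodic sequence of vertices. -/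
structure IsCyc {V : Type*} (G : SimpleGraph V) (n : ℕ) (c : ℕ → V) : Prop where
  three : 3 ≤ n
  per : ∀ i, c (i + n) = c i
  inj : ∀ i j, i < j → j < i + n → c i ≠ c j
  adj : ∀ i, G.Adj (c i) (c (i + 1))

/-- `S` contains no cycle of `G`. -/
def ForestOn {V : Type*} (G : SimpleGraph V) (S : Set V) : Prop :=
  ∀ n c, IsCyc G n c → ∃ i, c i ∉ S

theorem IsCyc.map {V W : Type*} {G : SimpleGraph V} {H : SimpleGraph W} {n : ℕ} {c : ℕ → V}
    (hc : IsCyc G n c) (f : V → W) (hf : Function.Injective f)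
    (hadj : ∀ a b, G.Adj a b → H.Adj (f a) (f b)) : IsCyc H n (fun i => f (c i)) where
  three := hc.three
  per i := by simp [hc.per]
  inj i j h1 h2 h := hc.inj i j h1 h2 (hf h)
  adj i := hadj _ _ (hc.adj i)

theorem IsCyc.shift {V : Type*} {G : SimpleGraph V} {n : ℕ} {c : ℕ → V} (hc : IsCyc G n c)
    (k : ℕ) : IsCyc G n (fun i => c (i + k)) where
  three := hc.three
  per i := by
    have := hc.per (i + k)
    rwa [show i + k + n = i + n + k by omega] at this
  inj i j h1 h2 := hc.inj _ _ (by omega) (by omega)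
  adj i := by
    have := hc.adj (i + k)
    rwa [show i + k + 1 = i + 1 + k by omega] at this

theorem SimpleGraph.Walk.IsCycle.isCyc {V : Type*} {G : SimpleGraph V} {u : V} {w : G.Walk u u}
    (hw : w.IsCycle) : IsCyc G w.length (fun i => w.getVert (i % w.length)) where
  three := hw.three_le_length
  per i := by simp
  inj i j h1 h2 h := by
    have h3 := hw.three_le_length
    have hi := Nat.mod_lt i (by omega : 0 < w.length)
    have hj := Nat.mod_lt j (by omega : 0 < w.length)
    have := hw.getVert_injOn' (by simp only [Set.mem_ofPred_eq]; omega)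
      (by simp only [Set.mem_ofPred_eq]; omega) h
    have h4 : w.length ∣ j - i := (Nat.modEq_iff_dvd' h1.le).mp this
    have := Nat.le_of_dvd (by omega) h4
    omega
  adj i := by
    have h3 := hw.three_le_length
    have hi := Nat.mod_lt i (by omega : 0 < w.length)
    have := w.adj_getVert_succ hi
    by_cases h : i % w.length + 1 = w.length
    · have h5 : (i + 1) % w.length = 0 := by
        rw [← Nat.mod_add_mod, h, Nat.mod_self]
      rw [h5]
      simpa [h] using this
    · have h5 : (i + 1) % w.length = i % w.length + 1 := by
        rw [← Nat.mod_add_mod, Nat.mod_eq_of_lt (by omega)]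
      rw [h5]
      exact this

theorem ForestOn.mono {V : Type*} {G : SimpleGraph V} {S T : Set V} (hT : ForestOn G T)
    (h : S ⊆ T) : ForestOn G S := fun n c hc => by
  obtain ⟨i, hi⟩ := hT n c hc
  exact ⟨i, fun h' => hi (h h')⟩

theorem ForestOn.isAcyclic {V : Type*} {G : SimpleGraph V} {S : Set V} (h : ForestOn G S) :
    (G.induce S).IsAcyclic := by
  intro u w hw
  obtain ⟨i, hi⟩ := h _ _ (hw.isCyc.map (H := G) (fun x => x.1) Subtype.val_injective
    (fun a b hab => hab))
  exact hi (Subtype.mem _)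

/-- If every edge inside `S` contains `r`, then `S` contains no cycle. -/
theorem ForestOn.star {V : Type*} {G : SimpleGraph V} {S : Set V} (r : V)
    (h : ∀ a ∈ S, ∀ b ∈ S, G.Adj a b → a = r ∨ b = r) : ForestOn G S := by
  intro n c hc
  by_contra! hS
  have h3 := hc.three
  have h01 := hc.inj 0 1 (by omega) (by omega)
  have h02 := hc.inj 0 2 (by omega) (by omega)
  have h12 := hc.inj 1 2 (by omega) (by omega)
  have h13 := hc.inj 1 3 (by omega) (by omega)
  have h23 := hc.inj 2 3 (by omega) (by omega)
  have e0 := h _ (hS 0) _ (hS 1) (hc.adj 0)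
  have e1 := h _ (hS 1) _ (hS 2) (hc.adj 1)
  have e2 := h _ (hS 2) _ (hS 3) (hc.adj 2)
  grind

/-! ### Orders obtained by removing vertices one at a time -/

/-- The vertices visible when `x` is added to the set `U`, time running backwards. -/
def bag {V : Type*} (G : SimpleGraph V) (U : Set V) (x : V) : Set V :=
  {v | v ∉ U ∧ (v = x ∨ ∃ w ∈ insert x U, G.Adj v w)}

/-- `U` can be completed, one vertex at a time, through acyclic bags. -/
inductive Completable {V : Type*} (G : SimpleGraph V) : Set V → Prop
  | done : Completable G Set.univ
  | step (U : Set V) (x : V) (hx : x ∉ U) (hb : ForestOn G (bag G U x))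
      (h : Completable G (insert x U)) : Completable G U

theorem Completable.exists_list {V : Type*} {G : SimpleGraph V} {U : Set V}
    (h : Completable G U) : ∃ l : List V, l.Nodup ∧ (∀ v, v ∈ l ↔ v ∉ U) ∧
      ∀ k (hk : k < l.length), ForestOn G (bag G (U ∪ {v | v ∈ l.take k}) l[k]) := by
  induction h with
  | done => exact ⟨[], by simp, by simp, by simp⟩
  | step U x hx hb _ ih =>
    obtain ⟨l, h1, h2, h3⟩ := ih
    refine ⟨x :: l, ?_, ?_, ?_⟩
    · simp [h1, h2]
    · intro v
      by_cases hv : v = x <;> simp [h2, hv, hx]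
    · intro k hk
      cases k with
      | zero => simpa using hb
      | succ k =>
        have := h3 k (by simpa using hk)
        have hset : U ∪ {v | v ∈ (x :: l).take (k + 1)} = insert x U ∪ {v | v ∈ l.take k} := by
          ext v
          simp only [List.take_succ_cons, List.mem_cons, Set.mem_union, Set.mem_insert_iff, Set.mem_ofPred_eq]
          tauto
        rw [hset]
        exact this

theorem Completable.exists_storyplan {V : Type*} [Fintype V] {G : SimpleGraph V}
    (h : Completable G ∅) : ∃ τ : V ≃ Fin (Fintype.card V), IsForestStoryplan G τ := by
  classical
  obtain ⟨l, h1, h2, h3⟩ := h.exists_list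
  have h2' : ∀ v, v ∈ l := fun v => by simp [h2]
  let e := List.Nodup.getEquivOfForallMemList l h1 h2'
  have hlen : l.length = Fintype.card V := by
    rw [← Fintype.card_congr e, Fintype.card_fin]
  have he : ∀ k : Fin l.length, e k = l[k] := fun k => rfl
  refine ⟨(e.symm.trans Fin.revPerm).trans (finCongr hlen), ?_⟩
  intro i
  let k : Fin l.length := Fin.rev (Fin.cast hlen.symm i)
  have hk : k.1 + 1 + i.1 = l.length := by
    have := i.2
    simp only [k, Fin.val_rev, Fin.val_cast]
    omega
  have := (h3 k.1 k.2).isAcyclic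
  refine ForestOn.isAcyclic ((h3 k.1 k.2).mono ?_)
  have hτ : ∀ v, ((((e.symm.trans Fin.revPerm).trans (finCongr hlen)) v) : ℕ) + 1
      + (e.symm v : ℕ) = l.length := by
    intro v
    have := (e.symm v).2
    simp [Fin.val_rev]
    omega
  have htake : ∀ v, v ∈ l.take k.1 ↔ (e.symm v : ℕ) < k.1 := by
    intro v
    obtain ⟨j, rfl⟩ := e.surjective v
    rw [Equiv.symm_apply_apply, he, List.mem_take_iff_getElem]
    constructor
    · rintro ⟨m, hm, hm'⟩
      have : m = j.1 := by
        have := (h1.getElem_inj_iff (i := m) (j := j.1) (hi := by omega) (hj := j.2)).1 hm'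
        exact this
      omega
    · intro hj
      exact ⟨j.1, by omega, rfl⟩
  intro v hv
  obtain ⟨hv1, u, hu, hv2⟩ := hv
  have a1 := hτ v
  have a2 := hτ u
  rw [Fin.le_def] at hv1 hv2
  refine ⟨?_, ?_⟩
  · simp only [Set.empty_union, Set.mem_ofPred_eq, htake]
    omega
  · have hmem : u = l[k] ∨ u ∈ l.take k.1 := by
      rw [htake]
      by_cases h : (e.symm u : ℕ) < k.1
      · exact Or.inr h
      · left
        have : e.symm u = k := Fin.ext (by omega)
        rw [← he, ← this, Equiv.apply_symm_apply]
    rcases hu with rfl | hu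
    · rcases hmem with h | h
      · exact Or.inl h
      · rw [htake] at h; omega
    · right
      refine ⟨u, ?_, hu⟩
      rcases hmem with h | h
      · exact Or.inl h
      · right; simpa using h

/-! ### Connected vertex sets and minors inside a vertex set -/

/-- `S` induces a nonempty connected subgraph of `G`. -/
def Conn {V : Type*} (G : SimpleGraph V) (S : Set V) : Prop :=
  S.Nonempty ∧ ∀ C : Set V, (∃ a ∈ S, a ∈ C) →
    (∀ a ∈ S, a ∈ C → ∀ b ∈ S, G.Adj a b → b ∈ C) → S ⊆ C

/-- Some edge of `G` joins `A` to `B`. -/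
def Touch {V : Type*} (G : SimpleGraph V) (A B : Set V) : Prop :=
  ∃ a ∈ A, ∃ b ∈ B, G.Adj a b

theorem Touch.symm {V : Type*} {G : SimpleGraph V} {A B : Set V} (h : Touch G A B) :
    Touch G B A := by
  obtain ⟨a, ha, b, hb, hab⟩ := h
  exact ⟨b, hb, a, ha, hab.symm⟩

theorem Touch.mono {V : Type*} {G : SimpleGraph V} {A B A' B' : Set V} (h : Touch G A B)
    (hA : A ⊆ A') (hB : B ⊆ B') : Touch G A' B' := by
  obtain ⟨a, ha, b, hb, hab⟩ := h
  exact ⟨a, hA ha, b, hB hb, hab⟩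

theorem SimpleGraph.Adj.touch {V : Type*} {G : SimpleGraph V} {A B : Set V} {a b : V}
    (h : G.Adj a b) (ha : a ∈ A) (hb : b ∈ B) : Touch G A B := ⟨a, ha, b, hb, h⟩

theorem Conn.singleton {V : Type*} (G : SimpleGraph V) (v : V) : Conn G {v} := by
  refine ⟨⟨v, rfl⟩, ?_⟩
  rintro C ⟨a, rfl, ha⟩ - b rfl
  exact ha

theorem Conn.union {V : Type*} {G : SimpleGraph V} {A B : Set V} (hA : Conn G A)
    (hB : Conn G B) (h : Touch G A B) : Conn G (A ∪ B) := by
  obtain ⟨x, hx, y, hy, hxy⟩ := h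
  refine ⟨⟨x, Or.inl hx⟩, ?_⟩
  rintro C ⟨a, ha, haC⟩ hC
  have kA : (∃ a ∈ A, a ∈ C) → A ⊆ C := fun h => hA.2 C h
    (fun a ha haC b hb => hC a (Or.inl ha) haC b (Or.inl hb))
  have kB : (∃ a ∈ B, a ∈ C) → B ⊆ C := fun h => hB.2 C h
    (fun a ha haC b hb => hC a (Or.inr ha) haC b (Or.inr hb))
  have h1 : A ⊆ C ∧ B ⊆ C := by
    rcases ha with ha | ha
    · have := kA ⟨a, ha, haC⟩
      exact ⟨this, kB ⟨y, hy, hC x (Or.inl hx) (this hx) y (Or.inr hy) hxy⟩⟩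
    · have := kB ⟨a, ha, haC⟩
      exact ⟨kA ⟨x, hx, hC y (Or.inr hy) (this hy) x (Or.inl hx) hxy.symm⟩, this⟩
  exact Set.union_subset h1.1 h1.2

theorem Conn.insert {V : Type*} {G : SimpleGraph V} {A : Set V} {v : V} (hA : Conn G A)
    (h : ∃ a ∈ A, G.Adj v a) : Conn G (insert v A) := by
  obtain ⟨a, ha, hva⟩ := h
  exact (Conn.singleton G v).union hA ⟨v, rfl, a, ha, hva⟩

/-- A connected set together with vertices adjacent to it is connected. -/
theorem Conn.union_of_adj {V : Type*} {G : SimpleGraph V} {A M : Set V} (hA : Conn G A)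
    (h : ∀ m ∈ M, ∃ a ∈ A, G.Adj m a) : Conn G (A ∪ M) := by
  refine ⟨hA.1.mono Set.subset_union_left, ?_⟩
  rintro C ⟨a, ha, haC⟩ hC
  have kA : A ⊆ C := by
    refine hA.2 C ?_ (fun a ha haC b hb => hC a (Or.inl ha) haC b (Or.inl hb))
    rcases ha with ha | ha
    · exact ⟨a, ha, haC⟩
    · obtain ⟨b, hb, hab⟩ := h a ha
      exact ⟨b, hb, hC a (Or.inr ha) haC b (Or.inl hb) hab⟩
  rintro b (hb | hb)
  · exact kA hb
  · obtain ⟨d, hd, hbd⟩ := h b hb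
    exact hC d (Or.inl hd) (kA hd) b (Or.inr hb) hbd.symm

theorem Conn.congr {V : Type*} {G H : SimpleGraph V} {S : Set V} (hS : Conn G S)
    (h : ∀ a ∈ S, ∀ b ∈ S, G.Adj a b → H.Adj a b) : Conn H S :=
  ⟨hS.1, fun C h1 h2 => hS.2 C h1 (fun a ha haC b hb hab => h2 a ha haC b hb (h a ha b hb hab))⟩

theorem Conn.induce_connected {V : Type*} {G : SimpleGraph V} {S : Set V} (h : Conn G S) :
    (G.induce S).Connected := by
  obtain ⟨⟨r, hr⟩, h2⟩ := h
  have : Nonempty S := ⟨⟨r, hr⟩⟩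
  have key : ∀ a b : S, (G.induce S).Reachable a b := by
    intro a b
    have := h2 {v | ∃ hv : v ∈ S, (G.induce S).Reachable a ⟨v, hv⟩}
      ⟨a, a.2, a.2, SimpleGraph.Reachable.refl _⟩ (by
        rintro x hx ⟨_, hx'⟩ y hy hxy
        refine ⟨hy, hx'.trans (SimpleGraph.Adj.reachable ?_)⟩
        exact hxy)
    obtain ⟨_, h⟩ := this b.2
    exact h
  exact ⟨key⟩

/-- The component of `r` in the subgraph induced by `S`. -/
def comp {V : Type*} (G : SimpleGraph V) (S : Set V) (r : V) : Set V :=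
  {v | v ∈ S ∧ ∀ C : Set V, r ∈ C → (∀ a ∈ S, a ∈ C → ∀ b ∈ S, G.Adj a b → b ∈ C) → v ∈ C}

theorem comp_subset {V : Type*} (G : SimpleGraph V) (S : Set V) (r : V) : comp G S r ⊆ S :=
  fun _ h => h.1

theorem mem_comp_self {V : Type*} (G : SimpleGraph V) {S : Set V} {r : V} (h : r ∈ S) :
    r ∈ comp G S r := ⟨h, fun _ h _ => h⟩

theorem comp_closed {V : Type*} {G : SimpleGraph V} {S : Set V} {r a b : V}
    (ha : a ∈ comp G S r) (hb : b ∈ S) (hab : G.Adj a b) : b ∈ comp G S r :=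
  ⟨hb, fun C hr hC => hC a ha.1 (ha.2 C hr hC) b hb hab⟩

theorem conn_comp {V : Type*} {G : SimpleGraph V} {S : Set V} {r : V} (h : r ∈ S) :
    Conn G (comp G S r) := by
  refine ⟨⟨r, mem_comp_self G h⟩, ?_⟩
  rintro C ⟨a, ha, haC⟩ hC
  have hr : r ∈ C := by
    by_contra hr
    have := ha.2 {v | v ∈ comp G S r ∧ v ∉ C} ⟨mem_comp_self G h, hr⟩ (by
      rintro x hx ⟨hx1, hx2⟩ y hy hxy
      have hy1 := comp_closed hx1 hy hxy
      exact ⟨hy1, fun hyC => hx2 (hC y hy1 hyC x hx1 hxy.symm)⟩)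
    exact this.2 haC
  intro b hb
  have := hb.2 {v | v ∈ comp G S r ∧ v ∈ C} ⟨mem_comp_self G h, hr⟩ (by
      rintro x hx ⟨hx1, hx2⟩ y hy hxy
      have hy1 := comp_closed hx1 hy hxy
      exact ⟨hy1, hC x hx1 hx2 y hy1 hxy⟩)
  exact this.2

theorem Conn.subset_comp {V : Type*} {G : SimpleGraph V} {S A : Set V} {r : V} (hA : Conn G A)
    (hAS : A ⊆ S) (hr : r ∈ A) : A ⊆ comp G S r :=
  hA.2 _ ⟨r, hr, mem_comp_self G (hAS hr)⟩
    (fun _ _ ha' _ hb hab => comp_closed ha' (hAS hb) hab)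

/-- A consecutive segment of a sequence of adjacent vertices is connected. -/
theorem conn_image_Ico {V : Type*} {G : SimpleGraph V} {c : ℕ → V} {i j : ℕ} (hij : i < j)
    (hc : ∀ k, i ≤ k → k + 1 < j → G.Adj (c k) (c (k + 1))) : Conn G (c '' Set.Ico i j) := by
  induction j, hij using Nat.le_induction with
  | base =>
    have : c '' Set.Ico i (i + 1) = {c i} := by
      have : Set.Ico i (i + 1) = {i} := by ext; simp; omega
      rw [this, Set.image_singleton]
    rw [Nat.succ_eq_add_one, this]
    exact Conn.singleton G _
  | succ j hj ih =>
    have ih := ih (fun k h1 h2 => hc k h1 (by omega))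
    have : c '' Set.Ico i (j + 1) = insert (c j) (c '' Set.Ico i j) := by
      have : Set.Ico i (j + 1) = insert j (Set.Ico i j) := by
        ext; simp; omega
      rw [this, Set.image_insert_eq]
    rw [this]
    refine ih.insert ⟨c (j - 1), ⟨j - 1, ?_, rfl⟩, ?_⟩
    · simp; omega
    · have := hc (j - 1) (by omega) (by omega)
      rw [Nat.sub_add_cancel (by omega)] at this
      exact this.symm

/-- `K` is a minor of `G` with branch sets inside `s`. -/
def MinorIn {W V : Type*} (K : SimpleGraph W) (G : SimpleGraph V) (s : Set V) : Prop :=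
  ∃ f : W → Set V, (∀ w, Conn G (f w) ∧ f w ⊆ s) ∧ (∀ w₁ w₂, w₁ ≠ w₂ → Disjoint (f w₁) (f w₂)) ∧
    ∀ w₁ w₂, K.Adj w₁ w₂ → Touch G (f w₁) (f w₂)

theorem MinorIn.isMinorOf {W V : Type*} {K : SimpleGraph W} {G : SimpleGraph V} {s : Set V}
    (h : MinorIn K G s) : K.IsMinorOf G := by
  obtain ⟨f, h1, h2, h3⟩ := h
  exact ⟨f, fun w => (h1 w).1.induce_connected, h2, h3⟩

/-- Minors of a minor are minors. -/
theorem MinorIn.trans {W V V' : Type*} {K : SimpleGraph W} {G' : SimpleGraph V'}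
    {G : SimpleGraph V} {s' : Set V'} {s : Set V} (h : MinorIn K G' s') (f : V' → Set V)
    (hf : ∀ v ∈ s', Conn G (f v) ∧ f v ⊆ s)
    (hd : ∀ v ∈ s', ∀ w ∈ s', v ≠ w → Disjoint (f v) (f w))
    (ht : ∀ v ∈ s', ∀ w ∈ s', G'.Adj v w → Touch G (f v) (f w)) : MinorIn K G s := by
  obtain ⟨g, h1, h2, h3⟩ := h
  refine ⟨fun w => ⋃ v ∈ g w, f v, ?_, ?_, ?_⟩
  · intro w
    obtain ⟨⟨hne, hc⟩, hs⟩ := h1 w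
    refine ⟨⟨?_, ?_⟩, ?_⟩
    · obtain ⟨v, hv⟩ := hne
      obtain ⟨x, hx⟩ := (hf v (hs hv)).1.1
      exact ⟨x, by simp only [Set.mem_iUnion]; exact ⟨v, hv, hx⟩⟩
    · rintro C ⟨a, ha, haC⟩ hC
      simp only [Set.mem_iUnion, exists_prop] at ha hC
      obtain ⟨v, hv, hav⟩ := ha
      have kk : ∀ u ∈ g w, (∃ a ∈ f u, a ∈ C) → f u ⊆ C := fun u hu h =>
        (hf u (hs hu)).1.2 C h
          (fun a ha haC b hb hab => hC a ⟨u, hu, ha⟩ haC b ⟨u, hu, hb⟩ hab)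
      have := hc {u | f u ⊆ C} ⟨v, hv, kk v hv ⟨a, hav, haC⟩⟩ (by
        intro u hu huC u' hu' huu'
        obtain ⟨p, hp, q, hq, hpq⟩ := ht u (hs hu) u' (hs hu') huu'
        exact kk u' hu' ⟨q, hq, hC p ⟨u, hu, hp⟩ (huC hp) q ⟨u', hu', hq⟩ hpq⟩)
      simp only [Set.iUnion_subset_iff]
      exact fun u hu => this hu
    · simp only [Set.iUnion_subset_iff]
      exact fun u hu => (hf u (hs hu)).2
  · intro w₁ w₂ hw
    simp only [Set.disjoint_iUnion_left, Set.disjoint_iUnion_right]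
    intro v hv u hu
    refine hd u ((h1 _).2 hu) v ((h1 _).2 hv) ?_
    rintro rfl
    exact Set.disjoint_left.1 (h2 _ _ hw) hu hv
  · intro w₁ w₂ hw
    obtain ⟨a, ha, b, hb, hab⟩ := h3 _ _ hw
    refine (ht a ((h1 _).2 ha) b ((h1 _).2 hb) hab).mono ?_ ?_
    · exact Set.subset_biUnion_of_mem (u := f) ha
    · exact Set.subset_biUnion_of_mem (u := f) hb

abbrev K5 : SimpleGraph (Fin 5) := SimpleGraph.completeGraph (Fin 5)
abbrev K33 : SimpleGraph (Fin 3 ⊕ Fin 3) := completeBipartiteGraph (Fin 3) (Fin 3)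

/-- No `K₅` or `K₃,₃` minor of `G` lies inside `s`. -/
def Pl {V : Type*} (G : SimpleGraph V) (s : Set V) : Prop :=
  ¬ MinorIn K5 G s ∧ ¬ MinorIn K33 G s

theorem Pl.minor {V V' : Type*} {G' : SimpleGraph V'} {G : SimpleGraph V} {s' : Set V'}
    {s : Set V} (h : Pl G s) (f : V' → Set V)
    (hf : ∀ v ∈ s', Conn G (f v) ∧ f v ⊆ s)
    (hd : ∀ v ∈ s', ∀ w ∈ s', v ≠ w → Disjoint (f v) (f w))
    (ht : ∀ v ∈ s', ∀ w ∈ s', G'.Adj v w → Touch G (f v) (f w)) : Pl G' s' :=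
  ⟨fun hm => h.1 (hm.trans f hf hd ht), fun hm => h.2 (hm.trans f hf hd ht)⟩

theorem Pl.mono {V : Type*} {G' G : SimpleGraph V} {s' s : Set V} (h : Pl G s) (hs : s' ⊆ s)
    (hG : ∀ a ∈ s', ∀ b ∈ s', G'.Adj a b → G.Adj a b) : Pl G' s' :=
  h.minor (fun v => {v}) (fun v hv => ⟨Conn.singleton G v, by simpa using hs hv⟩)
    (fun v _ w _ hvw => by simpa using hvw)
    (fun v hv w hw hvw => ⟨v, rfl, w, rfl, hG v hv w hw hvw⟩)

theorem SimpleGraph.IsPlanar.pl {V : Type*} {G : SimpleGraph V} (h : G.IsPlanar) (s : Set V) :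
    Pl G s := ⟨fun hm => h.1 hm.isMinorOf, fun hm => h.2 hm.isMinorOf⟩

theorem Pl.no_K33 {V : Type*} {G : SimpleGraph V} {s : Set V} (h : Pl G s)
    (R C : Fin 3 → Set V) (hR : ∀ i, Conn G (R i) ∧ R i ⊆ s) (hC : ∀ i, Conn G (C i) ∧ C i ⊆ s)
    (dR : ∀ i j, i < j → Disjoint (R i) (R j)) (dC : ∀ i j, i < j → Disjoint (C i) (C j))
    (dRC : ∀ i j, Disjoint (R i) (C j)) (t : ∀ i j, Touch G (R i) (C j)) : False := by
  refine h.2 ⟨Sum.elim R C, ?_, ?_, ?_⟩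
  · rintro (i | i)
    · exact hR i
    · exact hC i
  · rintro (i | i) (j | j) hij
    · rcases lt_or_gt_of_ne (fun h => hij (congrArg _ h) : i ≠ j) with h | h
      · exact dR _ _ h
      · exact (dR _ _ h).symm
    · exact dRC i j
    · exact (dRC j i).symm
    · rcases lt_or_gt_of_ne (fun h => hij (congrArg _ h) : i ≠ j) with h | h
      · exact dC _ _ h
      · exact (dC _ _ h).symm
  · rintro (i | i) (j | j) hij
    · simp at hij
    · exact t i j
    · exact (t j i).symm
    · simp at hij

theorem Pl.no_K5 {V : Type*} {G : SimpleGraph V} {s : Set V} (h : Pl G s)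
    (R : Fin 5 → Set V) (hR : ∀ i, Conn G (R i) ∧ R i ⊆ s)
    (dR : ∀ i j, i < j → Disjoint (R i) (R j)) (t : ∀ i j, i < j → Touch G (R i) (R j)) :
    False := by
  refine h.1 ⟨R, hR, ?_, ?_⟩
  · intro i j hij
    rcases lt_or_gt_of_ne hij with h | h
    · exact dR _ _ h
    · exact (dR _ _ h).symm
  · intro i j hij
    have hij : i ≠ j := hij.ne
    rcases lt_or_gt_of_ne hij with h | h
    · exact t _ _ h
    · exact (t _ _ h).symm

/-- `K₃,₃` exclusion with explicit branch sets. -/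
theorem Pl.no_K33' {V : Type*} {G : SimpleGraph V} {s : Set V} (h : Pl G s)
    (R₀ R₁ R₂ C₀ C₁ C₂ : Set V)
    (hc : Conn G R₀ ∧ Conn G R₁ ∧ Conn G R₂ ∧ Conn G C₀ ∧ Conn G C₁ ∧ Conn G C₂)
    (hs : R₀ ⊆ s ∧ R₁ ⊆ s ∧ R₂ ⊆ s ∧ C₀ ⊆ s ∧ C₁ ⊆ s ∧ C₂ ⊆ s)
    (hd : (Disjoint R₀ R₁ ∧ Disjoint R₀ R₂ ∧ Disjoint R₁ R₂) ∧
      (Disjoint C₀ C₁ ∧ Disjoint C₀ C₂ ∧ Disjoint C₁ C₂) ∧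
      (Disjoint R₀ C₀ ∧ Disjoint R₀ C₁ ∧ Disjoint R₀ C₂) ∧
      (Disjoint R₁ C₀ ∧ Disjoint R₁ C₁ ∧ Disjoint R₁ C₂) ∧
      (Disjoint R₂ C₀ ∧ Disjoint R₂ C₁ ∧ Disjoint R₂ C₂))
    (ht : (Touch G R₀ C₀ ∧ Touch G R₀ C₁ ∧ Touch G R₀ C₂) ∧
      (Touch G R₁ C₀ ∧ Touch G R₁ C₁ ∧ Touch G R₁ C₂) ∧
      (Touch G R₂ C₀ ∧ Touch G R₂ C₁ ∧ Touch G R₂ C₂)) : False := by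
  refine h.no_K33 ![R₀, R₁, R₂] ![C₀, C₁, C₂] ?_ ?_ ?_ ?_ ?_ ?_ <;>
    simp [Fin.forall_fin_succ] <;> tauto

/-- `K₅` exclusion with explicit branch sets. -/
theorem Pl.no_K5' {V : Type*} {G : SimpleGraph V} {s : Set V} (h : Pl G s)
    (R₀ R₁ R₂ R₃ R₄ : Set V)
    (hc : Conn G R₀ ∧ Conn G R₁ ∧ Conn G R₂ ∧ Conn G R₃ ∧ Conn G R₄)
    (hs : R₀ ⊆ s ∧ R₁ ⊆ s ∧ R₂ ⊆ s ∧ R₃ ⊆ s ∧ R₄ ⊆ s)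
    (hd : (Disjoint R₀ R₁ ∧ Disjoint R₀ R₂ ∧ Disjoint R₀ R₃ ∧ Disjoint R₀ R₄) ∧
      (Disjoint R₁ R₂ ∧ Disjoint R₁ R₃ ∧ Disjoint R₁ R₄) ∧
      (Disjoint R₂ R₃ ∧ Disjoint R₂ R₄) ∧ Disjoint R₃ R₄)
    (ht : (Touch G R₀ R₁ ∧ Touch G R₀ R₂ ∧ Touch G R₀ R₃ ∧ Touch G R₀ R₄) ∧
      (Touch G R₁ R₂ ∧ Touch G R₁ R₃ ∧ Touch G R₁ R₄) ∧
      (Touch G R₂ R₃ ∧ Touch G R₂ R₄) ∧ Touch G R₃ R₄) : False := by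
  refine h.no_K5 ![R₀, R₁, R₂, R₃, R₄] ?_ ?_ ?_ <;>
    simp [Fin.forall_fin_succ] <;> tauto

/-! ### Combinatorial spheres -/

/-- `ab` is an edge of the complex `T`. -/
def TEdge {α : Type*} [DecidableEq α] (T : Finset (Finset α)) (a b : α) : Prop :=
  a ≠ b ∧ ∃ t ∈ T, a ∈ t ∧ b ∈ t

/-- The 1-skeleton of `T`. -/
def tgraph {α : Type*} [DecidableEq α] (T : Finset (Finset α)) : SimpleGraph α where
  Adj := TEdge T
  symm := ⟨by
    rintro a b ⟨h, t, ht, ha, hb⟩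
    exact ⟨h.symm, t, ht, hb, ha⟩⟩
  loopless := ⟨fun _ h => h.1 rfl⟩

/-- A closed strongly connected triangulated surface with trivial first cohomology modulo 2. -/
structure IsSphere {α : Type*} [DecidableEq α] (T : Finset (Finset α)) : Prop where
  card : ∀ t ∈ T, t.card = 3
  nonempty : T.Nonempty
  two : ∀ a b d, {a, b, d} ∈ T → ∃ d', d' ≠ d ∧ {a, b, d'} ∈ T ∧
    ∀ x, {a, b, x} ∈ T → x = d ∨ x = d'
  strong : ∀ P : Finset α → Prop, (∃ t ∈ T, P t) →
    (∀ a b d d', {a, b, d} ∈ T → {a, b, d'} ∈ T → P {a, b, d} → P {a, b, d'}) → ∀ t ∈ T, P t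
  h1 : ∀ c : α → α → ZMod 2, (∀ a b, c a b = c b a) →
    (∀ a b d, {a, b, d} ∈ T → c a b + c b d + c a d = 0) →
    ∃ φ : α → ZMod 2, ∀ a b, TEdge T a b → c a b = φ a + φ b

section

variable {α : Type*} [DecidableEq α] {T : Finset (Finset α)}

theorem TEdge.symm {a b : α} (h : TEdge T a b) : TEdge T b a := (tgraph T).adj_symm h

theorem insert_swap (a b d : α) : ({a, b, d} : Finset α) = {b, a, d} := Finset.insert_comm a b {d}

theorem insert_swap' (a b d : α) : ({a, b, d} : Finset α) = {a, d, b} := by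
  rw [Finset.pair_comm]

theorem insert_rot (a b d : α) : ({a, b, d} : Finset α) = {b, d, a} := by
  rw [insert_swap, insert_swap']

theorem card3_ne {a b d : α} (h : ({a, b, d} : Finset α).card = 3) : a ≠ b ∧ b ≠ d ∧ a ≠ d := by
  refine ⟨?_, ?_, ?_⟩ <;> rintro rfl
  · have := Finset.card_le_two (a := a) (b := d); simp at h; omega
  · have := Finset.card_le_two (a := a) (b := b); simp at h; omega
  · have := Finset.card_le_two (a := a) (b := b)
    rw [insert_swap'] at h
    simp at h
    omega

theorem eq_of_mem3 {t : Finset α} (ht : t.card = 3) {a b : α} (hab : a ≠ b) (ha : a ∈ t)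
    (hb : b ∈ t) : ∃ d, t = {a, b, d} := by
  have h1 : ((t.erase a).erase b).card = 1 := by
    rw [Finset.card_erase_of_mem (by simp [hb, hab.symm]), Finset.card_erase_of_mem ha, ht]
  obtain ⟨d, hd⟩ := Finset.card_eq_one.1 h1
  refine ⟨d, ?_⟩
  rw [← hd, Finset.insert_erase (by simp [hb, hab.symm]), Finset.insert_erase ha]

namespace IsSphere

variable (hT : IsSphere T)
include hT

theorem ne {a b d : α} (h : {a, b, d} ∈ T) : a ≠ b ∧ b ≠ d ∧ a ≠ d := card3_ne (hT.card _ h)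

theorem tedge {a b d : α} (h : {a, b, d} ∈ T) : TEdge T a b :=
  ⟨(hT.ne h).1, _, h, by simp, by simp⟩

theorem tedge' {a b d : α} (h : {a, b, d} ∈ T) : TEdge T a b ∧ TEdge T b d ∧ TEdge T a d :=
  ⟨⟨(hT.ne h).1, _, h, by simp, by simp⟩, ⟨(hT.ne h).2.1, _, h, by simp, by simp⟩,
    ⟨(hT.ne h).2.2, _, h, by simp, by simp⟩⟩

theorem exists_tri {a b : α} (h : TEdge T a b) : ∃ d, {a, b, d} ∈ T := by
  obtain ⟨hab, t, ht, ha, hb⟩ := h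
  obtain ⟨d, rfl⟩ := eq_of_mem3 (hT.card t ht) hab ha hb
  exact ⟨d, ht⟩

theorem exists_two {a b : α} (h : TEdge T a b) : ∃ d d', d ≠ d' ∧ {a, b, d} ∈ T ∧
    {a, b, d'} ∈ T ∧ ∀ x, {a, b, x} ∈ T → x = d ∨ x = d' := by
  obtain ⟨d, hd⟩ := hT.exists_tri h
  obtain ⟨d', h1, h2, h3⟩ := hT.two a b d hd
  exact ⟨d, d', h1.symm, hd, h2, h3⟩

/-- An edge lies in at most two triangles. -/
theorem third {a b d d' x : α} (h1 : {a, b, d} ∈ T) (h2 : {a, b, d'} ∈ T) (hne : d ≠ d')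
    (h3 : {a, b, x} ∈ T) : x = d ∨ x = d' := by
  obtain ⟨e, he1, he2, he3⟩ := hT.two a b d h1
  rcases he3 _ h2 with h | h
  · exact absurd h.symm hne
  · subst h
    exact he3 _ h3

end IsSphere

/-! ### Chains modulo 2 -/

variable [Fintype α]

/-- The degree modulo 2 of the chain `Z` at `a`. -/
def deg2 (Z : Sym2 α → ZMod 2) (a : α) : ZMod 2 := ∑ e : Sym2 α, if a ∈ e then Z e else 0

theorem deg2_add (Z Z' : Sym2 α → ZMod 2) (a : α) :
    deg2 (Z + Z') a = deg2 Z a + deg2 Z' a := by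
  unfold deg2
  rw [← Finset.sum_add_distrib]
  refine Finset.sum_congr rfl fun e _ => ?_
  split_ifs <;> simp

theorem deg2_sum {ι : Type*} (s : Finset ι) (Z : ι → Sym2 α → ZMod 2) (a : α) :
    deg2 (∑ i ∈ s, Z i) a = ∑ i ∈ s, deg2 (Z i) a := by
  classical
  induction s using Finset.induction_on with
  | empty => simp [deg2]
  | insert i s hi ih => rw [Finset.sum_insert hi, Finset.sum_insert hi, deg2_add, ih]

theorem deg2_single (x y a : α) (hxy : x ≠ y) :
    deg2 (Pi.single s(x, y) 1) a = (Pi.single x 1 : α → ZMod 2) a + (Pi.single y 1 : α → ZMod 2) a := by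
  unfold deg2
  rw [Finset.sum_eq_single s(x, y)]
  · simp only [Sym2.mem_iff, Pi.single_apply, if_true]
    by_cases h1 : a = x <;> by_cases h2 : a = y <;> simp_all
  · intro e _ he
    simp [he]
  · simp

/-- The boundary of a triangle. -/
def bd (t : Finset α) : Sym2 α → ZMod 2 :=
  fun e => if e ∈ t.sym2 ∧ ¬ e.IsDiag then 1 else 0

omit [Fintype α] in
theorem bd_mk (t : Finset α) (a b : α) :
    bd t s(a, b) = if a ∈ t ∧ b ∈ t ∧ a ≠ b then 1 else 0 := by
  unfold bd
  congr 1
  simp [and_assoc]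

omit [Fintype α] in
theorem bd_eq {a b d : α} (hab : a ≠ b) (hbd : b ≠ d) (had : a ≠ d) :
    bd ({a, b, d} : Finset α) =
      Pi.single s(a, b) 1 + Pi.single s(b, d) 1 + Pi.single s(a, d) 1 := by
  funext e
  induction e using Sym2.ind with
  | _ x y =>
    rw [bd_mk]
    simp only [Finset.mem_insert, Finset.mem_singleton, Pi.add_apply, Pi.single_apply,
      Sym2.eq_iff]
    by_cases h1 : x = a <;> by_cases h2 : x = b <;> by_cases h3 : x = d <;>
    by_cases h4 : y = a <;> by_cases h5 : y = b <;> by_cases h6 : y = d <;> simp_all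

theorem zmod2_add_self (x : ZMod 2) : x + x = 0 := CharTwo.add_self_eq_zero x

theorem deg2_bd {t : Finset α} (ht : t.card = 3) (x : α) : deg2 (bd t) x = 0 := by
  obtain ⟨a, b, d, hab, had, hbd, rfl⟩ := Finset.card_eq_three.1 ht
  rw [bd_eq hab hbd had, deg2_add, deg2_add, deg2_single _ _ _ hab, deg2_single _ _ _ hbd,
    deg2_single _ _ _ had]
  generalize (Pi.single a 1 : α → ZMod 2) x = p
  generalize (Pi.single b 1 : α → ZMod 2) x = q
  generalize (Pi.single d 1 : α → ZMod 2) x = r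
  revert p q r
  decide

namespace IsSphere

variable (hT : IsSphere T)
include hT

omit [Fintype α] in
theorem sum_bd (σ : Finset α → ZMod 2) {a b d d' : α} (h1 : {a, b, d} ∈ T)
    (h2 : {a, b, d'} ∈ T) (hne : d ≠ d') :
    (∑ t ∈ T, σ t • bd t) s(a, b) = σ {a, b, d} + σ {a, b, d'} := by
  have hab := (hT.ne h1).1
  have ht : ({a, b, d} : Finset α) ≠ {a, b, d'} := by
    intro h
    have : d ∈ ({a, b, d'} : Finset α) := by rw [← h]; simp
    have := hT.ne h1
    simp only [Finset.mem_insert, Finset.mem_singleton] at *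
    grind
  rw [Finset.sum_apply, ← Finset.sum_subset (s₁ := {{a, b, d}, {a, b, d'}}), Finset.sum_pair ht]
  · simp [bd_mk, hab]
  · intro t
    simp only [Finset.mem_insert, Finset.mem_singleton]
    rintro (rfl | rfl) <;> assumption
  · intro t ht hnt
    rw [Pi.smul_apply, bd_mk, if_neg, smul_zero]
    rintro ⟨ha, hb, _⟩
    obtain ⟨x, rfl⟩ := eq_of_mem3 (hT.card t ht) hab ha hb
    rcases hT.third h1 h2 hne ht with rfl | rfl <;> simp at hnt

/-- Every even chain is a sum of triangle boundaries. -/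
theorem dual (Z : Sym2 α → ZMod 2) (hs : ∀ a b, Z s(a, b) ≠ 0 → TEdge T a b)
    (he : ∀ a, deg2 Z a = 0) : ∃ σ : Finset α → ZMod 2, Z = ∑ t ∈ T, σ t • bd t := by
  by_contra hno
  have hZ : Z ∉ Submodule.span (ZMod 2) (bd '' (T : Set (Finset α))) := by
    intro h
    obtain ⟨σ, hσ⟩ := (Submodule.mem_span_image_finset_iff_exists_fun' (ZMod 2)).1 h
    exact hno ⟨σ, hσ.symm⟩
  obtain ⟨f, hf1, hf2⟩ := Submodule.exists_le_ker_of_notMem hZ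
  have hbd : ∀ t ∈ T, f (bd t) = 0 := fun t ht =>
    hf2 (Submodule.subset_span ⟨t, ht, rfl⟩)
  obtain ⟨φ, hφ⟩ := hT.h1 (fun a b => f (Pi.single s(a, b) 1)) (fun a b => by rw [Sym2.eq_swap])
    (fun a b d h => by
      have := hbd _ h
      obtain ⟨h1, h2, h3⟩ := hT.ne h
      rwa [bd_eq h1 h2 h3, map_add, map_add] at this)
  apply hf1
  have h1 : f Z = ∑ e : Sym2 α, Z e * f (Pi.single e 1) := by
    conv_lhs => rw [← Finset.univ_sum_single Z]
    rw [map_sum]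
    refine Finset.sum_congr rfl fun e _ => ?_
    have : (Pi.single e (Z e) : Sym2 α → ZMod 2) = Z e • Pi.single e 1 := by
      rw [← Pi.single_smul]; simp
    rw [this, map_smul, smul_eq_mul]
  have h2 : ∀ e : Sym2 α, Z e * f (Pi.single e 1) = ∑ x, φ x * if x ∈ e then Z e else 0 := by
    intro e
    induction e using Sym2.ind with
    | _ a b =>
      by_cases h0 : Z s(a, b) = 0
      · simp [h0]
      · have hab := hs a b h0
        rw [hφ a b hab]
        have : ∀ x, (φ x * if x ∈ s(a, b) then Z s(a, b) else 0) =
            (if x = a then φ x * Z s(a, b) else 0) + if x = b then φ x * Z s(a, b) else 0 := by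
          intro x
          have := hab.1
          by_cases h1 : x = a <;> by_cases h2 : x = b <;> simp_all
        simp only [this, Finset.sum_add_distrib, Finset.sum_ite_eq', Finset.mem_univ, if_true]
        ring
  rw [h1, Finset.sum_congr rfl fun e _ => h2 e, Finset.sum_comm]
  refine Finset.sum_eq_zero fun x _ => ?_
  rw [← Finset.mul_sum]
  have := he x
  unfold deg2 at this
  rw [this, mul_zero]

theorem dual' (Z : Sym2 α → ZMod 2) (hs : ∀ a b, Z s(a, b) ≠ 0 → TEdge T a b)
    (he : ∀ a, deg2 Z a = 0) : ∃ σ : Finset α → ZMod 2, ∀ a b d d', d ≠ d' →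
      {a, b, d} ∈ T → {a, b, d'} ∈ T → Z s(a, b) = σ {a, b, d} + σ {a, b, d'} := by
  obtain ⟨σ, hσ⟩ := hT.dual Z hs he
  refine ⟨σ, fun a b d d' hne h1 h2 => ?_⟩
  rw [← hT.sum_bd σ h1 h2 hne, ← hσ]

end IsSphere

/-- In an even chain no vertex has exactly one edge. -/
theorem exists_other {Z : Sym2 α → ZMod 2} (he : ∀ a, deg2 Z a = 0) {a b : α}
    (h : Z s(a, b) ≠ 0) : ∃ d, d ≠ b ∧ Z s(a, d) ≠ 0 := by
  by_contra! hno
  apply h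
  have := he a
  unfold deg2 at this
  rw [Finset.sum_eq_single s(a, b)] at this
  · simpa using this
  · intro e _ hne
    split_ifs with hae
    · obtain ⟨d, rfl⟩ := hae
      exact hno d (fun hd => hne (by rw [hd]))
    · rfl
  · simp

end

/-! ### The 1-skeleton of a sphere has no `K₅` or `K₃,₃` minor -/

/-- Vectors modulo 2 covering every coordinate at most twice, with zero sum and large supports,
cannot span all unit vectors on `m` coordinates. -/
theorem false_of_sparse_span {Q I : Type*} [Fintype Q] [Fintype I] {m g : ℕ} (cl : Fin m → I)
    (x : Q → I → ZMod 2) (h2 : ∀ i, (Finset.univ.filter fun κ => x κ i ≠ 0).card ≤ 2)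
    (hz : ∀ i, ∑ κ, x κ i = 0)
    (hg : ∀ κ, (∃ i, x κ i ≠ 0) → g ≤ (Finset.univ.filter fun i => x κ i ≠ 0).card)
    (hσ : ∀ j, ∃ σ : Q → ZMod 2, ∀ i, ∑ κ, σ κ * x κ (cl i) = if i = j then 1 else 0)
    (hm : 0 < m) (hlt : 2 * Fintype.card I < g * (m + 1)) : False := by
  classical
  let N : Finset Q := Finset.univ.filter fun κ => ∃ i, x κ i ≠ 0
  have hN : ∀ κ, κ ∉ N → ∀ i, x κ i = 0 := by
    intro κ hκ i
    by_contra h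
    exact hκ (by simp only [N, Finset.mem_filter, Finset.mem_univ, true_and]; exact ⟨i, h⟩)
  have hcard : g * N.card ≤ 2 * Fintype.card I := by
    calc g * N.card = ∑ κ ∈ N, g := by simp [mul_comm]
      _ ≤ ∑ κ ∈ N, (Finset.univ.filter fun i => x κ i ≠ 0).card :=
        Finset.sum_le_sum fun κ hκ => hg κ (Finset.mem_filter.1 hκ).2
      _ ≤ ∑ κ, (Finset.univ.filter fun i => x κ i ≠ 0).card :=
        Finset.sum_le_sum_of_subset (Finset.subset_univ _)
      _ = ∑ i, (Finset.univ.filter fun κ => x κ i ≠ 0).card :=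
        Finset.sum_card_bipartiteAbove_eq_sum_card_bipartiteBelow _
      _ ≤ ∑ i : I, 2 := Finset.sum_le_sum fun i _ => h2 i
      _ = 2 * Fintype.card I := by simp [mul_comm]
  have hNm : N.card ≤ m := by
    by_contra h
    have : g * (m + 1) ≤ g * N.card := Nat.mul_le_mul_left _ (by omega)
    omega
  let L : (N → ZMod 2) →ₗ[ZMod 2] (Fin m → ZMod 2) :=
    { toFun := fun σ i => ∑ κ : N, σ κ * x κ (cl i)
      map_add' := by
        intro σ τ
        funext i
        simp [add_mul, Finset.sum_add_distrib]
      map_smul' := by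
        intro r σ
        funext i
        simp [Finset.mul_sum, mul_assoc] }
  have hsub : ∀ (σ : Q → ZMod 2) i, ∑ κ : N, σ κ * x κ i = ∑ κ, σ κ * x κ i := by
    intro σ i
    rw [Finset.sum_coe_sort N (fun κ => σ κ * x κ i)]
    exact Finset.sum_subset (Finset.subset_univ _) fun κ _ h => by rw [hN κ h, mul_zero]
  have hsurj : Function.Surjective L := by
    rw [← LinearMap.range_eq_top, eq_top_iff, ← (Pi.basisFun (ZMod 2) (Fin m)).span_eq,
      Submodule.span_le]
    rintro _ ⟨j, rfl⟩
    obtain ⟨σ, hσ⟩ := hσ j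
    refine ⟨fun κ => σ κ, ?_⟩
    funext i
    change ∑ κ : N, σ κ * x κ (cl i) = _
    rw [hsub, hσ]
    simp [Pi.single_apply]
  have hfr := LinearMap.finrank_le_finrank_of_surjective hsurj
  rw [Module.finrank_fintype_fun_eq_card, Module.finrank_fintype_fun_eq_card, Fintype.card_fin,
    Fintype.card_coe] at hfr
  have hinj : Function.Injective L := by
    rw [LinearMap.injective_iff_surjective_of_finrank_eq_finrank]
    · exact hsurj
    · rw [Module.finrank_fintype_fun_eq_card, Module.finrank_fintype_fun_eq_card,
        Fintype.card_fin, Fintype.card_coe]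
      omega
  have h1 : L (fun _ => 1) = L 0 := by
    rw [map_zero]
    funext i
    change ∑ κ : N, 1 * x κ (cl i) = 0
    rw [hsub (fun _ => 1)]
    simpa using hz (cl i)
  have h0 := hinj h1
  have : 0 < N.card := by omega
  obtain ⟨κ, hκ⟩ := Finset.card_pos.1 this
  have := congrFun h0 ⟨κ, hκ⟩
  simp at this

section

variable {α : Type*} [DecidableEq α] {T : Finset (Finset α)} [Fintype α]

omit [DecidableEq α] [Fintype α] in
theorem zmod2_ne_zero {x : ZMod 2} (h : x ≠ 0) : x = 1 := by
  revert x; decide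

theorem deg2_smul (r : ZMod 2) (Z : Sym2 α → ZMod 2) (a : α) :
    deg2 (r • Z) a = r * deg2 Z a := by
  unfold deg2
  rw [Finset.mul_sum]
  refine Finset.sum_congr rfl fun e _ => ?_
  split_ifs <;> simp

/-- Two vertices of a connected set are joined by a chain. -/
theorem exists_chain {G : SimpleGraph α} {S : Set α} (hS : Conn G S) {a b : α} (ha : a ∈ S) (hb : b ∈ S) :
    ∃ P : Sym2 α → ZMod 2, (∀ x y, P s(x, y) ≠ 0 → G.Adj x y ∧ x ∈ S ∧ y ∈ S) ∧
      ∀ v, deg2 P v = (Pi.single a 1 : α → ZMod 2) v + (Pi.single b 1 : α → ZMod 2) v := by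
  refine hS.2 {b | ∃ P : Sym2 α → ZMod 2, (∀ x y, P s(x, y) ≠ 0 → G.Adj x y ∧ x ∈ S ∧ y ∈ S) ∧
      ∀ v, deg2 P v = (Pi.single a 1 : α → ZMod 2) v + (Pi.single b 1 : α → ZMod 2) v}
      ⟨a, ha, 0, by simp, fun v => ?_⟩ ?_ hb
  · rw [zmod2_add_self]; simp [deg2]
  · rintro x hx ⟨P, hP1, hP2⟩ y hy hxy
    refine ⟨P + Pi.single s(x, y) 1, ?_, ?_⟩
    · intro u v huv
      by_cases h : P s(u, v) = 0
      · rw [Pi.add_apply, h, zero_add, Pi.single_apply] at huv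
        have : s(u, v) = s(x, y) := by
          by_contra h; simp [h] at huv
        rcases Sym2.eq_iff.1 this with ⟨rfl, rfl⟩ | ⟨rfl, rfl⟩
        · exact ⟨hxy, hx, hy⟩
        · exact ⟨hxy.symm, hy, hx⟩
      · exact hP1 u v h
    · intro v
      rw [deg2_add, hP2, deg2_single _ _ _ hxy.ne]
      generalize (Pi.single a 1 : α → ZMod 2) v = p
      generalize (Pi.single x 1 : α → ZMod 2) v = q
      generalize (Pi.single y 1 : α → ZMod 2) v = r
      revert p q r
      decide

end

universe u

open Classical in
/-- The cycle space of a minor of the 1-skeleton of a sphere has a sparse spanning family. -/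
theorem IsSphere.exists_sparse {α : Type u} [DecidableEq α] {T : Finset (Finset α)} [Fintype α]
    (hT : IsSphere T) {W I : Type*} [Fintype I] (f : W → Set α)
    (hf : ∀ w, Conn (tgraph T) (f w)) (hd : ∀ w w', w ≠ w' → Disjoint (f w) (f w'))
    (p q : I → W) (hpq : ∀ i, p i ≠ q i) (hI : ∀ i j, s(p i, q i) = s(p j, q j) → i = j)
    (ht : ∀ i, Touch (tgraph T) (f (p i)) (f (q i))) :
    ∃ (Q : Type u) (_ : Fintype Q) (x : Q → I → ZMod 2),
      (∀ i, (Finset.univ.filter fun κ => x κ i ≠ 0).card ≤ 2) ∧ (∀ i, ∑ κ, x κ i = 0) ∧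
      (∀ κ w, (∑ i, if w = p i ∨ w = q i then x κ i else 0) = 0) ∧
      ∀ J : I → ZMod 2, (∀ w, (∑ i, if w = p i ∨ w = q i then J i else 0) = 0) →
        ∃ σ : Q → ZMod 2, ∀ i, ∑ κ, σ κ * x κ i = J i := by
  choose a ha b hb hab using ht
  have hab : ∀ i, TEdge T (a i) (b i) := hab
  have huniq : ∀ {v w w'}, v ∈ f w → v ∈ f w' → w = w' := by
    intro v w w' h h'
    by_contra hne
    exact Set.disjoint_left.1 (hd _ _ hne) h h'
  let l : I → Sym2 α := fun i => s(a i, b i)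
  have hl : Function.Injective l := by
    intro i j hij
    apply hI
    rcases Sym2.eq_iff.1 hij with ⟨h1, h2⟩ | ⟨h1, h2⟩
    · rw [huniq (ha i) (h1 ▸ ha j), huniq (hb i) (h2 ▸ hb j)]
    · rw [huniq (ha i) (h1 ▸ hb j), huniq (hb i) (h2 ▸ ha j), Sym2.eq_swap]
  let Y : α → α → Prop := fun u v => (∃ w, u ∈ f w ∧ v ∈ f w) ∨ ∃ i, s(u, v) = l i
  let rel : {t // t ∈ T} → {t // t ∈ T} → Prop := fun t t' =>
    ∃ u v d d', t.1 = {u, v, d} ∧ t'.1 = {u, v, d'} ∧ ¬ Y u v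
  let ind : Quot rel → Finset α → ZMod 2 := fun κ t =>
    if ∃ h : t ∈ T, Quot.mk rel ⟨t, h⟩ = κ then 1 else 0
  let Z : Quot rel → Sym2 α → ZMod 2 := fun κ => ∑ t ∈ T, ind κ t • bd t
  have hind : ∀ κ t (h : t ∈ T), ind κ t = if Quot.mk rel ⟨t, h⟩ = κ then 1 else 0 := by
    intro κ t h
    simp [ind, h]
  have hZdeg : ∀ κ v, deg2 (Z κ) v = 0 := by
    intro κ v
    rw [deg2_sum]
    exact Finset.sum_eq_zero fun t ht => by rw [deg2_smul, deg2_bd (hT.card t ht), mul_zero]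
  have hZedge : ∀ κ u v, Z κ s(u, v) ≠ 0 → TEdge T u v := by
    intro κ u v h
    simp only [Z, Finset.sum_apply] at h
    obtain ⟨t, ht, h⟩ := Finset.exists_ne_zero_of_sum_ne_zero h
    rw [Pi.smul_apply, bd_mk] at h
    have : u ∈ t ∧ v ∈ t ∧ u ≠ v := by
      by_contra hn; simp [hn] at h
    exact ⟨this.2.2, t, ht, this.1, this.2.1⟩
  have hZval : ∀ κ u v d d', d ≠ d' → ∀ (h : {u, v, d} ∈ T) (h' : {u, v, d'} ∈ T),
      Z κ s(u, v) = (if Quot.mk rel ⟨_, h⟩ = κ then 1 else 0) +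
        if Quot.mk rel ⟨_, h'⟩ = κ then 1 else 0 := by
    intro κ u v d d' hne h h'
    rw [← hind, ← hind]
    exact hT.sum_bd _ h h' hne
  have hZY : ∀ κ u v, Z κ s(u, v) ≠ 0 → Y u v := by
    intro κ u v h
    by_contra hY
    obtain ⟨d, d', hne, h1, h2, -⟩ := hT.exists_two (hZedge κ u v h)
    apply h
    rw [hZval κ u v d d' hne h1 h2, Quot.sound (r := rel) (a := ⟨_, h1⟩) (b := ⟨_, h2⟩)
      ⟨u, v, d, d', rfl, rfl, hY⟩, zmod2_add_self]
  have : Finite (Quot rel) := Quot.finite rel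
  let _ : Fintype (Quot rel) := Fintype.ofFinite _
  refine ⟨Quot rel, inferInstance, fun κ i => Z κ (l i), ?_, ?_, ?_, ?_⟩
  · intro i
    obtain ⟨d, d', hne, h1, h2, -⟩ := hT.exists_two (hab i)
    refine (Finset.card_le_card (t := {Quot.mk rel ⟨_, h1⟩, Quot.mk rel ⟨_, h2⟩}) ?_).trans
      Finset.card_le_two
    intro κ hκ
    simp only [Finset.mem_filter, Finset.mem_univ, true_and, l] at hκ
    rw [hZval κ _ _ d d' hne h1 h2] at hκ
    simp only [Finset.mem_insert, Finset.mem_singleton]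
    by_contra! hn
    rw [if_neg (Ne.symm hn.1), if_neg (Ne.symm hn.2)] at hκ
    simp at hκ
  · intro i
    obtain ⟨d, d', hne, h1, h2, -⟩ := hT.exists_two (hab i)
    simp only [l, hZval _ _ _ d d' hne h1 h2, Finset.sum_add_distrib, Finset.sum_ite_eq,
      Finset.mem_univ, if_true]
    exact zmod2_add_self 1
  · intro κ w
    have h0 : ∑ v : α, (if v ∈ f w then deg2 (Z κ) v else 0) = 0 :=
      Finset.sum_eq_zero fun v _ => by rw [hZdeg]; simp
    let g : Sym2 α → ZMod 2 := fun e => ∑ v : α, if v ∈ f w ∧ v ∈ e then Z κ e else 0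
    have h1 : ∑ v : α, (if v ∈ f w then deg2 (Z κ) v else 0) = ∑ e, g e := by
      simp only [g]
      rw [Finset.sum_comm]
      refine Finset.sum_congr rfl fun v _ => ?_
      by_cases hv : v ∈ f w <;> simp [hv, deg2]
    have hg : ∀ u v, u ≠ v → g s(u, v) = (if u ∈ f w then Z κ s(u, v) else 0) +
        if v ∈ f w then Z κ s(u, v) else 0 := by
      intro u v huv
      have : ∀ y, (if y ∈ f w ∧ y ∈ s(u, v) then Z κ s(u, v) else 0) =
          (if y = u then (if u ∈ f w then Z κ s(u, v) else 0) else 0) +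
          if y = v then (if v ∈ f w then Z κ s(u, v) else 0) else 0 := by
        intro y
        by_cases h1 : y = u
        · subst h1
          simp [huv]
        · by_cases h2 : y = v
          · subst h2
            simp [Ne.symm huv]
          · simp [h1, h2]
      simp only [g, this, Finset.sum_add_distrib, Finset.sum_ite_eq', Finset.mem_univ, if_true]
    refine Eq.trans ?_ (h1.symm.trans h0)
    refine Finset.sum_of_injOn l hl.injOn (by simp) ?_ ?_
    · intro e _ he
      induction e using Sym2.ind with
      | _ u v =>
        by_cases hne : Z κ s(u, v) = 0
        · simp [g, hne]
        · rw [hg u v (hZedge κ u v hne).1]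
          rcases hZY κ u v hne with ⟨w', hu, hv⟩ | ⟨i, hi⟩
          · by_cases hw : w = w'
            · subst hw
              simp [hu, hv, zmod2_add_self]
            · have hu' : u ∉ f w := fun h => hw (huniq h hu)
              have hv' : v ∉ f w := fun h => hw (huniq h hv)
              simp [hu', hv']
          · exact absurd ⟨i, by simp, hi.symm⟩ he
    · intro i _
      rw [hg _ _ (hab i).1]
      have k1 : a i ∈ f w ↔ w = p i := ⟨fun h => huniq h (ha i), fun h => h ▸ ha i⟩
      have k2 : b i ∈ f w ↔ w = q i := ⟨fun h => huniq h (hb i), fun h => h ▸ hb i⟩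
      simp only [k1, k2]
      by_cases h1 : w = p i <;> by_cases h2 : w = q i
      · exact absurd (h1.symm.trans h2) (hpq i)
      all_goals simp [h1, h2, l]
      · simp [hpq i]
      · simp [Ne.symm (hpq i)]
  · intro J hJ
    have hbase : ∀ w, ∃ v, v ∈ f w := fun w => (hf w).1
    choose r hr using hbase
    choose P hP1 hP2 using fun i => exists_chain (hf (p i)) (ha i) (hr (p i))
    choose P' hP1' hP2' using fun i => exists_chain (hf (q i)) (hb i) (hr (q i))
    let E : Sym2 α → ZMod 2 := ∑ i, J i • (Pi.single (l i) 1 + (P i + P' i))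
    have hEl : ∀ j, E (l j) = J j := by
      intro j
      simp only [E, Finset.sum_apply]
      rw [Finset.sum_eq_single j]
      · have h1 : P j (l j) = 0 := by
          by_contra h
          exact hpq j (huniq (hP1 j _ _ h).2.2 (hb j))
        have h2 : P' j (l j) = 0 := by
          by_contra h
          exact hpq j (huniq (ha j) (hP1' j _ _ h).2.1)
        simp [h1, h2]
      · intro i _ hij
        have h1 : P i (l j) = 0 := by
          by_contra h
          have := hP1 i _ _ h
          exact hpq j (by rw [huniq (ha j) this.2.1, huniq (hb j) this.2.2])
        have h2 : P' i (l j) = 0 := by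
          by_contra h
          have := hP1' i _ _ h
          exact hpq j (by rw [huniq (ha j) this.2.1, huniq (hb j) this.2.2])
        have h3 : l j ≠ l i := fun h => hij (hl h).symm
        simp [h1, h2, h3]
      · simp
    have hEY : ∀ u v, E s(u, v) ≠ 0 → TEdge T u v ∧ Y u v := by
      intro u v h
      simp only [E, Finset.sum_apply] at h
      obtain ⟨i, -, h⟩ := Finset.exists_ne_zero_of_sum_ne_zero h
      by_cases h1 : P i s(u, v) = 0
      · by_cases h2 : P' i s(u, v) = 0
        · have : s(u, v) = l i := by
            by_contra h3
            simp [h1, h2, h3] at h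
          refine ⟨?_, Or.inr ⟨i, this⟩⟩
          rcases Sym2.eq_iff.1 this with ⟨rfl, rfl⟩ | ⟨rfl, rfl⟩
          · exact hab i
          · exact (hab i).symm
        · have := hP1' i _ _ h2
          exact ⟨this.1, Or.inl ⟨_, this.2⟩⟩
      · have := hP1 i _ _ h1
        exact ⟨this.1, Or.inl ⟨_, this.2⟩⟩
    have hEdeg : ∀ v, deg2 E v = 0 := by
      intro v
      have h1 : ∀ i, deg2 (J i • (Pi.single (l i) 1 + (P i + P' i))) v =
          (if v = r (p i) then J i else 0) + if v = r (q i) then J i else 0 := by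
        intro i
        rw [deg2_smul, deg2_add, deg2_add, hP2, hP2', deg2_single _ _ _ (hab i).1]
        have : (if v = r (p i) then J i else 0) + (if v = r (q i) then J i else 0) =
          J i * ((Pi.single (r (p i)) 1 : α → ZMod 2) v +
            (Pi.single (r (q i)) 1 : α → ZMod 2) v) := by
          simp [Pi.single_apply, mul_add]
        rw [this]
        congr 1
        generalize (Pi.single (a i) 1 : α → ZMod 2) v = x1
        generalize (Pi.single (b i) 1 : α → ZMod 2) v = x2
        generalize (Pi.single (r (p i)) 1 : α → ZMod 2) v = x3
        generalize (Pi.single (r (q i)) 1 : α → ZMod 2) v = x4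
        revert x1 x2 x3 x4
        decide
      rw [deg2_sum, Finset.sum_congr rfl fun i _ => h1 i]
      by_cases hv : ∃ w, v = r w
      · obtain ⟨w, rfl⟩ := hv
        have hrinj : ∀ w', r w = r w' ↔ w = w' :=
          fun w' => ⟨fun h => huniq (hr w) (h ▸ hr w'), fun h => h ▸ rfl⟩
        refine Eq.trans ?_ (hJ w)
        refine Finset.sum_congr rfl fun i _ => ?_
        simp only [hrinj]
        have := hpq i
        by_cases h1 : w = p i <;> by_cases h2 : w = q i
        · exact absurd (h1.symm.trans h2) (hpq i)
        all_goals simp [h1, h2]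
        · simp [hpq i]
        · simp [Ne.symm (hpq i)]
      · push Not at hv
        simp [hv]
    obtain ⟨σ, hσ⟩ := hT.dual' E (fun u v h => (hEY u v h).1) hEdeg
    have hrel : ∀ t t', rel t t' → σ t.1 = σ t'.1 := by
      rintro ⟨t, ht⟩ ⟨t', ht'⟩ ⟨u, v, d, d', rfl, rfl, hY⟩
      by_cases hdd : d = d'
      · subst hdd; rfl
      · have := hσ u v d d' hdd ht ht'
        have h0 : E s(u, v) = 0 := by
          by_contra h
          exact hY (hEY u v h).2
        rw [h0] at this
        exact (CharTwo.add_eq_zero.1 this.symm)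
    refine ⟨Quot.lift (fun t => σ t.1) hrel, fun i => ?_⟩
    obtain ⟨d, d', hne, h1, h2, -⟩ := hT.exists_two (hab i)
    simp only [l, hZval _ _ _ d d' hne h1 h2, mul_add, mul_ite, mul_one, mul_zero,
      Finset.sum_add_distrib, Finset.sum_ite_eq, Finset.mem_univ, if_true]
    rw [← hσ _ _ d d' hne h1 h2]
    exact hEl i

theorem IsSphere.no_model {α : Type*} [DecidableEq α] {T : Finset (Finset α)} [Fintype α]
    (hT : IsSphere T) {W : Type*} [DecidableEq W] {K : SimpleGraph W} {s : Set α}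
    {n m : ℕ} (g : ℕ) (p q : Fin n → W)
    (hK : ∀ i, K.Adj (p i) (q i)) (hI : ∀ i j, s(p i, q i) = s(p j, q j) → i = j)
    (cl : Fin m → Fin n) (J : Fin m → Fin n → ZMod 2)
    (hJ : ∀ j w, (∑ i, if w = p i ∨ w = q i then J j i else 0) = 0)
    (hJcl : ∀ j i, J j (cl i) = if i = j then 1 else 0)
    (hg : ∀ x : Fin n → ZMod 2, (∀ w, (∑ i, if w = p i ∨ w = q i then x i else 0) = 0) →
      (∃ i, x i ≠ 0) → g ≤ (Finset.univ.filter fun i => x i ≠ 0).card)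
    (hm : 0 < m) (hlt : 2 * n < g * (m + 1)) : ¬ MinorIn K (tgraph T) s := by
  rintro ⟨f, h1, h2, h3⟩
  obtain ⟨Q, _, x, hx1, hx2, hx3, hx4⟩ := hT.exists_sparse f (fun w => (h1 w).1) h2 p q
    (fun i => (hK i).ne) hI (fun i => h3 _ _ (hK i))
  refine false_of_sparse_span (g := g) cl x hx1 hx2 (fun κ h => hg (x κ) (fun w => ?_) h) ?_ hm
    (by simpa using hlt)
  · convert hx3 κ w
  · intro j
    obtain ⟨σ, hσ⟩ := hx4 (J j) (fun w => by convert hJ j w)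
    exact ⟨σ, fun i => by rw [hσ, hJcl]⟩

set_option maxRecDepth 100000 in
set_option synthInstance.maxHeartbeats 400000 in
set_option synthInstance.maxSize 10000 in
set_option maxHeartbeats 1000000 in
theorem K33_even_support : ∀ a b c d e f g h i : ZMod 2, a + (b + c) = 0 → d + (e + f) = 0 →
    g + (h + i) = 0 → a + (d + g) = 0 → b + (e + h) = 0 → c + (f + i) = 0 →
    (a ≠ 0 ∨ b ≠ 0 ∨ c ≠ 0 ∨ d ≠ 0 ∨ e ≠ 0 ∨ f ≠ 0 ∨ g ≠ 0 ∨ h ≠ 0 ∨ i ≠ 0) →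
    4 ≤ a.val + (b.val + (c.val + (d.val + (e.val + (f.val + (g.val + (h.val + i.val))))))) := by
  decide

set_option maxRecDepth 100000 in
set_option synthInstance.maxHeartbeats 400000 in
set_option synthInstance.maxSize 10000 in
set_option maxHeartbeats 1000000 in
theorem K5_even_support : ∀ a b c d e f g h i j : ZMod 2, a + (b + (c + d)) = 0 →
    a + (e + (f + g)) = 0 → b + (e + (h + i)) = 0 → c + (f + (h + j)) = 0 →
    d + (g + (i + j)) = 0 →
    (a ≠ 0 ∨ b ≠ 0 ∨ c ≠ 0 ∨ d ≠ 0 ∨ e ≠ 0 ∨ f ≠ 0 ∨ g ≠ 0 ∨ h ≠ 0 ∨ i ≠ 0 ∨ j ≠ 0) →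
    3 ≤ a.val + (b.val + (c.val + (d.val + (e.val + (f.val + (g.val + (h.val + (i.val +
      j.val)))))))) := by
  decide

theorem zmod2_val (x : ZMod 2) : (if x = 0 then 0 else 1) = x.val := by
  revert x; decide

theorem IsSphere.pl {α : Type*} [DecidableEq α] {T : Finset (Finset α)} [Fintype α]
    (hT : IsSphere T) (s : Set α) : Pl (tgraph T) s := by
  constructor
  · refine hT.no_model 3 ![0, 0, 0, 0, 1, 1, 1, 2, 2, 3] ![1, 2, 3, 4, 2, 3, 4, 3, 4, 4] ?_ ?_
      ![4, 5, 6, 7, 8, 9] ![![1, 1, 0, 0, 1, 0, 0, 0, 0, 0], ![1, 0, 1, 0, 0, 1, 0, 0, 0, 0],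
        ![1, 0, 0, 1, 0, 0, 1, 0, 0, 0], ![0, 1, 1, 0, 0, 0, 0, 1, 0, 0],
        ![0, 1, 0, 1, 0, 0, 0, 0, 1, 0], ![0, 0, 1, 1, 0, 0, 0, 0, 0, 1]] ?_ ?_ ?_
      (by norm_num) (by norm_num)
    · decide
    · decide
    · decide
    · decide
    · intro x hx hne
      have h0 := hx 0
      have h1 := hx 1
      have h2 := hx 2
      have h3 := hx 3
      have h4 := hx 4
      rw [Finset.card_filter]
      simp [Fin.sum_univ_succ, Fin.exists_fin_succ, zmod2_val] at h0 h1 h2 h3 h4 hne ⊢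
      exact K5_even_support _ _ _ _ _ _ _ _ _ _ h0 h1 h2 h3 h4 hne
  · refine hT.no_model 4 ![.inl 0, .inl 0, .inl 0, .inl 1, .inl 1, .inl 1, .inl 2, .inl 2, .inl 2]
      ![.inr 0, .inr 1, .inr 2, .inr 0, .inr 1, .inr 2, .inr 0, .inr 1, .inr 2] ?_ ?_
      ![4, 5, 7, 8] ![![1, 1, 0, 1, 1, 0, 0, 0, 0], ![1, 0, 1, 1, 0, 1, 0, 0, 0],
        ![1, 1, 0, 0, 0, 0, 1, 1, 0], ![1, 0, 1, 0, 0, 0, 1, 0, 1]] ?_ ?_ ?_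
      (by norm_num) (by norm_num)
    · intro i
      fin_cases i <;> simp [K33]
    · decide
    · decide
    · decide
    · intro x hx hne
      have h0 := hx (.inl 0)
      have h1 := hx (.inl 1)
      have h2 := hx (.inl 2)
      have h3 := hx (.inr 0)
      have h4 := hx (.inr 1)
      have h5 := hx (.inr 2)
      rw [Finset.card_filter]
      simp [Fin.sum_univ_succ, Fin.exists_fin_succ, zmod2_val] at h0 h1 h2 h3 h4 h5 hne ⊢
      exact K33_even_support _ _ _ _ _ _ _ _ _ h0 h1 h2 h3 h4 h5 hne

/-! ### Separation in combinatorial spheres -/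

section

variable {α : Type*} [DecidableEq α] {T : Finset (Finset α)}

/-- `ab` lies in a triangle satisfying `P` and in one not satisfying `P`. -/
def Bd (T : Finset (Finset α)) (P : Finset α → Prop) (a b : α) : Prop :=
  ∃ d d', {a, b, d} ∈ T ∧ {a, b, d'} ∈ T ∧ P {a, b, d} ∧ ¬ P {a, b, d'}

theorem Bd.symm {P : Finset α → Prop} {a b : α} (h : Bd T P a b) : Bd T P b a := by
  obtain ⟨d, d', h1, h2, h3, h4⟩ := h
  rw [insert_swap] at h1 h2 h3 h4
  exact ⟨d, d', h1, h2, h3, h4⟩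

/-- The vertex set of `T`. -/
def verts (T : Finset (Finset α)) : Set α := {v | ∃ t ∈ T, v ∈ t}

theorem TEdge.left {a b : α} (h : TEdge T a b) : a ∈ verts T := by
  obtain ⟨_, t, ht, ha, _⟩ := h
  exact ⟨t, ht, ha⟩

theorem TEdge.right {a b : α} (h : TEdge T a b) : b ∈ verts T := h.symm.left

namespace IsSphere

variable (hT : IsSphere T)
include hT

theorem tedge_of_bd {P : Finset α → Prop} {a b : α} (h : Bd T P a b) : TEdge T a b := by
  obtain ⟨d, _, h1, _⟩ := h
  exact hT.tedge h1

theorem exists_bd {P : Finset α → Prop} (h1 : ∃ t ∈ T, P t) (h2 : ∃ t ∈ T, ¬ P t) :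
    ∃ a b, Bd T P a b := by
  by_contra! hno
  obtain ⟨t, ht, hPt⟩ := h2
  refine hPt (hT.strong P h1 ?_ t ht)
  intro a b d d' h h' hP
  by_contra hP'
  exact hno a b ⟨d, d', h, h', hP, hP'⟩

theorem exists_tri_of_mem {v : α} (h : v ∈ verts T) : ∃ a b, {v, a, b} ∈ T := by
  obtain ⟨t, ht, hv⟩ := h
  have : ∃ a ∈ t, a ≠ v := by
    by_contra! hno
    have h3 := hT.card t ht
    have : t ⊆ {v} := fun x hx => by simpa using hno x hx
    have := Finset.card_le_card this
    simp at this
    omega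
  obtain ⟨a, ha, hav⟩ := this
  obtain ⟨b, rfl⟩ := eq_of_mem3 (hT.card t ht) hav.symm hv ha
  exact ⟨a, b, ht⟩

open Classical in
theorem exists_other_bd [Fintype α] {P : Finset α → Prop} {a b : α} (h : Bd T P a b) :
    ∃ e, e ≠ b ∧ Bd T P a e := by
  let σ : Finset α → ZMod 2 := fun t => if P t then 1 else 0
  let Z : Sym2 α → ZMod 2 := ∑ t ∈ T, σ t • bd t
  have hZ : ∀ v, deg2 Z v = 0 := by
    intro v
    rw [deg2_sum]
    exact Finset.sum_eq_zero fun t ht => by rw [deg2_smul, deg2_bd (hT.card t ht), mul_zero]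
  have hab : Z s(a, b) ≠ 0 := by
    obtain ⟨d, d', h1, h2, h3, h4⟩ := h
    have hne : d ≠ d' := by rintro rfl; exact h4 h3
    rw [show Z s(a, b) = _ from hT.sum_bd σ h1 h2 hne]
    simp [σ, h3, h4]
  obtain ⟨e, he, hae⟩ := exists_other hZ hab
  refine ⟨e, he, ?_⟩
  have hT' : TEdge T a e := by
    simp only [Z, Finset.sum_apply] at hae
    obtain ⟨t, ht, h⟩ := Finset.exists_ne_zero_of_sum_ne_zero hae
    rw [Pi.smul_apply, bd_mk] at h
    have : a ∈ t ∧ e ∈ t ∧ a ≠ e := by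
      by_contra hn; simp [hn] at h
    exact ⟨this.2.2, t, ht, this.1, this.2.1⟩
  obtain ⟨d, d', hne, h1, h2, -⟩ := hT.exists_two hT'
  rw [show Z s(a, e) = _ from hT.sum_bd σ h1 h2 hne] at hae
  by_cases k1 : P {a, e, d} <;> by_cases k2 : P {a, e, d'}
  · simp [σ, k1, k2] at hae
    exact absurd (zmod2_add_self 1) hae
  · exact ⟨d, d', h1, h2, k1, k2⟩
  · exact ⟨d', d, h2, h1, k2, k1⟩
  · simp [σ, k1, k2] at hae

/-- Edges on the boundary of the star of `A` avoid `A` and are joined to `A`. -/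
theorem bd_star {A : Set α} {a b : α} (h : Bd T (fun t => ∃ x ∈ A, x ∈ t) a b) :
    a ∉ A ∧ b ∉ A ∧ ∃ d ∈ A, TEdge T a d ∧ TEdge T b d := by
  obtain ⟨d, d', h1, h2, ⟨x, hx, hxt⟩, h4⟩ := h
  have ha : a ∉ A := fun h => h4 ⟨a, h, by simp⟩
  have hb : b ∉ A := fun h => h4 ⟨b, h, by simp⟩
  have : x = d := by
    simp only [Finset.mem_insert, Finset.mem_singleton] at hxt
    rcases hxt with rfl | rfl | rfl
    · exact absurd hx ha
    · exact absurd hx hb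
    · rfl
  subst this
  exact ⟨ha, hb, x, hx, (hT.tedge' h1).2.2, (hT.tedge' h1).2.1⟩

/-- If every triangle of the 1-skeleton is in `T`, then the 1-skeleton is 4-connected. -/
theorem four_conn [Fintype α]
    (hF : ∀ a b d, TEdge T a b → TEdge T b d → TEdge T a d → {a, b, d} ∈ T)
    {A : Set α} (hA : ∃ a ∈ A, a ∈ verts T) {b₀ : α} (hb₀ : b₀ ∈ verts T) (hb₀A : b₀ ∉ A)
    (hb₀N : ∀ a ∈ A, ¬ TEdge T a b₀) (x y z : α) :
    ∃ v, v ∉ A ∧ (∃ a ∈ A, TEdge T a v) ∧ v ≠ x ∧ v ≠ y ∧ v ≠ z := by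
  by_contra! hno
  let P : Finset α → Prop := fun t => ∃ x ∈ A, x ∈ t
  have hN : ∀ v, v ∉ A → (∃ a ∈ A, TEdge T a v) → v = x ∨ v = y ∨ v = z := by
    intro v h1 h2
    have := hno v h1 h2
    tauto
  have hBN : ∀ a b, Bd T P a b → a ∉ A ∧ (a = x ∨ a = y ∨ a = z) := by
    intro a b h
    obtain ⟨h1, _, d, hd, h2, _⟩ := hT.bd_star h
    exact ⟨h1, hN a h1 ⟨d, hd, h2.symm⟩⟩
  obtain ⟨p, q, hp⟩ := hT.exists_tri_of_mem hb₀
  have hPb : ¬ P {b₀, p, q} := by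
    rintro ⟨a, ha, hat⟩
    simp only [Finset.mem_insert, Finset.mem_singleton] at hat
    rcases hat with rfl | rfl | rfl
    · exact hb₀A ha
    · exact hb₀N _ ha (hT.tedge' hp).1.symm
    · exact hb₀N _ ha (hT.tedge' hp).2.2.symm
  obtain ⟨a, b, hab⟩ := hT.exists_bd (P := P) (by
    obtain ⟨a, ha, t, ht, hat⟩ := hA
    exact ⟨t, ht, a, ha, hat⟩) ⟨_, hp, hPb⟩
  obtain ⟨e, heb, hae⟩ := hT.exists_other_bd hab
  obtain ⟨e', hea, hbe⟩ := hT.exists_other_bd hab.symm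
  have n1 := (hT.tedge_of_bd hab).1
  have n2 := (hT.tedge_of_bd hae).1
  have n3 := (hT.tedge_of_bd hbe).1
  have m1 := hBN _ _ hab
  have m2 := hBN _ _ hab.symm
  have m3 := hBN _ _ hae.symm
  have m4 := hBN _ _ hbe.symm
  have : e' = e := by grind
  subst this
  have hS := hF a b e' (hT.tedge_of_bd hab) (hT.tedge_of_bd hbe) (hT.tedge_of_bd hae)
  have hSP : ¬ P {a, b, e'} := by
    rintro ⟨u, hu, hut⟩
    simp only [Finset.mem_insert, Finset.mem_singleton] at hut
    rcases hut with rfl | rfl | rfl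
    · exact m1.1 hu
    · exact m2.1 hu
    · exact m3.1 hu
  have hfin := hT.strong (fun t => P t ∨ t = {a, b, e'}) ⟨_, hS, Or.inr rfl⟩ (by
    intro u v d d' h h' hP
    by_contra hP'
    push Not at hP'
    have huv := (hT.ne h).1
    rcases hP with hP | hP
    · have hbd : Bd T P u v := ⟨d, d', h, h', hP, hP'.1⟩
      have k1 := hBN _ _ hbd
      have k2 := hBN _ _ hbd.symm
      have : ∃ r, ({a, b, e'} : Finset α) = {u, v, r} := by
        refine eq_of_mem3 (hT.card _ hS) huv ?_ ?_ <;>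
        · simp only [Finset.mem_insert, Finset.mem_singleton]
          grind
      obtain ⟨r, hr⟩ := this
      rw [hr] at hS hSP hP'
      have hrd : r ≠ d := by rintro rfl; exact hSP hP
      have hrd' : r ≠ d' := by rintro rfl; exact hP'.2 rfl
      have hdd : d ≠ d' := by rintro rfl; exact hP'.1 hP
      rcases hT.third h h' hdd hS with h | h
      · exact hrd h
      · exact hrd' h
    · rw [← hP] at hSP hP'
      have hu : u ∈ ({a, b, e'} : Finset α) := by rw [← hP]; simp
      have hv : v ∈ ({a, b, e'} : Finset α) := by rw [← hP]; simp
      have hbd : Bd T P u v := by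
        simp only [Finset.mem_insert, Finset.mem_singleton] at hu hv
        rcases hu with rfl | rfl | rfl <;> rcases hv with rfl | rfl | rfl
        · exact absurd rfl huv
        · exact hab
        · exact hae
        · exact hab.symm
        · exact absurd rfl huv
        · exact hbe
        · exact hae.symm
        · exact hbe.symm
        · exact absurd rfl huv
      obtain ⟨w, w', hw, hw', k1, k2⟩ := hbd
      have hdd : d ≠ d' := by rintro rfl; exact hP'.2 rfl
      rcases hT.third h h' hdd hw with rfl | rfl
      · exact hSP k1
      · exact hP'.1 k1) _ hp
  rcases hfin with h | h
  · exact hPb h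
  · have : b₀ ∈ ({a, b, e'} : Finset α) := by rw [← h]; simp
    have hbN : ∀ v w, Bd T P v w → v ≠ b₀ := by
      intro v w hvw hv
      obtain ⟨_, _, d, hd, h1, _⟩ := hT.bd_star (A := A) hvw
      rw [hv] at h1
      exact hb₀N d hd h1.symm
    simp only [Finset.mem_insert, Finset.mem_singleton] at this
    rcases this with h | h | h
    · exact hbN _ _ hab h.symm
    · exact hbN _ _ hab.symm h.symm
    · exact hbN _ _ hae.symm h.symm

/-- If every triangle of the 1-skeleton is in `T`, the non-neighbours of a vertex are connected. -/
theorem conn_non_nbrs [Fintype α]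
    (hF : ∀ a b d, TEdge T a b → TEdge T b d → TEdge T a d → {a, b, d} ∈ T)
    {u r : α} (hr : r ∈ verts T) (hru : r ≠ u) (hur : ¬ TEdge T u r) :
    Conn (tgraph T) {v | v ∈ verts T ∧ v ≠ u ∧ ¬ TEdge T u v} := by
  refine ⟨⟨r, hr, hru, hur⟩, ?_⟩
  rintro C ⟨a₀, ha₀, ha₀C⟩ hC b₀ hb₀
  by_contra hb₀C
  let A : Set α := {v | (v ∈ verts T ∧ v ≠ u ∧ ¬ TEdge T u v) ∧ v ∈ C}
  let P : Finset α → Prop := fun t => ∃ x ∈ A, x ∈ t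
  have hBN : ∀ a b, Bd T P a b → TEdge T u a := by
    intro a b h
    obtain ⟨h1, _, d, hd, h2, _⟩ := hT.bd_star h
    by_contra h3
    have hau : a ≠ u := by
      rintro rfl
      exact hd.1.2.2 h2
    have : a ∈ C := hC d hd.1 hd.2 a ⟨h2.left, hau, h3⟩ h2.symm
    exact h1 ⟨⟨h2.left, hau, h3⟩, this⟩
  obtain ⟨p, q, hp⟩ := hT.exists_tri_of_mem hb₀.1
  have hPb : ¬ P {b₀, p, q} := by
    rintro ⟨a, ha, hat⟩
    simp only [Finset.mem_insert, Finset.mem_singleton] at hat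
    rcases hat with rfl | rfl | rfl
    · exact hb₀C ha.2
    · exact hb₀C (hC _ ha.1 ha.2 b₀ hb₀ (hT.tedge' hp).1.symm)
    · exact hb₀C (hC _ ha.1 ha.2 b₀ hb₀ (hT.tedge' hp).2.2.symm)
  have hPu : ∀ v w, ¬ (P {u, v, w} ∧ {u, v, w} ∈ T) := by
    rintro v w ⟨⟨a, ha, hat⟩, h⟩
    simp only [Finset.mem_insert, Finset.mem_singleton] at hat
    rcases hat with rfl | rfl | rfl
    · exact ha.1.2.1 rfl
    · exact ha.1.2.2 (hT.tedge' h).1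
    · exact ha.1.2.2 (hT.tedge' h).2.2
  have hcone : ∀ a b, Bd T P a b → {u, a, b} ∈ T := fun a b h =>
    hF u a b (hBN a b h) (hT.tedge_of_bd h) (hBN b a h.symm)
  have hfin := hT.strong (fun t => P t ∨ ∃ a b, Bd T P a b ∧ t = {u, a, b}) (by
    obtain ⟨t, ht, hat⟩ := ha₀.1
    exact ⟨t, ht, Or.inl ⟨a₀, ⟨ha₀, ha₀C⟩, hat⟩⟩) (by
    have hside : ∀ x y d d', {x, y, d} ∈ T → {x, y, d'} ∈ T → P {x, y, d} → ¬ P {x, y, d'} →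
        ({x, y, d'} : Finset α) = {u, x, y} := by
      intro x y d d' h h' hP hP'
      have hbd : Bd T P x y := ⟨d, d', h, h', hP, hP'⟩
      have hc := hcone x y hbd
      rw [insert_rot] at hc
      have hdd : d ≠ d' := by rintro rfl; exact hP' hP
      rcases hT.third h h' hdd hc with h1 | h1
      · subst h1
        rw [← insert_rot] at h hP
        exact absurd ⟨hP, h⟩ (hPu x y)
      · rw [h1, insert_rot d' x y]
    rintro x y d d' h h' (hP | ⟨a, b, hab, hP⟩)
    · by_cases hP' : P {x, y, d'}
      · exact Or.inl hP'
      · exact Or.inr ⟨x, y, ⟨d, d', h, h', hP, hP'⟩, hside x y d d' h h' hP hP'⟩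
    · by_cases hdd : d = d'
      · subst hdd
        exact Or.inr ⟨a, b, hab, hP⟩
      have hxy := (hT.ne h).1
      have hu : u ∈ ({x, y, d} : Finset α) := by rw [hP]; simp
      have hstar : ∀ a b d', Bd T P a b → {u, a, d'} ∈ T → Bd T P a d' := by
        intro a b d' hab had
        obtain ⟨e, heb, hae⟩ := hT.exists_other_bd hab
        rcases hT.third (hcone a b hab) (hcone a e hae) (Ne.symm heb) had with rfl | rfl
        · exact hab
        · exact hae
      have huxy : u = x ∨ u = y ∨ u = d := by simpa using hu
      have habu := hT.ne (hcone a b hab)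
      have hx : x = u ∨ x = a ∨ x = b := by
        have : x ∈ ({u, a, b} : Finset α) := by rw [← hP]; simp
        simpa using this
      have hy : y = u ∨ y = a ∨ y = b := by
        have : y ∈ ({u, a, b} : Finset α) := by rw [← hP]; simp
        simpa using this
      rcases hx with hx | hx | hx <;> rcases hy with hy | hy | hy <;> subst hx <;> subst hy
      · exact absurd rfl hxy
      · exact Or.inr ⟨y, d', hstar _ _ _ hab h', rfl⟩
      · exact Or.inr ⟨y, d', hstar _ _ _ hab.symm h', rfl⟩
      · rw [insert_swap] at h' ⊢
        exact Or.inr ⟨x, d', hstar _ _ _ hab h', rfl⟩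
      · exact absurd rfl hxy
      · left
        obtain ⟨w, w', hw, hw', k1, k2⟩ := hab
        rcases hT.third h h' hdd hw with rfl | rfl
        · rw [hP] at k1 h
          exact absurd ⟨k1, h⟩ (hPu _ _)
        · exact k1
      · rw [insert_swap] at h' ⊢
        exact Or.inr ⟨x, d', hstar _ _ _ hab.symm h', rfl⟩
      · left
        obtain ⟨w, w', hw, hw', k1, k2⟩ := hab.symm
        rcases hT.third h h' hdd hw with rfl | rfl
        · rw [hP] at k1 h
          exact absurd ⟨k1, h⟩ (hPu _ _)
        · exact k1
      · exact absurd rfl hxy) _ hp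
  rcases hfin with h | ⟨a, b, hab, h⟩
  · exact hPb h
  · have hb : b₀ ∈ ({u, a, b} : Finset α) := by rw [← h]; simp
    simp only [Finset.mem_insert, Finset.mem_singleton] at hb
    rcases hb with rfl | rfl | rfl
    · exact hb₀.2.1 rfl
    · exact hb₀.2.2 (hBN _ _ hab)
    · exact hb₀.2.2 (hBN _ _ hab.symm)

end IsSphere

end

/-! ### Surgery on spheres -/

section

variable {α : Type*} [DecidableEq α] {T : Finset (Finset α)}

/-- A strongly connected complex with trivial first cohomology modulo 2. -/
structure IsPatch (T : Finset (Finset α)) : Prop where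
  card : ∀ t ∈ T, t.card = 3
  nonempty : T.Nonempty
  strong : ∀ P : Finset α → Prop, (∃ t ∈ T, P t) →
    (∀ a b d d', {a, b, d} ∈ T → {a, b, d'} ∈ T → P {a, b, d} → P {a, b, d'}) → ∀ t ∈ T, P t
  h1 : ∀ c : α → α → ZMod 2, (∀ a b, c a b = c b a) →
    (∀ a b d, {a, b, d} ∈ T → c a b + c b d + c a d = 0) →
    ∃ φ : α → ZMod 2, ∀ a b, TEdge T a b → c a b = φ a + φ b

theorem TEdge.mono {T T' : Finset (Finset α)} (h : T ⊆ T') {a b : α} (hab : TEdge T a b) :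
    TEdge T' a b := by
  obtain ⟨h1, t, ht, h2⟩ := hab
  exact ⟨h1, t, h ht, h2⟩

omit [DecidableEq α] in
theorem verts_mono {T T' : Finset (Finset α)} (h : T ⊆ T') : verts T ⊆ verts T' := by
  rintro v ⟨t, ht, hv⟩
  exact ⟨t, h ht, hv⟩

theorem verts_union (T T' : Finset (Finset α)) : verts (T ∪ T') = verts T ∪ verts T' := by
  ext v
  simp only [verts, Finset.mem_union, Set.mem_ofPred_eq, Set.mem_union]
  constructor
  · rintro ⟨t, ht | ht, hv⟩
    · exact Or.inl ⟨t, ht, hv⟩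
    · exact Or.inr ⟨t, ht, hv⟩
  · rintro (⟨t, ht, hv⟩ | ⟨t, ht, hv⟩)
    · exact ⟨t, Or.inl ht, hv⟩
    · exact ⟨t, Or.inr ht, hv⟩

theorem TEdge.exists_tri {a b : α} (h : TEdge T a b) (hT : ∀ t ∈ T, t.card = 3) :
    ∃ d, {a, b, d} ∈ T := by
  obtain ⟨hab, t, ht, ha, hb⟩ := h
  obtain ⟨d, rfl⟩ := eq_of_mem3 (hT t ht) hab ha hb
  exact ⟨d, ht⟩

theorem IsPatch.single {t : Finset α} (ht : t.card = 3) : IsPatch {t} := by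
  refine ⟨by simpa using ht, by simp, ?_, ?_⟩
  · intro P h _
    simpa using h
  · intro c hs hc
    obtain ⟨a, b, d, hab, had, hbd, rfl⟩ := Finset.card_eq_three.1 ht
    have h := hc a b d (by simp)
    have key : ∀ x y z : ZMod 2, x + y + z = 0 → y = x + z ∧ y = z + x := by decide
    have h0 := key _ _ _ h
    refine ⟨fun v => if v = a then 0 else c a v, ?_⟩
    rintro p q ⟨hpq, t', ht', hp, hq⟩
    rw [Finset.mem_singleton] at ht'
    subst ht'
    simp only [Finset.mem_insert, Finset.mem_singleton] at hp hq
    rcases hp with rfl | rfl | rfl <;> rcases hq with rfl | rfl | rfl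
    · exact absurd rfl hpq
    · simp [hab.symm]
    · simp [had.symm]
    · simp [hab.symm, hs p q]
    · exact absurd rfl hpq
    · simpa [hab.symm, had.symm] using h0.1
    · simp [had.symm, hs p q]
    · simpa [hab.symm, had.symm, hs p q] using h0.2
    · exact absurd rfl hpq

/-- Attaching a triangle along one edge with a new apex, or along two edges. -/
theorem IsPatch.add {Δ : Finset (Finset α)} (hΔ : IsPatch Δ) {a b d : α}
    (hc : ({a, b, d} : Finset α).card = 3) (hab : TEdge Δ a b)
    (hd : d ∉ verts Δ ∨ TEdge Δ b d) : IsPatch (insert {a, b, d} Δ) := by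
  refine ⟨?_, by simp, ?_, ?_⟩
  · intro t ht
    rcases Finset.mem_insert.1 ht with rfl | ht
    · exact hc
    · exact hΔ.card t ht
  · intro P hP hcl
    obtain ⟨e, he⟩ := hab.exists_tri hΔ.card
    have h1 : P {a, b, e} := by
      obtain ⟨t, ht, hPt⟩ := hP
      have : ∃ t ∈ Δ, P t := by
        rcases Finset.mem_insert.1 ht with rfl | ht
        · exact ⟨_, he, hcl a b d e (by simp) (by simp [he]) hPt⟩
        · exact ⟨t, ht, hPt⟩
      exact hΔ.strong P this (fun a b d d' h h' => hcl a b d d' (by simp [h]) (by simp [h'])) _ he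
    have h2 : P {a, b, d} := hcl a b e d (by simp [he]) (by simp) h1
    intro t ht
    rcases Finset.mem_insert.1 ht with rfl | ht
    · exact h2
    · exact hΔ.strong P ⟨_, he, h1⟩
        (fun a b d d' h h' => hcl a b d d' (by simp [h]) (by simp [h'])) _ ht
  · intro c hs hcc
    obtain ⟨φ, hφ⟩ := hΔ.h1 c hs (fun a b d h => hcc a b d (by simp [h]))
    have h := hcc a b d (by simp)
    have hne := card3_ne hc
    have key : ∀ x y z : ZMod 2, x + y + z = 0 → z = x + y ∧ y = x + z := by decide
    have k2 : ∀ x y z : ZMod 2, x + y + (y + z) = x + z ∧ x + (x + y + (y + z)) = z ∧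
      y + (x + y + (y + z)) = x + y + z ∧ x + y = y + x := by decide
    have main : ∃ ψ : α → ZMod 2, (∀ p q, TEdge Δ p q → c p q = ψ p + ψ q) ∧
        c b d = ψ b + ψ d := by
      rcases hd with hd | hd
      · refine ⟨fun v => if v = d then φ b + c b d else φ v, ?_, ?_⟩
        · intro p q hpq
          have h1 : p ≠ d := by rintro rfl; exact hd hpq.left
          have h2 : q ≠ d := by rintro rfl; exact hd hpq.right
          simpa [h1, h2] using hφ p q hpq
        · simp only [if_neg hne.2.1, if_true]
          generalize φ b = x
          generalize c b d = y
          revert x y; decide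
      · exact ⟨φ, hφ, hφ _ _ hd⟩
    obtain ⟨ψ, h1, h2⟩ := main
    have h3 := h1 _ _ hab
    have h4 : c a d = ψ a + ψ d := by
      rw [(key _ _ _ h).1, h2, h3]
      exact (k2 _ _ _).1
    refine ⟨ψ, ?_⟩
    rintro p q ⟨hpq, t, ht, hp, hq⟩
    rcases Finset.mem_insert.1 ht with rfl | ht
    · simp only [Finset.mem_insert, Finset.mem_singleton] at hp hq
      have e1 := hs b a
      have e2 := hs d a
      have e3 := hs d b
      rcases hp with rfl | rfl | rfl <;> rcases hq with rfl | rfl | rfl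
      · exact absurd rfl hpq
      · exact h3
      · exact h4
      · rw [e1, h3, add_comm]
      · exact absurd rfl hpq
      · exact h2
      · rw [e2, h4, add_comm]
      · rw [e3, h2, add_comm]
      · exact absurd rfl hpq
    · exact h1 p q ⟨hpq, t, ht, hp, hq⟩

/-- The 1-skeleton of a patch is connected. -/
theorem IsPatch.conn (hT : IsPatch T) : Conn (tgraph T) (verts T) := by
  have hne : ∀ t ∈ T, ∃ v ∈ t, True := by
    intro t ht
    have := Finset.card_pos.1 (by rw [hT.card t ht]; norm_num : 0 < t.card)
    obtain ⟨v, hv⟩ := this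
    exact ⟨v, hv, trivial⟩
  refine ⟨?_, ?_⟩
  · obtain ⟨t, ht⟩ := hT.nonempty
    obtain ⟨v, hv, -⟩ := hne t ht
    exact ⟨v, t, ht, hv⟩
  rintro C ⟨a, ⟨t, ht, hat⟩, haC⟩ hC
  have hall : ∀ t ∈ T, (∃ v ∈ t, v ∈ C) → ∀ w ∈ t, w ∈ C := by
    rintro t ht ⟨v, hv, hvC⟩ w hw
    by_cases hvw : v = w
    · exact hvw ▸ hvC
    · exact hC v ⟨t, ht, hv⟩ hvC w ⟨t, ht, hw⟩ ⟨hvw, t, ht, hv, hw⟩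
  have := hT.strong (fun t => ∃ v ∈ t, v ∈ C) ⟨t, ht, a, hat, haC⟩ (by
    intro a b d d' h h' hP
    exact ⟨a, by simp, hall _ h hP a (by simp)⟩)
  rintro b ⟨t', ht', hbt'⟩
  exact hall t' ht' (this t' ht') b hbt'

/-- Replacing a disc of a sphere by another one with the same boundary. -/
theorem IsSphere.replace (hT : IsSphere T) {Γ Δ : Finset (Finset α)} (hΓ : Γ ⊆ T)
    (hΓne : Γ.Nonempty) (hΓc : Conn (tgraph Γ) (verts Γ)) (hΔ : IsPatch Δ)
    (hdis : ∀ t ∈ T, t ∉ Γ → t ∉ Δ)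
    (hD : ∀ a b d e, {a, b, d} ∈ Γ → {a, b, e} ∈ T → {a, b, e} ∉ Γ →
      ∃ f, {a, b, f} ∈ Δ ∧ ∀ g, {a, b, g} ∈ Δ → g = f)
    (hI : ∀ a b d, {a, b, d} ∈ Δ → (∃ e f, {a, b, e} ∈ Γ ∧ {a, b, f} ∈ T ∧ {a, b, f} ∉ Γ) ∨
      ((∀ e, {a, b, e} ∈ T → {a, b, e} ∈ Γ) ∧
        ∃ d', d' ≠ d ∧ {a, b, d'} ∈ Δ ∧ ∀ x, {a, b, x} ∈ Δ → x = d ∨ x = d'))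
    (hv : ∀ v, v ∈ verts Δ → v ∈ verts (T \ Γ) → v ∈ verts Γ) :
    IsSphere (T \ Γ ∪ Δ) := by
  have hm : ∀ t, t ∈ T \ Γ ∪ Δ ↔ (t ∈ T ∧ t ∉ Γ) ∨ t ∈ Δ := by
    intro t; simp
  refine ⟨?_, ?_, ?_, ?_, ?_⟩
  · intro t ht
    rcases (hm t).1 ht with ht | ht
    · exact hT.card t ht.1
    · exact hΔ.card t ht
  · obtain ⟨t, ht⟩ := hΔ.nonempty
    exact ⟨t, (hm t).2 (Or.inr ht)⟩
  · intro a b d h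
    simp only [hm] at h ⊢
    rcases h with h | h
    · obtain ⟨d', hd', h', hx⟩ := hT.two a b d h.1
      by_cases hG : {a, b, d'} ∈ Γ
      · obtain ⟨f, hf, hfu⟩ := hD a b d' d hG h.1 h.2
        refine ⟨f, ?_, Or.inr hf, ?_⟩
        · rintro rfl
          exact hdis _ h.1 h.2 hf
        · rintro x (hx1 | hx1)
          · rcases hx x hx1.1 with h1 | rfl
            · exact Or.inl h1
            · exact absurd hG hx1.2
          · exact Or.inr (hfu x hx1)
      · refine ⟨d', hd', Or.inl ⟨h', hG⟩, ?_⟩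
        rintro x (hx1 | hx1)
        · exact hx x hx1.1
        · exfalso
          rcases hI a b x hx1 with ⟨e, f, he, hf⟩ | ⟨h1, _⟩
          · rcases hx e (hΓ he) with rfl | rfl
            · exact h.2 he
            · exact hG he
          · exact h.2 (h1 d h.1)
    · rcases hI a b d h with ⟨e, f, he, hf, hf'⟩ | ⟨h1, d', h2, h3, h4⟩
      · refine ⟨f, ?_, Or.inl ⟨hf, hf'⟩, ?_⟩
        · rintro rfl
          exact hdis _ hf hf' h
        · rintro x (hx | hx)
          · have : e ≠ f := by rintro rfl; exact hf' he
            rcases hT.third (hΓ he) hf this hx.1 with rfl | h1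
            · exact absurd he hx.2
            · exact Or.inr h1
          · obtain ⟨g, _, hg⟩ := hD a b e f he hf hf'
            exact Or.inl ((hg x hx).trans (hg d h).symm)
      · refine ⟨d', h2, Or.inr h3, ?_⟩
        rintro x (hx | hx)
        · exact absurd (h1 x hx.1) hx.2
        · exact h4 x hx
  · intro P hP hcl
    have hall : (∃ t ∈ Δ, P t) → ∀ t ∈ Δ, P t := fun h =>
      hΔ.strong P h fun a b d d' h h' => hcl a b d d' ((hm _).2 (Or.inr h)) ((hm _).2 (Or.inr h'))
    have key := hT.strong (fun t => (t ∉ Γ ∧ P t) ∨ (t ∈ Γ ∧ ∃ s ∈ Δ, P s)) (by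
      obtain ⟨t, ht, hPt⟩ := hP
      rcases (hm t).1 ht with ht | ht
      · exact ⟨t, ht.1, Or.inl ⟨ht.2, hPt⟩⟩
      · obtain ⟨s, hs⟩ := hΓne
        exact ⟨s, hΓ hs, Or.inr ⟨hs, t, ht, hPt⟩⟩) (by
      rintro a b d d' h h' (⟨h1, h2⟩ | ⟨h1, h2⟩)
      · by_cases hG : {a, b, d'} ∈ Γ
        · obtain ⟨f, hf, -⟩ := hD a b d' d hG h h1
          exact Or.inr ⟨hG, _, hf, hcl a b d f ((hm _).2 (Or.inl ⟨h, h1⟩)) ((hm _).2 (Or.inr hf)) h2⟩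
        · exact Or.inl ⟨hG, hcl a b d d' ((hm _).2 (Or.inl ⟨h, h1⟩))
            ((hm _).2 (Or.inl ⟨h', hG⟩)) h2⟩
      · by_cases hG : {a, b, d'} ∈ Γ
        · exact Or.inr ⟨hG, h2⟩
        · obtain ⟨f, hf, -⟩ := hD a b d d' h1 h' hG
          exact Or.inl ⟨hG, hcl a b f d' ((hm _).2 (Or.inr hf)) ((hm _).2 (Or.inl ⟨h', hG⟩))
            (hall h2 _ hf)⟩)
    intro t ht
    rcases (hm t).1 ht with ht | ht
    · rcases key t ht.1 with h | h
      · exact h.2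
      · exact absurd h.1 ht.2
    · obtain ⟨s, hs⟩ := hΓne
      rcases key s (hΓ hs) with h | h
      · exact absurd hs h.1
      · exact hall h.2 t ht
  · intro c hs hc
    classical
    obtain ⟨φ₀, hφ₀⟩ := hΔ.h1 c hs (fun a b d h => hc a b d ((hm _).2 (Or.inr h)))
    let c' : α → α → ZMod 2 := fun a b => if TEdge (T \ Γ) a b then c a b else φ₀ a + φ₀ b
    have hout : ∀ a b, TEdge (T \ Γ) a b → c' a b = c a b := fun a b h => if_pos h
    have hin : ∀ a b, TEdge Γ a b → c' a b = φ₀ a + φ₀ b := by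
      intro a b h
      by_cases ho : TEdge (T \ Γ) a b
      · rw [hout a b ho]
        obtain ⟨d, hd⟩ := h.exists_tri (fun t ht => hT.card t (hΓ ht))
        obtain ⟨e, he⟩ := ho.exists_tri (fun t ht => hT.card t (Finset.mem_sdiff.1 ht).1)
        rw [Finset.mem_sdiff] at he
        obtain ⟨f, hf, -⟩ := hD a b d e hd he.1 he.2
        exact hφ₀ a b ⟨h.1, _, hf, by simp, by simp⟩
      · exact if_neg ho
    have three : ∀ {S : Finset (Finset α)} {a b d : α}, S ⊆ T → {a, b, d} ∈ S →
        TEdge S a b ∧ TEdge S b d ∧ TEdge S a d := by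
      intro S a b d hS h
      obtain ⟨h1, h2, h3⟩ := hT.ne (hS h)
      exact ⟨⟨h1, _, h, by simp, by simp⟩, ⟨h2, _, h, by simp, by simp⟩,
        ⟨h3, _, h, by simp, by simp⟩⟩
    have hc's : ∀ a b, c' a b = c' b a := by
      intro a b
      by_cases h : TEdge (T \ Γ) a b
      · rw [hout _ _ h, hout _ _ h.symm, hs]
      · have h2 : ¬ TEdge (T \ Γ) b a := fun h' => h h'.symm
        simp only [c', if_neg h, if_neg h2, add_comm]
    obtain ⟨φ, hφ⟩ := hT.h1 c' hc's (by
      intro a b d h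
      by_cases hG : {a, b, d} ∈ Γ
      · obtain ⟨h1, h2, h3⟩ := three hΓ hG
        rw [hin _ _ h1, hin _ _ h2, hin _ _ h3]
        generalize φ₀ a = x
        generalize φ₀ b = y
        generalize φ₀ d = z
        revert x y z; decide
      · have hS : {a, b, d} ∈ T \ Γ := Finset.mem_sdiff.2 ⟨h, hG⟩
        obtain ⟨h1, h2, h3⟩ := three Finset.sdiff_subset hS
        rw [hout _ _ h1, hout _ _ h2, hout _ _ h3]
        exact hc a b d ((hm _).2 (Or.inl ⟨h, hG⟩)))
    obtain ⟨v₀, hv₀⟩ := hΓc.1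
    have hconst : ∀ v ∈ verts Γ, φ v + φ₀ v = φ v₀ + φ₀ v₀ := by
      refine hΓc.2 {v | φ v + φ₀ v = φ v₀ + φ₀ v₀} ⟨v₀, hv₀, rfl⟩ ?_
      intro a _ haC b _ hab
      have hab : TEdge Γ a b := hab
      have h1 := hin _ _ hab
      rw [hφ a b (hab.mono hΓ)] at h1
      have key : ∀ x y z w k : ZMod 2, x + y = z + w → x + z = k → y + w = k := by decide
      exact key _ _ _ _ _ h1 haC
    have k5 : ∀ x y k : ZMod 2, x + y = (x + k) + (y + k) := by decide
    refine ⟨fun v => if v ∈ verts (T \ Γ) then φ v + (φ v₀ + φ₀ v₀) else φ₀ v, ?_⟩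
    have hΔv : ∀ v ∈ verts Δ, (if v ∈ verts (T \ Γ) then φ v + (φ v₀ + φ₀ v₀) else φ₀ v) = φ₀ v := by
      intro v hvΔ
      split_ifs with h
      · have := hconst v (hv v hvΔ h)
        rw [← this]
        generalize φ v = x
        generalize φ₀ v = y
        revert x y; decide
      · rfl
    rintro a b ⟨hab, t, ht, ha, hb⟩
    rcases (hm t).1 ht with ht | ht
    · have hE : TEdge (T \ Γ) a b := ⟨hab, t, Finset.mem_sdiff.2 ht, ha, hb⟩
      simp only [if_pos hE.left, if_pos hE.right]
      rw [← hout a b hE, hφ a b ⟨hab, t, ht.1, ha, hb⟩]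
      exact k5 _ _ _
    · have hE : TEdge Δ a b := ⟨hab, t, ht, ha, hb⟩
      simp only [hΔv a hE.left, hΔv b hE.right]
      exact hφ₀ a b hE

end

section

variable {α : Type*} [DecidableEq α] {T : Finset (Finset α)}

theorem insert_inj3 {a b d d' : α} (hd : d ≠ a ∧ d ≠ b)
    (h : ({a, b, d} : Finset α) = {a, b, d'}) : d = d' := by
  have : d ∈ ({a, b, d'} : Finset α) := by rw [← h]; simp
  simp only [Finset.mem_insert, Finset.mem_singleton] at this
  tauto

theorem sum_bd_mul [Fintype α] (c : α → α → ZMod 2) (hs : ∀ a b, c a b = c b a)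
    {a b d : α} (h : ({a, b, d} : Finset α).card = 3) :
    ∑ e : Sym2 α, bd {a, b, d} e * Sym2.lift ⟨c, hs⟩ e = c a b + c b d + c a d := by
  obtain ⟨h1, h2, h3⟩ := card3_ne h
  rw [bd_eq h1 h2 h3]
  simp only [Pi.add_apply, add_mul, Finset.sum_add_distrib, Pi.single_apply, ite_mul, one_mul,
    zero_mul, Finset.sum_ite_eq', Finset.mem_univ, if_true, Sym2.lift_mk]

/-- A cocycle on all triangles but one is a cocycle. -/
theorem IsSphere.cocycle_erase [Fintype α] (hT : IsSphere T) {t : Finset α} (ht : t ∈ T)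
    (c : α → α → ZMod 2) (hs : ∀ a b, c a b = c b a)
    (hc : ∀ a b d, {a, b, d} ∈ T.erase t → c a b + c b d + c a d = 0) :
    ∀ a b d, {a, b, d} ∈ T → c a b + c b d + c a d = 0 := by
  intro a b d h
  by_cases hne : {a, b, d} = t
  · have h1 : ∑ t' ∈ T, ∑ e : Sym2 α, bd t' e * Sym2.lift ⟨c, hs⟩ e = 0 := by
      rw [Finset.sum_comm]
      refine Finset.sum_eq_zero fun e _ => ?_
      rw [← Finset.sum_mul]
      have : ∑ t' ∈ T, bd t' e = 0 := by
        induction e using Sym2.ind with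
        | _ p q =>
          by_cases hpq : TEdge T p q
          · obtain ⟨x, y, hxy, hx, hy, _⟩ := hT.exists_two hpq
            have := hT.sum_bd (fun _ => 1) hx hy hxy
            simp only [one_smul, Finset.sum_apply] at this
            rw [this]
            exact zmod2_add_self 1
          · refine Finset.sum_eq_zero fun t' ht' => ?_
            rw [bd_mk, if_neg]
            rintro ⟨k1, k2, k3⟩
            exact hpq ⟨k3, t', ht', k1, k2⟩
      rw [this, zero_mul]
    rw [Finset.sum_eq_single t] at h1
    · rw [← hne, sum_bd_mul c hs (hT.card _ h)] at h1
      exact h1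
    · intro t' ht' htt
      obtain ⟨x, y, z, hxy, hxz, hyz, rfl⟩ := Finset.card_eq_three.1 (hT.card t' ht')
      rw [sum_bd_mul c hs (hT.card _ ht')]
      exact hc x y z (Finset.mem_erase.2 ⟨htt, ht'⟩)
    · exact fun hn => absurd ht hn
  · exact hc a b d (Finset.mem_erase.2 ⟨hne, h⟩)

theorem IsSphere.tedge_erase (hT : IsSphere T) {t : Finset α} {a b : α} (h : TEdge T a b) :
    TEdge (T.erase t) a b := by
  obtain ⟨d, d', hdd, h1, h2, -⟩ := hT.exists_two h
  have hne := hT.ne h1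
  by_cases hd : {a, b, d} = t
  · have : {a, b, d'} ≠ t := by
      rw [← hd]
      exact fun hh => hdd (insert_inj3 ⟨hne.2.2.symm, hne.2.1.symm⟩ hh.symm)
    exact ⟨h.1, _, Finset.mem_erase.2 ⟨this, h2⟩, by simp, by simp⟩
  · exact ⟨h.1, _, Finset.mem_erase.2 ⟨hd, h1⟩, by simp, by simp⟩

/-- Removing a triangle from a sphere leaves a disc. -/
theorem IsSphere.isPatch_erase [Fintype α] (hT : IsSphere T) {t : Finset α} (ht : t ∈ T) :
    IsPatch (T.erase t) := by
  refine ⟨fun s hs => hT.card s (Finset.mem_of_mem_erase hs), ?_, ?_, ?_⟩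
  · obtain ⟨a, b, d, hab, had, hbd, rfl⟩ := Finset.card_eq_three.1 (hT.card t ht)
    obtain ⟨_, s, hs, _⟩ := hT.tedge_erase (t := {a, b, d}) (hT.tedge ht)
    exact ⟨s, hs⟩
  · intro P hP hcl
    by_contra! hno
    have hb : ∀ Q : Finset α → Prop,
        (∀ a b d d', {a, b, d} ∈ T.erase t → {a, b, d'} ∈ T.erase t → Q {a, b, d} →
          Q {a, b, d'}) →
        ∀ a b, Bd T (fun s => s ≠ t ∧ Q s) a b → a ∈ t ∧ b ∈ t := by
      rintro Q hQ a b ⟨d, d', h1, h2, ⟨h3, h4⟩, h5⟩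
      have : {a, b, d'} = t := by
        by_contra hne
        exact h5 ⟨hne, hQ a b d d' (Finset.mem_erase.2 ⟨h3, h1⟩) (Finset.mem_erase.2 ⟨hne, h2⟩) h4⟩
      rw [← this]
      simp
    have hn : ∀ a b d d', {a, b, d} ∈ T.erase t → {a, b, d'} ∈ T.erase t → ¬ P {a, b, d} →
          ¬ P {a, b, d'} := fun a b d d' h1 h2 h3 h4 => h3 (hcl a b d' d h2 h1 h4)
    have hall : ∀ x y, x ∈ t → y ∈ t → x ≠ y → Bd T (fun s => s ≠ t ∧ P s) x y := by
      obtain ⟨s, hs, hPs⟩ := hP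
      rw [Finset.mem_erase] at hs
      obtain ⟨a, b, hab⟩ := hT.exists_bd (P := fun s => s ≠ t ∧ P s) ⟨s, hs.2, hs.1, hPs⟩
        ⟨t, ht, fun h => h.1 rfl⟩
      obtain ⟨e, heb, hae⟩ := hT.exists_other_bd hab
      obtain ⟨e', hea, hbe⟩ := hT.exists_other_bd hab.symm
      have m1 := hb P hcl _ _ hab
      have m2 := hb P hcl _ _ hae
      have m3 := hb P hcl _ _ hbe
      have n1 := (hT.tedge_of_bd hab).1
      have n2 := (hT.tedge_of_bd hae).1
      have n3 := (hT.tedge_of_bd hbe).1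
      obtain ⟨w, hw⟩ := eq_of_mem3 (hT.card t ht) n1 m1.1 m1.2
      have hm : ∀ x, x ∈ t → x = a ∨ x = b ∨ x = w := by
        intro x hx; rw [hw] at hx; simpa using hx
      have e1 : e = w := by
        have := hm _ m2.2; grind
      have e2 : e' = w := by
        have := hm _ m3.2; grind
      subst e1
      subst e2
      intro x y hx hy hxy
      rcases hm x hx with rfl | rfl | rfl <;> rcases hm y hy with rfl | rfl | rfl
      · exact absurd rfl hxy
      · exact hab
      · exact hae
      · exact hab.symm
      · exact absurd rfl hxy
      · exact hbe
      · exact hae.symm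
      · exact hbe.symm
      · exact absurd rfl hxy
    obtain ⟨s, hs, hPs⟩ := hno
    rw [Finset.mem_erase] at hs
    obtain ⟨a, b, hab⟩ := hT.exists_bd (P := fun s => s ≠ t ∧ ¬ P s) ⟨s, hs.2, hs.1, hPs⟩
      ⟨t, ht, fun h => h.1 rfl⟩
    have hm := hb (fun s => ¬ P s) hn a b hab
    have hab1 := (hT.tedge_of_bd hab).1
    obtain ⟨p, p', h1, h2, h3, h4⟩ := hab
    obtain ⟨q, q', k1, k2, k3, k4⟩ := hall a b hm.1 hm.2 hab1
    obtain ⟨w, hw⟩ := eq_of_mem3 (hT.card t ht) hab1 hm.1 hm.2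
    have hpq : p ≠ q := by rintro rfl; exact h3.2 k3.2
    rcases hT.third h1 k1 hpq (hw ▸ ht) with rfl | rfl
    · exact h3.1 hw.symm
    · exact k3.1 hw.symm
  · intro c hs hc
    obtain ⟨φ, hφ⟩ := hT.h1 c hs (hT.cocycle_erase ht c hs hc)
    exact ⟨φ, fun a b h => hφ a b (h.mono (Finset.erase_subset _ _))⟩

theorem verts_subset_of_tedge {T T' : Finset (Finset α)} (hT : IsSphere T)
    (h : ∀ a b, TEdge T a b → TEdge T' a b) : verts T ⊆ verts T' := by
  intro v hv
  obtain ⟨a, b, hab⟩ := hT.exists_tri_of_mem hv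
  exact (h v a (hT.tedge hab)).left

/-- Connected sum along a common triangle. -/
theorem IsSphere.glue [Fintype α] {A B : Finset (Finset α)} (hA : IsSphere A) (hB : IsSphere B)
    {t : Finset α} (htA : t ∈ A) (htB : t ∈ B) (hAB : ∀ v, v ∈ verts A → v ∈ verts B → v ∈ t) :
    ∃ T, IsSphere T ∧ verts T = verts A ∪ verts B ∧ (∀ a b, TEdge A a b → TEdge T a b) ∧
      (∀ a b, TEdge B a b → TEdge T a b) ∧ ∀ t' ∈ B, t' ≠ t → t' ∈ T := by
  have hS : IsSphere (A \ {t} ∪ B.erase t) := by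
    refine hA.replace (by simpa using htA) (by simp) (IsPatch.single (hA.card t htA)).conn
      (hB.isPatch_erase htB) ?_ ?_ ?_ ?_
    · intro t' h1 h2 h3
      have h3 := Finset.mem_of_mem_erase h3
      have : t' ⊆ t := fun v hv => hAB v ⟨t', h1, hv⟩ ⟨t', h3, hv⟩
      have := Finset.eq_of_subset_of_card_le this (by rw [hA.card t htA, hA.card t' h1])
      exact h2 (by simpa using this)
    · intro a b d e h1 h2 h3
      rw [Finset.mem_singleton] at h1
      subst h1
      obtain ⟨f, hf1, hf2, hf3⟩ := hB.two a b d htB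
      have hne := hB.ne hf2
      have hne' := hB.ne htB
      refine ⟨f, Finset.mem_erase.2 ⟨fun h => hf1 (insert_inj3 ⟨hne.2.2.symm, hne.2.1.symm⟩ h),
        hf2⟩, ?_⟩
      intro g hg
      rw [Finset.mem_erase] at hg
      rcases hf3 g hg.2 with rfl | h
      · exact absurd rfl hg.1
      · exact h
    · intro a b d h
      rw [Finset.mem_erase] at h
      have hab := (hB.ne h.2).1
      by_cases hm : a ∈ t ∧ b ∈ t
      · left
        obtain ⟨e, rfl⟩ := eq_of_mem3 (hA.card t htA) hab hm.1 hm.2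
        obtain ⟨f, hf1, hf2, hf3⟩ := hA.two a b e htA
        have hne := hA.ne hf2
        exact ⟨e, f, by simp, hf2, by
          simpa using fun h => hf1 (insert_inj3 ⟨hne.2.2.symm, hne.2.1.symm⟩ h)⟩
      · right
        refine ⟨?_, ?_⟩
        · intro e he
          exact absurd ⟨hAB a ⟨_, he, by simp⟩ ⟨_, h.2, by simp⟩,
            hAB b ⟨_, he, by simp⟩ ⟨_, h.2, by simp⟩⟩ hm
        · obtain ⟨f, hf1, hf2, hf3⟩ := hB.two a b d h.2
          refine ⟨f, hf1, Finset.mem_erase.2 ⟨?_, hf2⟩, fun x hx => hf3 x (Finset.mem_of_mem_erase hx)⟩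
          rintro rfl
          exact hm ⟨by simp, by simp⟩
    · intro v hv1 hv2
      exact ⟨t, by simp, hAB v (verts_mono Finset.sdiff_subset hv2)
        (verts_mono (Finset.erase_subset _ _) hv1)⟩
  have h1 : ∀ a b, TEdge A a b → TEdge (A \ {t} ∪ B.erase t) a b := by
    intro a b h
    refine (hA.tedge_erase (t := t) h).mono ?_
    rw [Finset.sdiff_singleton_eq_erase]
    exact Finset.subset_union_left
  have h2 : ∀ a b, TEdge B a b → TEdge (A \ {t} ∪ B.erase t) a b := fun a b h =>
    (hB.tedge_erase (t := t) h).mono Finset.subset_union_right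
  refine ⟨_, hS, ?_, h1, h2, fun t' ht' hne =>
    Finset.mem_union_right _ (Finset.mem_erase.2 ⟨hne, ht'⟩)⟩
  refine Set.Subset.antisymm ?_ (Set.union_subset (verts_subset_of_tedge hA h1)
    (verts_subset_of_tedge hB h2))
  rw [verts_union]
  exact Set.union_subset_union (verts_mono Finset.sdiff_subset) (verts_mono (Finset.erase_subset _ _))

/-- The boundary of a tetrahedron. -/
theorem isSphere_tetra {s : Finset α} (hs : s.card = 4) : IsSphere (s.powersetCard 3) := by
  obtain ⟨a, b, d, e, hab, had, hae, hbd, hbe, hde, rfl⟩ := Finset.card_eq_four.1 hs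
  have hp : IsPatch (({a, b, d, e} : Finset α).powersetCard 3) := by
    have c1 : ({a, b, d} : Finset α).card = 3 := Finset.card_eq_three.2 ⟨_, _, _, hab, had, hbd, rfl⟩
    have c2 : ({a, b, e} : Finset α).card = 3 := Finset.card_eq_three.2 ⟨_, _, _, hab, hae, hbe, rfl⟩
    have c3 : ({d, a, e} : Finset α).card = 3 :=
      Finset.card_eq_three.2 ⟨_, _, _, had.symm, hde, hae, rfl⟩
    have c4 : ({b, d, e} : Finset α).card = 3 :=
      Finset.card_eq_three.2 ⟨_, _, _, hbd, hbe, hde, rfl⟩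
    have p1 := IsPatch.single c1
    have p2 := p1.add (a := a) (b := b) (d := e) c2 ⟨hab, {a, b, d}, by simp, by simp, by simp⟩ (Or.inl (by
      rintro ⟨t, ht, het⟩
      rw [Finset.mem_singleton] at ht
      subst ht
      simp at het
      tauto))
    have p3 := p2.add (a := d) (b := a) (d := e) c3
      ⟨had.symm, {a, b, d}, by simp, by simp, by simp⟩
      (Or.inr ⟨hae, {a, b, e}, by simp, by simp, by simp⟩)
    have p4 := p3.add (a := b) (b := d) (d := e) c4
      ⟨hbd, {a, b, d}, by simp, by simp, by simp⟩
      (Or.inr ⟨hde, {d, a, e}, by simp, by simp, by simp⟩)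
    convert p4 using 1
    ext t
    simp only [Finset.mem_powersetCard, Finset.mem_insert, Finset.mem_singleton]
    constructor
    · rintro ⟨h1, h2⟩
      have h3 : (({a, b, d, e} : Finset α) \ t).card = 1 := by
        rw [Finset.card_sdiff_of_subset h1, hs, h2]
      obtain ⟨x, hx⟩ := Finset.card_eq_one.1 h3
      have h4 : t = ({a, b, d, e} : Finset α) \ {x} := by
        rw [← hx, Finset.sdiff_sdiff_eq_self h1]
      have h5 : x ∈ ({a, b, d, e} : Finset α) := by
        have : x ∈ (({a, b, d, e} : Finset α) \ t) := by rw [hx]; simp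
        exact (Finset.mem_sdiff.1 this).1
      simp only [Finset.mem_insert, Finset.mem_singleton] at h5
      rw [h4]
      rcases h5 with rfl | rfl | rfl | rfl
      · left; ext; simp; grind
      · right; left; ext; simp; grind
      · right; right; left; ext; simp; grind
      · right; right; right; ext; simp; grind
    · rintro (rfl | rfl | rfl | rfl)
      · exact ⟨by intro; simp; tauto, c4⟩
      · exact ⟨by intro; simp; tauto, c3⟩
      · exact ⟨by intro; simp; tauto, c2⟩
      · exact ⟨by intro; simp; tauto, c1⟩
  refine ⟨hp.card, hp.nonempty, ?_, hp.strong, hp.h1⟩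
  generalize ({a, b, d, e} : Finset α) = s at hs
  intro x y z h
  obtain ⟨h1, h2⟩ := Finset.mem_powersetCard.1 h
  obtain ⟨n1, n2, n3⟩ := card3_ne h2
  have h3 : (s \ {x, y, z}).card = 1 := by
    rw [Finset.card_sdiff_of_subset h1, hs, h2]
  obtain ⟨w, hw⟩ := Finset.card_eq_one.1 h3
  have hw' : ∀ v, (v ∈ s ∧ v ≠ x ∧ v ≠ y ∧ v ≠ z) ↔ v = w := by
    intro v
    rw [← Finset.mem_singleton, ← hw]
    simp
  obtain ⟨k1, k2, k3, k4⟩ := (hw' w).2 rfl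
  refine ⟨w, k4, Finset.mem_powersetCard.2 ⟨?_, ?_⟩, ?_⟩
  · intro v hv
    simp only [Finset.mem_insert, Finset.mem_singleton] at hv
    rcases hv with rfl | rfl | rfl
    · exact h1 (by simp)
    · exact h1 (by simp)
    · exact k1
  · exact Finset.card_eq_three.2 ⟨x, y, w, n1, k2.symm, k3.symm, rfl⟩
  · intro v hv
    obtain ⟨j1, j2⟩ := Finset.mem_powersetCard.1 hv
    have := card3_ne j2
    by_cases hvz : v = z
    · exact Or.inl hvz
    · exact Or.inr ((hw' v).1 ⟨j1 (by simp), this.2.2.symm, this.2.1.symm, hvz⟩)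

omit [DecidableEq α] in
theorem verts_powersetCard {s : Finset α} (hs : 3 ≤ s.card) :
    verts (s.powersetCard 3) = (s : Set α) := by
  ext v
  constructor
  · rintro ⟨t, ht, hv⟩
    exact (Finset.mem_powersetCard.1 ht).1 hv
  · intro hv
    obtain ⟨t, ht1, ht2, ht3⟩ := Finset.exists_subsuperset_card_eq (s := {v}) (t := s) (n := 3)
      (by simpa using hv) (by simp) hs
    exact ⟨t, Finset.mem_powersetCard.2 ⟨ht2, ht3⟩, ht1 (by simp)⟩

theorem tedge_powersetCard {s : Finset α} (hs : 3 ≤ s.card) {a b : α} (ha : a ∈ s) (hb : b ∈ s)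
    (hab : a ≠ b) : TEdge (s.powersetCard 3) a b := by
  obtain ⟨t, ht1, ht2, ht3⟩ := Finset.exists_subsuperset_card_eq (s := {a, b}) (t := s) (n := 3)
      (by intro x; simp; rintro (rfl | rfl) <;> assumption) (by rw [Finset.card_pair hab]; omega) hs
  exact ⟨hab, t, Finset.mem_powersetCard.2 ⟨ht2, ht3⟩, ht1 (by simp), ht1 (by simp)⟩

/-- Stellar subdivision of a triangle. -/
theorem IsSphere.stellar [Fintype α] (hT : IsSphere T) {y z w a : α} (h : {y, z, w} ∈ T)
    (ha : a ∉ verts T) : ∃ T', IsSphere T' ∧ verts T' = insert a (verts T) ∧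
      (∀ p q, TEdge T p q → TEdge T' p q) ∧ TEdge T' a y ∧ TEdge T' a z ∧ {a, y, z} ∈ T' := by
  have hy : y ∈ verts T := ⟨_, h, by simp⟩
  have hz : z ∈ verts T := ⟨_, h, by simp⟩
  have hw : w ∈ verts T := ⟨_, h, by simp⟩
  have hn := hT.ne h
  have h4 : ({a, y, z, w} : Finset α).card = 4 := by
    refine Finset.card_eq_four.2 ⟨a, y, z, w, ?_, ?_, ?_, hn.1, hn.2.2, hn.2.1, rfl⟩ <;>
    · rintro rfl
      contradiction
  have hB := isSphere_tetra h4
  have htB : {y, z, w} ∈ ({a, y, z, w} : Finset α).powersetCard 3 :=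
    Finset.mem_powersetCard.2 ⟨by intro; simp; tauto, hT.card _ h⟩
  obtain ⟨T', h1, h2, h3, h5, h6⟩ := hT.glue hB h htB (by
    intro v hv1 hv2
    rw [verts_powersetCard (by omega)] at hv2
    simp only [Finset.coe_insert, Set.mem_insert_iff] at hv2
    rcases hv2 with rfl | hv2
    · exact absurd hv1 ha
    · simpa using hv2)
  have hm : ∀ v, v ∈ ({y, z, w} : Finset α) → v ∈ verts T := by
    intro v hv
    simp only [Finset.mem_insert, Finset.mem_singleton] at hv
    rcases hv with rfl | rfl | rfl <;> assumption
  have hay : a ≠ y := by rintro rfl; exact ha hy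
  have haz : a ≠ z := by rintro rfl; exact ha hz
  refine ⟨T', h1, ?_, h3, ?_, ?_, ?_⟩
  · rw [h2, verts_powersetCard (by omega)]
    ext v
    simp only [Set.mem_union, Finset.mem_coe, Set.mem_insert_iff]
    rw [Finset.mem_insert]
    constructor
    · rintro (hv | hv | hv)
      · exact Or.inr hv
      · exact Or.inl hv
      · exact Or.inr (hm v hv)
    · rintro (hv | hv)
      · exact Or.inr (Or.inl hv)
      · exact Or.inl hv
  · exact h5 _ _ (tedge_powersetCard (by omega) (by simp) (by simp) hay)
  · exact h5 _ _ (tedge_powersetCard (by omega) (by simp) (by simp) haz)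
  · refine h6 _ (Finset.mem_powersetCard.2 ⟨?_, ?_⟩) ?_
    · intro x
      simp only [Finset.mem_insert, Finset.mem_singleton]
      tauto
    · exact Finset.card_eq_three.2 ⟨_, _, _, hay, haz, hn.1, rfl⟩
    · intro hh
      exact ha (hm a (by rw [← hh]; simp))

/-- Gluing two spheres along a common edge. -/
theorem IsSphere.glue_edge [Fintype α] {A B : Finset (Finset α)} (hA : IsSphere A)
    (hB : IsSphere B) {y z : α} (hyA : TEdge A y z) (hyB : TEdge B y z)
    (hAB : ∀ v, v ∈ verts A → v ∈ verts B → v = y ∨ v = z) :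
    ∃ T, IsSphere T ∧ verts T = verts A ∪ verts B ∧ (∀ a b, TEdge A a b → TEdge T a b) ∧
      ∀ a b, TEdge B a b → TEdge T a b := by
  obtain ⟨a, ha⟩ := hA.exists_tri hyA
  obtain ⟨b, hb⟩ := hB.exists_tri hyB
  have hbn := hB.ne hb
  have hbA : b ∉ verts A := by
    intro h
    rcases hAB b h ⟨_, hb, by simp⟩ with h | h
    · exact hbn.2.2 h.symm
    · exact hbn.2.1 h.symm
  obtain ⟨A', h1, h2, h3, -, -, h4⟩ := hA.stellar ha hbA
  rw [insert_rot] at h4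
  obtain ⟨T, k1, k2, k3, k4, -⟩ := h1.glue hB h4 hb (by
    intro v hv1 hv2
    rw [h2] at hv1
    simp only [Finset.mem_insert, Finset.mem_singleton]
    rcases hv1 with hv1 | hv1
    · tauto
    · have := hAB v hv1 hv2
      tauto)
  refine ⟨T, k1, ?_, fun p q h => k3 p q (h3 p q h), k4⟩
  rw [k2, h2]
  have : b ∈ verts B := ⟨_, hb, by simp⟩
  ext v
  simp only [Set.mem_union, Set.mem_insert_iff]
  constructor
  · rintro ((rfl | h) | h)
    · exact Or.inr this
    · exact Or.inl h
    · exact Or.inr h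
  · tauto

end

/-! ### Graphs without `K₅` and `K₃,₃` minors are contained in spheres -/

section

variable {V : Type*} [DecidableEq V]

/-- `G` restricted to `s` is contained in the 1-skeleton of a sphere with vertex set `s`. -/
def Emb (G : SimpleGraph V) (s : Finset V) : Prop :=
  ∃ T : Finset (Finset V), IsSphere T ∧ verts T = (s : Set V) ∧
    ∀ a ∈ s, ∀ b ∈ s, G.Adj a b → TEdge T a b

theorem emb_of_card_four (G : SimpleGraph V) {s : Finset V} (hs : s.card = 4) : Emb G s :=
  ⟨_, isSphere_tetra hs, verts_powersetCard (by omega),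
    fun _ ha _ hb hab => tedge_powersetCard (by omega) ha hb hab.ne⟩

omit [DecidableEq V] in
theorem adj_sup_edge {G : SimpleGraph V} {y z a b : V} :
    (G ⊔ SimpleGraph.edge y z).Adj a b ↔
      G.Adj a b ∨ ((a = y ∧ b = z ∨ a = z ∧ b = y) ∧ a ≠ b) := by
  rw [SimpleGraph.sup_adj, SimpleGraph.edge_adj]

/-- Adding an edge between two vertices joined through a connected set outside. -/
theorem Pl.add_edge {G : SimpleGraph V} {s A : Set V} {y z : V} {C : Set V} (h : Pl G s)
    (hA : A ⊆ s) (hC : Conn G C) (hCs : C ⊆ s) (hCA : ∀ v ∈ C, v ∉ A) (hy : y ∈ A)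
    (hyC : ∃ v ∈ C, G.Adj y v) (hzC : ∃ v ∈ C, G.Adj z v) :
    Pl (G ⊔ SimpleGraph.edge y z) A := by
  refine h.minor (fun v => if v = y then insert y C else {v}) ?_ ?_ ?_
  · intro v hv
    split_ifs with hvy
    · exact ⟨hC.insert hyC, Set.insert_subset (hA hy) hCs⟩
    · exact ⟨Conn.singleton G v, by simpa using hA hv⟩
  · intro v hv w hw hvw
    have h1 : v ∉ C := fun h => hCA v h hv
    have h2 : w ∉ C := fun h => hCA w h hw
    split_ifs <;> simp_all
  · intro v hv w hw hvw
    have hsub : ∀ v, ({v} : Set V) ⊆ if v = y then insert y C else {v} := by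
      intro v
      split_ifs with h
      · subst h; simp
      · exact subset_rfl
    have hzy : Touch G (if y = y then insert y C else {y}) (if z = y then insert y C else {z}) := by
      rw [if_pos rfl]
      obtain ⟨c, hc, hcz⟩ := hzC
      exact ⟨c, Or.inr hc, z, hsub z rfl, hcz.symm⟩
    rcases adj_sup_edge.1 hvw with h | ⟨⟨rfl, rfl⟩ | ⟨rfl, rfl⟩, -⟩
    · exact (h.touch (Set.mem_singleton v) (Set.mem_singleton w)).mono (hsub v) (hsub w)
    · exact hzy
    · exact hzy.symm

variable [Fintype V]

/-- Vertices of degree at most two are inserted into a face. -/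
theorem emb_of_low_degree {G : SimpleGraph V} {s : Finset V} (hp : Pl G (s : Set V))
    (ih : ∀ (G' : SimpleGraph V) (s' : Finset V), s'.card < s.card → 4 ≤ s'.card →
      Pl G' (s' : Set V) → Emb G' s') (hs : 5 ≤ s.card) {a y z : V} (ha : a ∈ s)
    (hd : ∀ b ∈ s, G.Adj a b → b = y ∨ b = z) : Emb G s := by
  have hc : (s.erase a).card = s.card - 1 := Finset.card_erase_of_mem ha
  suffices h : ∃ T : Finset (Finset V), IsSphere T ∧ verts T = ((s.erase a : Finset V) : Set V) ∧
      (∀ p ∈ s.erase a, ∀ q ∈ s.erase a, G.Adj p q → TEdge T p q) ∧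
      ∃ u v w, {u, v, w} ∈ T ∧ ∀ b ∈ s, G.Adj a b → b = u ∨ b = v by
    obtain ⟨T, h1, h2, h3, u, v, w, h4, h5⟩ := h
    obtain ⟨T', k1, k2, k3, k4, k5, -⟩ := h1.stellar (a := a) h4 (by rw [h2]; simp)
    refine ⟨T', k1, ?_, ?_⟩
    · rw [k2, h2, ← Finset.coe_insert, Finset.insert_erase ha]
    · have hab : ∀ b ∈ s, G.Adj a b → TEdge T' a b := by
        intro b hb hab
        rcases h5 b hb hab with rfl | rfl <;> assumption
      intro p hp q hq hpq
      by_cases hpa : p = a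
      · subst hpa
        exact hab q hq hpq
      by_cases hqa : q = a
      · subst hqa
        exact (hab p hp hpq.symm).symm
      exact k3 p q (h3 p (Finset.mem_erase.2 ⟨hpa, hp⟩) q (Finset.mem_erase.2 ⟨hqa, hq⟩) hpq)
  have hsub : ((s.erase a : Finset V) : Set V) ⊆ s := by simp
  by_cases hyz : (y ∈ s ∧ G.Adj a y) ∧ (z ∈ s ∧ G.Adj a z) ∧ y ≠ z
  · obtain ⟨⟨hy, hay⟩, ⟨hz, haz⟩, hne⟩ := hyz
    obtain ⟨T, h1, h2, h3⟩ := ih (G ⊔ SimpleGraph.edge y z) (s.erase a) (by omega) (by omega)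
      (hp.add_edge (C := {a}) hsub (Conn.singleton G a) (by simpa using ha) (by simp)
        (by simpa using And.intro hy hay.ne') ⟨a, rfl, hay.symm⟩ ⟨a, rfl, haz.symm⟩)
    have hyz' : TEdge T y z := h3 y (by simpa using ⟨hay.ne', hy⟩) z
      (by simpa using ⟨haz.ne', hz⟩) (adj_sup_edge.2 (Or.inr ⟨Or.inl ⟨rfl, rfl⟩, hne⟩))
    obtain ⟨w, hw⟩ := h1.exists_tri hyz'
    exact ⟨T, h1, h2, fun p hp q hq h => h3 p hp q hq (adj_sup_edge.2 (Or.inl h)), y, z, w, hw, hd⟩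
  · have hex : ∃ u ∈ s.erase a, ∀ b ∈ s, G.Adj a b → b = u := by
      by_cases hn : ∃ u ∈ s, G.Adj a u
      · obtain ⟨u, hu, hau⟩ := hn
        refine ⟨u, Finset.mem_erase.2 ⟨hau.ne', hu⟩, ?_⟩
        intro b hb hab
        have h1 := hd u hu hau
        have h2 := hd b hb hab
        by_contra hbu
        apply hyz
        grind
      · push Not at hn
        obtain ⟨u, hu⟩ := Finset.card_pos.1 (by omega : 0 < (s.erase a).card)
        exact ⟨u, hu, fun b hb hab => absurd hab (hn b hb)⟩
    obtain ⟨u, hu, hua⟩ := hex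
    obtain ⟨T, h1, h2, h3⟩ := ih G (s.erase a) (by omega) (by omega)
      (hp.mono hsub fun _ _ _ _ h => h)
    obtain ⟨v, w, hvw⟩ := h1.exists_tri_of_mem (v := u) (by rw [h2]; exact hu)
    exact ⟨T, h1, h2, h3, u, v, w, hvw, fun b hb hab => Or.inl (hua b hb hab)⟩

/-- Gluing along an edge present on both sides. -/
theorem emb_glue {G G₁ G₂ : SimpleGraph V} {s A B : Finset V} (h1 : Emb G₁ A) (h2 : Emb G₂ B)
    (hs : ∀ v, v ∈ s ↔ v ∈ A ∨ v ∈ B) {y z : V} (hAB : ∀ v, v ∈ A → v ∈ B → v = y ∨ v = z)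
    (hy : y ∈ A ∧ y ∈ B) (hz : z ∈ A ∧ z ∈ B) (e1 : G₁.Adj y z) (e2 : G₂.Adj y z)
    (hG : ∀ a ∈ s, ∀ b ∈ s, G.Adj a b →
      (a ∈ A ∧ b ∈ A ∧ G₁.Adj a b) ∨ (a ∈ B ∧ b ∈ B ∧ G₂.Adj a b)) : Emb G s := by
  obtain ⟨T₁, p1, p2, p3⟩ := h1
  obtain ⟨T₂, q1, q2, q3⟩ := h2
  obtain ⟨T, t1, t2, t3, t4⟩ := p1.glue_edge q1 (p3 y hy.1 z hz.1 e1) (q3 y hy.2 z hz.2 e2) (by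
    rw [p2, q2]
    exact hAB)
  refine ⟨T, t1, ?_, ?_⟩
  · rw [t2, p2, q2]
    ext v
    simpa using (hs v).symm
  · intro a ha b hb hab
    rcases hG a ha b hb hab with ⟨k1, k2, k3⟩ | ⟨k1, k2, k3⟩
    · exact t3 _ _ (p3 a k1 b k2 k3)
    · exact t4 _ _ (q3 a k1 b k2 k3)

theorem emb_of_cut_vertex {G : SimpleGraph V} {s : Finset V} (hp : Pl G (s : Set V))
    (ih : ∀ (G' : SimpleGraph V) (s' : Finset V), s'.card < s.card → 4 ≤ s'.card →
      Pl G' (s' : Set V) → Emb G' s')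
    (hδ : ∀ a ∈ s, ∀ y z, ∃ b ∈ s, G.Adj a b ∧ b ≠ y ∧ b ≠ z) {y : V} (hy : y ∈ s)
    {X Y : Finset V} (hXY : ∀ v, v ∈ s ↔ v = y ∨ v ∈ X ∨ v ∈ Y) (hyX : y ∉ X) (hyY : y ∉ Y)
    (hdis : ∀ v ∈ X, v ∉ Y) (hX : X.Nonempty) (hY : Y.Nonempty)
    (hn : ∀ a ∈ X, ∀ b ∈ Y, ¬ G.Adj a b) : Emb G s := by
  wlog hz : ∃ z ∈ X, G.Adj y z generalizing X Y
  · obtain ⟨z, hz, hyz, -, -⟩ := hδ y hy y y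
    refine this (X := Y) (Y := X) (fun v => by rw [hXY]; tauto) hyY hyX
      (fun v h1 h2 => hdis v h2 h1) hY hX (fun a ha b hb h => hn b hb a ha h.symm) ⟨z, ?_, hyz⟩
    rcases (hXY z).1 hz with rfl | h | h
    · exact absurd rfl hyz.ne
    · exact (‹¬ ∃ z ∈ X, G.Adj y z› ⟨z, h, hyz⟩).elim
    · exact h
  obtain ⟨z, hzX, hyz⟩ := hz
  have hbig : ∀ {X Y : Finset V}, (∀ v, v ∈ s ↔ v = y ∨ v ∈ X ∨ v ∈ Y) → X.Nonempty →
      (∀ a ∈ X, ∀ b ∈ Y, ¬ G.Adj a b) → 3 ≤ X.card := by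
    intro X Y hXY hXne hn
    obtain ⟨a, ha⟩ := hXne
    have hm : ∀ b ∈ s, G.Adj a b → b ≠ y → b ∈ X := by
      intro b hb hab hby
      rcases (hXY b).1 hb with h | h | h
      · exact absurd h hby
      · exact h
      · exact absurd hab (hn a ha b h)
    have has : a ∈ s := (hXY a).2 (Or.inr (Or.inl ha))
    obtain ⟨b, hb, hab, hby, _⟩ := hδ a has y y
    obtain ⟨d, hd, had, hdy, hdb⟩ := hδ a has y b
    have h3 : ({a, b, d} : Finset V).card = 3 :=
      Finset.card_eq_three.2 ⟨a, b, d, hab.ne, had.ne, hdb.symm, rfl⟩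
    rw [← h3]
    refine Finset.card_le_card ?_
    intro v hv
    simp only [Finset.mem_insert, Finset.mem_singleton] at hv
    rcases hv with rfl | rfl | rfl
    · exact ha
    · exact hm _ hb hab hby
    · exact hm _ hd had hdy
  have hX3 := hbig hXY hX hn
  have hY3 := hbig (X := Y) (Y := X) (fun v => by rw [hXY]; tauto) hY
    (fun a ha b hb h => hn b hb a ha h.symm)
  have hzY := hdis z hzX
  have hAs : insert y X ⊆ s := by
    intro v hv
    rw [Finset.mem_insert] at hv
    rw [hXY]; tauto
  have hBs : insert y (insert z Y) ⊆ s := by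
    intro v hv
    simp only [Finset.mem_insert] at hv
    rcases hv with rfl | rfl | hv
    · exact hy
    · exact (hXY _).2 (Or.inr (Or.inl hzX))
    · exact (hXY _).2 (Or.inr (Or.inr hv))
  have cA : (insert y X).card = X.card + 1 := Finset.card_insert_of_notMem hyX
  have cB : (insert y (insert z Y)).card = Y.card + 2 := by
    rw [Finset.card_insert_of_notMem, Finset.card_insert_of_notMem hzY]
    simp only [Finset.mem_insert]
    rintro (rfl | h)
    · exact hyX hzX
    · exact hyY h
  have cs : s.card = X.card + Y.card + 1 := by
    have : s = insert y (X ∪ Y) := by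
      ext v; rw [hXY]; simp
    rw [this, Finset.card_insert_of_notMem (by simp [hyX, hyY]),
      Finset.card_union_of_disjoint (Finset.disjoint_left.2 hdis)]
  have eA := ih G (insert y X) (by omega) (by omega)
    (hp.mono (by exact_mod_cast hAs) fun _ _ _ _ h => h)
  have eB := ih G (insert y (insert z Y)) (by omega) (by omega)
    (hp.mono (by exact_mod_cast hBs) fun _ _ _ _ h => h)
  refine emb_glue eA eB (y := y) (z := z) ?_ ?_ (by simp) (by simp [hzX]) hyz hyz ?_
  · intro v
    rw [hXY]
    simp only [Finset.mem_insert]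
    constructor
    · tauto
    · rintro ((h | h) | (h | rfl | h))
      · exact Or.inl h
      · exact Or.inr (Or.inl h)
      · exact Or.inl h
      · exact Or.inr (Or.inl hzX)
      · exact Or.inr (Or.inr h)
  · intro v h1 h2
    simp only [Finset.mem_insert] at h1 h2
    have := hdis v
    tauto
  · intro a ha b hb hab
    rw [hXY] at ha hb
    simp only [Finset.mem_insert]
    have h1 := hn a
    have h2 := hn b
    have h3 := hab.symm
    grind

omit [DecidableEq V] [Fintype V] in
theorem exists_split_of_not_conn {G : SimpleGraph V} {s : Finset V} (hne : s.Nonempty)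
    (h : ¬ Conn G (s : Set V)) : ∃ X Y : Finset V, (∀ v, v ∈ s ↔ v ∈ X ∨ v ∈ Y) ∧
      (∀ v ∈ X, v ∉ Y) ∧ X.Nonempty ∧ Y.Nonempty ∧ ∀ a ∈ X, ∀ b ∈ Y, ¬ G.Adj a b := by
  classical
  unfold Conn at h
  push Not at h
  obtain ⟨C, ⟨a, ha, haC⟩, hC, hn⟩ := h (by simpa using hne)
  obtain ⟨b, hb, hbC⟩ := Set.not_subset.1 hn
  refine ⟨s.filter (· ∈ C), s.filter (· ∉ C), ?_, ?_, ⟨a, ?_⟩, ⟨b, ?_⟩, ?_⟩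
  · intro v
    simp only [Finset.mem_filter]
    tauto
  · intro v
    simp only [Finset.mem_filter]
    tauto
  · simpa using ⟨ha, haC⟩
  · simpa using ⟨hb, hbC⟩
  · intro p hp q hq hpq
    rw [Finset.mem_filter] at hp hq
    exact hq.2 (hC p hp.1 hp.2 q hq.1 hpq)

theorem emb_of_cut_pair {G : SimpleGraph V} {s : Finset V} (hp : Pl G (s : Set V))
    (ih : ∀ (G' : SimpleGraph V) (s' : Finset V), s'.card < s.card → 4 ≤ s'.card →
      Pl G' (s' : Set V) → Emb G' s')
    (hδ : ∀ a ∈ s, ∀ y z, ∃ b ∈ s, G.Adj a b ∧ b ≠ y ∧ b ≠ z)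
    (hcon : ∀ y ∈ s, Conn G ((s.erase y : Finset V) : Set V)) {y z : V} (hy : y ∈ s) (hz : z ∈ s)
    (hyz : y ≠ z)
    {X Y : Finset V} (hXY : ∀ v, v ∈ (s.erase y).erase z ↔ v ∈ X ∨ v ∈ Y)
    (hdis : ∀ v ∈ X, v ∉ Y) (hX : X.Nonempty) (hY : Y.Nonempty)
    (hn : ∀ a ∈ X, ∀ b ∈ Y, ¬ G.Adj a b) : Emb G s := by
  have side : ∀ {X Y : Finset V}, (∀ v, v ∈ (s.erase y).erase z ↔ v ∈ X ∨ v ∈ Y) →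
      (∀ v ∈ X, v ∉ Y) → X.Nonempty → Y.Nonempty → (∀ a ∈ X, ∀ b ∈ Y, ¬ G.Adj a b) →
      Emb (G ⊔ SimpleGraph.edge y z) (insert y (insert z X)) := by
    intro X Y hXY hdis hX hY hn
    simp only [Finset.mem_erase] at hXY
    have hyX : y ∉ X := fun h => ((hXY y).2 (Or.inl h)).2.1 rfl
    have hzX : z ∉ X := fun h => ((hXY z).2 (Or.inl h)).1 rfl
    have hyY : y ∉ Y := fun h => ((hXY y).2 (Or.inr h)).2.1 rfl
    have hzY : z ∉ Y := fun h => ((hXY z).2 (Or.inr h)).1 rfl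
    have hsub : insert y (insert z X) ⊆ s := by
      intro v hv
      simp only [Finset.mem_insert] at hv
      rcases hv with rfl | rfl | hv
      · exact hy
      · exact hz
      · exact ((hXY v).2 (Or.inl hv)).2.2
    have c1 : (insert y (insert z X)).card = X.card + 2 := by
      rw [Finset.card_insert_of_notMem (by simp [hyX, hyz]), Finset.card_insert_of_notMem hzX]
    obtain ⟨b, hb⟩ := hY
    have c2 : (insert y (insert z X)).card < s.card := by
      refine Finset.card_lt_card ⟨hsub, fun h => ?_⟩
      have := h ((hXY b).2 (Or.inr hb)).2.2
      simp only [Finset.mem_insert] at this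
      rcases this with rfl | rfl | h
      · exact hyY hb
      · exact hzY hb
      · exact hdis b h hb
    have c3 : 2 ≤ X.card := by
      obtain ⟨a, ha⟩ := hX
      obtain ⟨d, hd, had, hdy, hdz⟩ := hδ a ((hXY a).2 (Or.inl ha)).2.2 y z
      rw [← Finset.card_pair had.ne]
      refine Finset.card_le_card ?_
      intro v hv
      simp only [Finset.mem_insert, Finset.mem_singleton] at hv
      rcases hv with rfl | rfl
      · exact ha
      · rcases (hXY _).1 ⟨hdz, hdy, hd⟩ with h | h
        · exact h
        · exact absurd had (hn a ha _ h)
    have hC := conn_comp (G := G) (S := (Y : Set V)) (r := b) hb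
    have hCY := comp_subset G (Y : Set V) b
    have touch : ∀ p q : V, p ∈ s → q ∈ s → p ≠ q → (∀ v ∈ s, v ≠ p → v ≠ q → v ∈ X ∨ v ∈ Y) →
        p ∉ Y → q ∉ Y → ∃ v ∈ comp G (Y : Set V) b, G.Adj p v := by
      intro p q hps hqs hpq hv hpY hqY
      by_contra! hno
      have := (hcon q hqs).2 (comp G (Y : Set V) b)
        ⟨b, by simpa using And.intro ((hXY b).2 (Or.inr hb)).2.2 (fun h : b = q => hqY (h ▸ hb)),
          mem_comp_self G hb⟩ (by
        intro u hu huC w hw huw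
        simp only [Finset.coe_erase, Set.mem_sdiff, Finset.mem_coe, Set.mem_singleton_iff] at hw
        have hwp : w ≠ p := by
          rintro rfl
          exact hno u huC huw.symm
        rcases hv w hw.1 hwp hw.2 with h | h
        · exact absurd huw.symm (hn w h u (hCY huC))
        · exact comp_closed huC h huw)
      have hp' := this (show p ∈ ((s.erase q : Finset V) : Set V) by
        simpa using And.intro hps hpq)
      exact hpY (hCY hp')
    refine ih _ _ c2 (by omega) (hp.add_edge (C := comp G (Y : Set V) b) (by exact_mod_cast hsub)
      hC ?_ ?_ (by simp) (touch y z hy hz hyz ?_ hyY hzY) (touch z y hz hy hyz.symm ?_ hzY hyY))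
    · intro v hv
      exact ((hXY v).2 (Or.inr (hCY hv))).2.2
    · intro v hv hvX
      have hvY := hCY hv
      simp only [Finset.coe_insert, Set.mem_insert_iff, Finset.mem_coe] at hvX hvY
      rcases hvX with rfl | rfl | h
      · exact hyY hvY
      · exact hzY hvY
      · exact hdis v h hvY
    · intro v h1 h2 h3
      exact (hXY v).1 ⟨h3, h2, h1⟩
    · intro v h1 h2 h3
      exact (hXY v).1 ⟨h2, h3, h1⟩
  have e1 := side hXY hdis hX hY hn
  have e2 := side (fun v => by rw [hXY]; tauto) (fun v h1 h2 => hdis v h2 h1) hY hX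
    (fun a ha b hb h => hn b hb a ha h.symm)
  have hyz' : (G ⊔ SimpleGraph.edge y z).Adj y z := adj_sup_edge.2 (Or.inr ⟨Or.inl ⟨rfl, rfl⟩, hyz⟩)
  simp only [Finset.mem_erase] at hXY
  have hXY' : ∀ v, v ∈ s → v = y ∨ v = z ∨ v ∈ X ∨ v ∈ Y := by
    intro v hv
    have := hXY v
    tauto
  refine emb_glue e1 e2 (y := y) (z := z) ?_ ?_ (by simp) (by simp) hyz' hyz' ?_
  · intro v
    have := hXY v
    simp only [Finset.mem_insert]
    constructor
    · intro hv
      have := hXY' v hv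
      tauto
    · rintro ((rfl | rfl | h) | (rfl | rfl | h)) <;> first | assumption | tauto
  · intro v h1 h2
    simp only [Finset.mem_insert] at h1 h2
    have := hdis v
    tauto
  · intro a ha b hb hab
    have h1 := hn a
    have h2 := hn b
    have h3 := hab.symm
    have h4 := hXY' a ha
    have h5 := hXY' b hb
    have h6 : (G ⊔ SimpleGraph.edge y z).Adj a b := adj_sup_edge.2 (Or.inl hab)
    simp only [Finset.mem_insert]
    grind

end

section

variable {V : Type*} [DecidableEq V]

/-- A 3-connected graph on at least five vertices has a contractible edge. -/
theorem exists_contractible {G : SimpleGraph V} {s : Finset V} (hs : 5 ≤ s.card)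
    (hcon : ∀ y ∈ s, ∀ z ∈ s, y ≠ z → Conn G (((s.erase y).erase z : Finset V) : Set V))
    (hδ : ∀ a ∈ s, ∃ b ∈ s, G.Adj a b) :
    ∃ x ∈ s, ∃ y ∈ s, G.Adj x y ∧ ∀ z ∈ s, z ≠ x → z ≠ y →
      Conn G ((((s.erase x).erase y).erase z : Finset V) : Set V) := by
  by_contra! hbad
  have key : ∀ n, ∀ x ∈ s, ∀ y ∈ s, ∀ z ∈ s, G.Adj x y → z ≠ x → z ≠ y → ∀ C : Finset V,
      C.card = n → C.Nonempty → (∀ v ∈ C, v ∈ s ∧ v ≠ x ∧ v ≠ y ∧ v ≠ z) →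
      (∀ a ∈ C, ∀ b ∈ s, b ≠ x → b ≠ y → b ≠ z → G.Adj a b → b ∈ C) → False := by
    intro n
    induction n using Nat.strong_induction_on with
    | _ n ih =>
      intro x hx y hy z hz hxy hzx hzy C hCn hCne hCs hC
      have hv : ∃ v ∈ C, G.Adj z v := by
        by_contra! hno
        obtain ⟨c, hc⟩ := hCne
        have := (hcon x hx y hy hxy.ne).2 C ⟨c, by
          have := hCs c hc
          simp only [Finset.coe_erase, Set.mem_sdiff, Finset.mem_coe, Set.mem_singleton_iff]
          tauto, hc⟩ (by
          intro a _ haC b hb hab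
          simp only [Finset.coe_erase, Set.mem_sdiff, Finset.mem_coe, Set.mem_singleton_iff] at hb
          refine hC a haC b hb.1.1 hb.1.2 hb.2 ?_ hab
          rintro rfl
          exact hno a haC hab.symm)
        have hzC := this (show z ∈ _ by
          simp only [Finset.coe_erase, Set.mem_sdiff, Finset.mem_coe, Set.mem_singleton_iff]
          tauto)
        exact (hCs z hzC).2.2.2 rfl
      obtain ⟨v, hvC, hzv⟩ := hv
      obtain ⟨hvs, hvx, hvy, hvz⟩ := hCs v hvC
      obtain ⟨w, hw, hwz, hwv, hnc⟩ := hbad z hz v hvs hzv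
      obtain ⟨X, Y, hXY, hdis, hX, hY, hn⟩ := exists_split_of_not_conn (by
        rw [← Finset.card_pos, Finset.card_erase_of_mem (by simp [hw, hwz, hwv]),
          Finset.card_erase_of_mem (by simp [hvs, hvz]), Finset.card_erase_of_mem hz]
        omega) hnc
      simp only [Finset.mem_erase] at hXY
      have fin : ∀ X Y : Finset V, (∀ v', (v' ≠ w ∧ v' ≠ v ∧ v' ≠ z ∧ v' ∈ s) ↔ v' ∈ X ∨ v' ∈ Y) →
          (∀ v ∈ X, v ∉ Y) → X.Nonempty → Y.Nonempty → (∀ a ∈ X, ∀ b ∈ Y, ¬ G.Adj a b) →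
          x ∉ X → y ∉ X → False := by
        intro X Y hXY hdis hX hY hn hxX hyX
        have hXs : ∀ v' ∈ X, v' ≠ w ∧ v' ≠ v ∧ v' ≠ z ∧ v' ∈ s := fun v' h => (hXY v').2 (Or.inl h)
        have hcl : ∀ a ∈ X, ∀ b ∈ s, b ≠ z → b ≠ v → b ≠ w → G.Adj a b → b ∈ X := by
          intro a ha b hb h1 h2 h3 hab
          rcases (hXY b).1 ⟨h3, h2, h1, hb⟩ with h | h
          · exact h
          · exact absurd hab (hn a ha b h)
        have hvX : ∃ d ∈ X, G.Adj v d := by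
          by_contra! hno
          obtain ⟨c, hc⟩ := hX
          have := (hcon z hz w hw hwz.symm).2 X ⟨c, by
            have := hXs c hc
            simp only [Finset.coe_erase, Set.mem_sdiff, Finset.mem_coe, Set.mem_singleton_iff]
            tauto, hc⟩ (by
            intro a _ haC b hb hab
            simp only [Finset.coe_erase, Set.mem_sdiff, Finset.mem_coe,
              Set.mem_singleton_iff] at hb
            refine hcl a haC b hb.1.1 hb.1.2 ?_ hb.2 hab
            rintro rfl
            exact hno a haC hab.symm)
          have hzC := this (show v ∈ _ by
            simp only [Finset.coe_erase, Set.mem_sdiff, Finset.mem_coe, Set.mem_singleton_iff]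
            exact ⟨⟨hvs, hvz⟩, hwv.symm⟩)
          exact (hXs v hzC).2.1 rfl
        obtain ⟨d, hdX, hvd⟩ := hvX
        obtain ⟨hd1, hd2, hd3, hd4⟩ := hXs d hdX
        have hdC : d ∈ C := hC v hvC d hd4 (by rintro rfl; exact hxX hdX)
          (by rintro rfl; exact hyX hdX) hd3 hvd
        refine ih (X ∩ C).card ?_ z hz v hvs w hw hzv hwz hwv (X ∩ C) rfl ⟨d, by simp [hdX, hdC]⟩
          ?_ ?_
        · rw [← hCn]
          refine Finset.card_lt_card ⟨Finset.inter_subset_right, fun h => ?_⟩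
          exact (hXs v (Finset.mem_inter.1 (h hvC)).1).2.1 rfl
        · intro u hu
          have := hXs u (Finset.mem_inter.1 hu).1
          tauto
        · intro a ha b hb h1 h2 h3 hab
          rw [Finset.mem_inter] at ha ⊢
          have hbX := hcl a ha.1 b hb h1 h2 h3 hab
          refine ⟨hbX, hC a ha.2 b hb ?_ ?_ h1 hab⟩
          · rintro rfl; exact hxX hbX
          · rintro rfl; exact hyX hbX
      by_cases h : x ∉ X ∧ y ∉ X
      · exact fin X Y hXY hdis hX hY hn h.1 h.2
      · refine fin Y X (fun v => by rw [hXY]; tauto) (fun v h1 h2 => hdis v h2 h1) hY hX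
          (fun a ha b hb h => hn b hb a ha h.symm) ?_ ?_
        · intro hxY
          have := hdis x
          have := hn y
          have := hxy.symm
          grind
        · intro hyY
          have := hdis y
          have := hn x
          grind
  obtain ⟨x, hx⟩ := Finset.card_pos.1 (by omega : 0 < s.card)
  obtain ⟨y, hy, hxy⟩ := hδ x hx
  obtain ⟨z, hz, hzx, hzy, hnc⟩ := hbad x hx y hy hxy
  obtain ⟨X, Y, hXY, hdis, hX, hY, hn⟩ := exists_split_of_not_conn (by
    rw [← Finset.card_pos, Finset.card_erase_of_mem (by simp [hz, hzx, hzy]),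
      Finset.card_erase_of_mem (by simp [hy, hxy.ne']), Finset.card_erase_of_mem hx]
    omega) hnc
  simp only [Finset.mem_erase] at hXY
  refine key _ x hx y hy z hz hxy hzx hzy X rfl hX ?_ ?_
  · intro v hv
    have := (hXY v).2 (Or.inl hv)
    tauto
  · intro a ha b hb h1 h2 h3 hab
    rcases (hXY b).1 ⟨h3, h2, h1, hb⟩ with h | h
    · exact h
    · exact absurd hab (hn a ha b h)

end

/-- The triangles of `T` reachable from `x` without crossing an edge of `G` inside `W`. -/
def InFace {α : Type*} [DecidableEq α] (G : SimpleGraph α) (W : Set α) (T : Finset (Finset α))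
    (x : α) (t : Finset α) : Prop :=
  t ∈ T ∧ ∀ σ : Finset α → ZMod 2, (∀ a b d d', {a, b, d} ∈ T → {a, b, d'} ∈ T →
    ¬ (a ∈ W ∧ b ∈ W ∧ G.Adj a b) → σ {a, b, d} = σ {a, b, d'}) →
    ∀ a b, {x, a, b} ∈ T → σ t = σ {x, a, b}

theorem Conn.exists_adj {V : Type*} {G : SimpleGraph V} {S : Set V} (h : Conn G S) {a b : V}
    (ha : a ∈ S) (hb : b ∈ S) (hab : b ≠ a) : ∃ c ∈ S, G.Adj a c := by
  by_contra! hno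
  have := h.2 {a} ⟨a, ha, rfl⟩ (by
    rintro p hp rfl q hq hpq
    exact absurd hpq (hno q hq))
  exact hab (this hb)

theorem exists_isCyc {V : Type*} [Finite V] {G : SimpleGraph V}
    (h : ∀ a b, G.Adj a b → ∃ e, e ≠ b ∧ G.Adj a e) {a b : V} (hab : G.Adj a b) :
    ∃ n c, IsCyc G n c := by
  choose! f hf1 hf2 using h
  let p : ℕ → V × V := fun k => (fun q : V × V => (q.2, f q.2 q.1))^[k] (a, b)
  have hp : ∀ k, p (k + 1) = ((p k).2, f (p k).2 (p k).1) := fun k => by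
    simp only [p, Function.iterate_succ', Function.comp]
  have hadj : ∀ k, G.Adj (p k).1 (p k).2 := by
    intro k
    induction k with
    | zero => exact hab
    | succ k ih => rw [hp]; exact hf2 _ _ ih.symm
  let w : ℕ → V := fun k => (p k).1
  have hw1 : ∀ k, G.Adj (w k) (w (k + 1)) := fun k => by
    have := hadj k
    simp only [w, hp]
    exact this
  have hw2 : ∀ k, w (k + 2) ≠ w k := fun k => by
    simp only [w, hp]
    exact hf1 _ _ (hadj k).symm
  have hex : ∃ n, 0 < n ∧ ∃ i, w i = w (i + n) := by
    obtain ⟨i, j, hij, hne⟩ := Function.not_injective_iff.1 (not_injective_infinite_finite w)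
    rcases lt_or_gt_of_ne hne with hlt | hlt
    · exact ⟨j - i, by omega, i, by rw [hij]; congr 1; omega⟩
    · exact ⟨i - j, by omega, j, by rw [← hij]; congr 1; omega⟩
  classical
  obtain ⟨h0, i, hi⟩ := Nat.find_spec hex
  have hmin : ∀ m, 0 < m → m < Nat.find hex → ∀ j, w j ≠ w (j + m) := fun m h1 h2 j hj =>
    Nat.find_min hex h2 ⟨h1, j, hj⟩
  generalize Nat.find hex = n at *
  have hn3 : 3 ≤ n := by
    by_contra hlt
    have : n = 1 ∨ n = 2 := by omega
    rcases this with rfl | rfl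
    · exact (hw1 i).ne hi
    · exact hw2 i hi.symm
  refine ⟨n, fun k => w (i + k % n), hn3, fun k => by simp, fun k l hkl hlt heq => ?_, fun k => ?_⟩
  · have hne : k % n ≠ l % n := by
      intro h
      have := (Nat.modEq_iff_dvd' hkl.le).1 h
      exact absurd (Nat.le_of_dvd (by omega) this) (by omega)
    have h1 := Nat.mod_lt k h0
    have h2 := Nat.mod_lt l h0
    rcases lt_or_gt_of_ne hne with hh | hh
    · refine hmin (l % n - k % n) (by omega) (by omega) (i + k % n) ?_
      rw [heq]; congr 1; omega
    · refine hmin (k % n - l % n) (by omega) (by omega) (i + l % n) ?_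
      rw [← heq]; congr 1; omega
  · by_cases hk : k % n + 1 = n
    · have : (k + 1) % n = 0 := by rw [Nat.add_mod, Nat.mod_eq_of_lt (a := 1) (by omega), hk]; simp
      rw [this, add_zero, hi]
      have h2 := hw1 (i + k % n)
      rwa [add_assoc, hk] at h2
    · have : (k + 1) % n = k % n + 1 := by
        rw [Nat.add_mod, Nat.mod_eq_of_lt (a := 1) (by omega), Nat.mod_eq_of_lt]
        have := Nat.mod_lt k h0
        omega
      rw [this, ← add_assoc]
      exact hw1 _

/-- A cycle is an even chain. -/
theorem IsCyc.exists_chain {α : Type*} [DecidableEq α] [Fintype α] {G : SimpleGraph α} {n : ℕ}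
    {c : ℕ → α} (hc : IsCyc G n c) : ∃ Z : Sym2 α → ZMod 2, (∀ a, deg2 Z a = 0) ∧
      (∀ a b, Z s(a, b) ≠ 0 → ∃ k, s(a, b) = s(c k, c (k + 1))) ∧ Z s(c 0, c 1) ≠ 0 := by
  have hn := hc.three
  refine ⟨∑ k ∈ Finset.range n, Pi.single s(c k, c (k + 1)) 1, fun a => ?_, fun a b hab => ?_, ?_⟩
  · rw [deg2_sum, Finset.sum_congr rfl fun k _ => deg2_single _ _ a (hc.adj k).ne,
      Finset.sum_add_distrib]
    have h1 := Finset.sum_range_succ (fun k => (Pi.single (c k) 1 : α → ZMod 2) a) n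
    rw [Finset.sum_range_succ', ← zero_add n, hc.per 0, zero_add] at h1
    rw [add_right_cancel h1, zmod2_add_self]
  · by_contra! hno
    apply hab
    rw [Finset.sum_apply]
    exact Finset.sum_eq_zero fun k _ => Pi.single_eq_of_ne (hno k) _
  · rw [Finset.sum_apply, Finset.sum_eq_single 0]
    · simp
    · intro k hk hk0
      have hk := Finset.mem_range.1 hk
      refine Pi.single_eq_of_ne (fun h => ?_) _
      rcases Sym2.eq_iff.1 h with ⟨h1, _⟩ | ⟨h1, h2⟩
      · exact hc.inj 0 k (by omega) (by omega) h1
      · rcases Nat.lt_or_ge 1 k with hk1 | hk1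
        · exact hc.inj 1 k hk1 (by omega) h2
        · obtain rfl : k = 1 := by omega
          exact hc.inj 0 2 (by omega) (by omega) h1
    · simp; omega

section

variable {α : Type*} [DecidableEq α] {T : Finset (Finset α)}

/-- The link of a non-separating vertex is connected. -/
theorem IsSphere.link_bd (hT : IsSphere T) {z : α}
    (hz : Conn (tgraph T) {v | v ∈ verts T ∧ v ≠ z}) {P : Finset α → Prop} {a b a' b' : α}
    (h1 : {z, a, b} ∈ T) (hP : P {z, a, b}) (h2 : {z, a', b'} ∈ T) (hP' : ¬ P {z, a', b'}) :
    ∃ e, Bd T P z e := by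
  classical
  by_contra! hno
  have hag : ∀ e d d', {z, e, d} ∈ T → {z, e, d'} ∈ T → P {z, e, d} → P {z, e, d'} := by
    intro e d d' h h' hp
    by_contra hn
    exact hno e ⟨d, d', h, h', hp, hn⟩
  let f : α → ZMod 2 := fun e => if ∃ d, {z, e, d} ∈ T ∧ P {z, e, d} then 1 else 0
  have hf : ∀ e d, {z, e, d} ∈ T → f e = if P {z, e, d} then 1 else 0 := by
    intro e d h
    simp only [f]
    congr 1
    refine propext ⟨fun ⟨d', h', hp⟩ => hag e d' d h' h hp, fun hp => ⟨d, h, hp⟩⟩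
  have hff : ∀ e d, {z, e, d} ∈ T → f e = f d := by
    intro e d h
    rw [hf e d h, hf d e (by rwa [insert_swap']), insert_swap']
  let c : α → α → ZMod 2 := fun a b => (if a = z then f b else 0) + (if b = z then f a else 0)
  obtain ⟨φ, hφ⟩ := hT.h1 c (fun a b => add_comm _ _) (by
    intro p q r h
    obtain ⟨n1, n2, n3⟩ := hT.ne h
    simp only [c]
    by_cases hp : p = z
    · subst hp
      have := hff q r h
      simp [n1.symm, n3.symm, this, zmod2_add_self]
    by_cases hq : q = z
    · subst hq
      have := hff p r (by rwa [insert_swap])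
      simp [n1, n2.symm, this, zmod2_add_self]
    by_cases hr : r = z
    · subst hr
      have := hff p q (by rwa [insert_rot r p q])
      simp [n3, n2, this, zmod2_add_self]
    simp [hp, hq, hr])
  have hconst : ∀ v, v ∈ verts T → v ≠ z → φ v = φ a := by
    intro v hv hvz
    have := hz.2 {w | φ w = φ a} ⟨a, ⟨(hT.tedge' h1).1.right, (hT.ne h1).1.symm⟩, rfl⟩ (by
      rintro p ⟨_, hp⟩ hpa q ⟨_, hq⟩ hpq
      have h := hφ p q hpq
      simp only [c, hp, hq, if_false, add_zero] at h
      have h' : φ p = φ a := hpa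
      have : φ q = φ p := (CharTwo.add_eq_zero.1 h.symm).symm
      exact this.trans h')
    exact this ⟨hv, hvz⟩
  have e1 := hφ z a (hT.tedge h1)
  have e2 := hφ z a' (hT.tedge h2)
  rw [hconst a' (hT.tedge' h2).1.right (hT.ne h2).1.symm, ← e1] at e2
  simp only [c, if_true, (hT.ne h1).1.symm, (hT.ne h2).1.symm, if_false] at e2
  rw [hf _ _ h1, hf _ _ h2] at e2
  simp [hP, hP'] at e2

/-- The configuration obtained by contracting an edge of a 3-connected graph to `x`. -/
structure Contracted (G : SimpleGraph α) (W : Set α) (T : Finset (Finset α)) (x : α) : Prop where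
  sphere : IsSphere T
  conn : Conn G W
  conn' : ∀ w ∈ W, Conn G {v | v ∈ W ∧ v ≠ w}
  deg : ∀ a ∈ W, ∀ b, ∃ a' ∈ W, G.Adj a a' ∧ a' ≠ b
  notMem : x ∉ W
  vert : ∀ v, v ∈ verts T ↔ v = x ∨ v ∈ W
  vconn : ∀ z ∈ verts T, Conn (tgraph T) {v | v ∈ verts T ∧ v ≠ z}
  adj : ∀ a ∈ W, ∀ b ∈ W, G.Adj a b → TEdge T a b

namespace Contracted

variable {G : SimpleGraph α} {W : Set α} {x : α} (h : Contracted G W T x)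
include h

theorem star {a b : α} (hab : {x, a, b} ∈ T) : InFace G W T x {x, a, b} := by
  refine ⟨hab, fun σ hσ a' b' h' => ?_⟩
  by_contra hne
  obtain ⟨e, d, d', h1, h2, h3, h4⟩ := h.sphere.link_bd
    (h.vconn x ((h.vert x).2 (Or.inl rfl))) (P := fun t => σ t = σ {x, a, b}) hab rfl h'
    (fun h => hne h.symm)
  exact h4 ((hσ x e d d' h1 h2 (fun hh => h.notMem hh.1)).symm.trans h3)

omit h in
theorem cross {a b d d' : α} (hd : InFace G W T x {a, b, d}) (hd' : {a, b, d'} ∈ T)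
    (hn : ¬ (a ∈ W ∧ b ∈ W ∧ G.Adj a b)) : InFace G W T x {a, b, d'} :=
  ⟨hd', fun σ hσ p q hpq => (hσ a b d' d hd' hd.1 hn).trans (hd.2 σ hσ p q hpq)⟩

omit h in
theorem bd_edge {a b : α} (hab : Bd T (InFace G W T x) a b) : a ∈ W ∧ b ∈ W ∧ G.Adj a b := by
  by_contra hn
  obtain ⟨d, d', h1, h2, h3, h4⟩ := hab
  exact h4 (cross h3 h2 hn)

theorem dual [Fintype α] {Z : Sym2 α → ZMod 2}
    (hs : ∀ a b, Z s(a, b) ≠ 0 → a ∈ W ∧ b ∈ W ∧ G.Adj a b) (he : ∀ a, deg2 Z a = 0) :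
    ∃ σ : Finset α → ZMod 2, (∀ a b d d', d ≠ d' → {a, b, d} ∈ T → {a, b, d'} ∈ T →
      Z s(a, b) = σ {a, b, d} + σ {a, b, d'}) ∧ ∀ t, InFace G W T x t → σ t = 0 := by
  obtain ⟨σ, hσ⟩ := h.sphere.dual' Z (fun a b hab =>
    h.adj a (hs a b hab).1 b (hs a b hab).2.1 (hs a b hab).2.2) he
  obtain ⟨p, q, hpq⟩ := h.sphere.exists_tri_of_mem ((h.vert x).2 (Or.inl rfl))
  refine ⟨fun t => σ t + σ {x, p, q}, fun a b d d' hne h1 h2 => ?_, fun t ht => ?_⟩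
  · rw [hσ a b d d' hne h1 h2, add_add_add_comm, zmod2_add_self, add_zero]
  · simp only
    rw [ht.2 σ ?_ p q hpq, zmod2_add_self]
    intro a b d d' h1 h2 hn
    by_cases hdd : d = d'
    · rw [hdd]
    · have h0 : Z s(a, b) = 0 := by
        by_contra h0
        exact hn (hs a b h0)
      rw [hσ a b d d' hdd h1 h2] at h0
      exact CharTwo.add_eq_zero.1 h0

/-- Two edges at `w` extend to an even chain without further edges at `w`. -/
theorem exists_even [Fintype α] {w a b : α} (hw : w ∈ W) (ha : a ∈ W) (hb : b ∈ W)
    (hwa : G.Adj w a) (hwb : G.Adj w b) : ∃ Z : Sym2 α → ZMod 2,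
      (∀ p q, Z s(p, q) ≠ 0 → p ∈ W ∧ q ∈ W ∧ G.Adj p q) ∧ (∀ p, deg2 Z p = 0) ∧
      ∃ P : Sym2 α → ZMod 2, (∀ q, P s(w, q) = 0) ∧
        Z = P + Pi.single s(w, a) 1 + Pi.single s(w, b) 1 := by
  obtain ⟨P, hP1, hP2⟩ := exists_chain (h.conn' w hw) (a := a) (b := b) ⟨ha, hwa.ne'⟩ ⟨hb, hwb.ne'⟩
  refine ⟨_, fun p q hpq => ?_, fun p => ?_, P, fun q => ?_, rfl⟩
  · by_cases h0 : P s(p, q) = 0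
    · simp only [Pi.add_apply, h0, zero_add, Pi.single_apply, Sym2.eq_iff] at hpq
      by_cases h1 : p = w ∧ q = a ∨ p = a ∧ q = w
      · rcases h1 with ⟨rfl, rfl⟩ | ⟨rfl, rfl⟩
        exacts [⟨hw, ha, hwa⟩, ⟨ha, hw, hwa.symm⟩]
      · rw [if_neg h1, zero_add] at hpq
        by_cases h2 : p = w ∧ q = b ∨ p = b ∧ q = w
        · rcases h2 with ⟨rfl, rfl⟩ | ⟨rfl, rfl⟩
          exacts [⟨hw, hb, hwb⟩, ⟨hb, hw, hwb.symm⟩]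
        · rw [if_neg h2] at hpq
          exact absurd rfl hpq
    · obtain ⟨h1, h2, h3⟩ := hP1 p q h0
      exact ⟨h2.1, h3.1, h1⟩
  · rw [deg2_add, deg2_add, hP2, deg2_single _ _ _ hwa.ne, deg2_single _ _ _ hwb.ne]
    generalize (Pi.single a 1 : α → ZMod 2) p = r
    generalize (Pi.single b 1 : α → ZMod 2) p = s
    generalize (Pi.single w 1 : α → ZMod 2) p = t
    revert r s t
    decide
  · by_contra h0
    exact (hP1 w q h0).2.1.2 rfl

theorem not_both [Fintype α] {a b d d' : α} (ha : a ∈ W) (hb : b ∈ W) (hab : G.Adj a b)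
    (hne : d ≠ d') (h1 : InFace G W T x {a, b, d}) (h2 : InFace G W T x {a, b, d'}) : False := by
  obtain ⟨a', ha', haa', hne'⟩ := h.deg a ha b
  obtain ⟨Z, hZ1, hZ2, P, hP, hZ⟩ := h.exists_even ha hb ha' hab haa'
  obtain ⟨σ, hσ, hσ0⟩ := h.dual hZ1 hZ2
  have := hσ a b d d' hne h1.1 h2.1
  rw [hσ0 _ h1, hσ0 _ h2, hZ, Pi.add_apply, Pi.add_apply, hP, Pi.single_eq_same,
    Pi.single_eq_of_ne] at this
  · simp at this
  · intro he
    rcases Sym2.eq_iff.1 he with ⟨_, h⟩ | ⟨h, _⟩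
    · exact hne' h.symm
    · exact haa'.ne h

theorem outer [Fintype α] {a b : α} (ha : a ∈ W) (hb : b ∈ W) (hab : G.Adj a b) :
    ∃ d, {a, b, d} ∈ T ∧ ¬ InFace G W T x {a, b, d} := by
  obtain ⟨d, d', hne, h1, h2, _⟩ := h.sphere.exists_two (h.adj a ha b hb hab)
  by_contra! hno
  exact h.not_both ha hb hab hne (hno d h1) (hno d' h2)

theorem exists_bd_at [Fintype α] {z p q : α} (hz : z ≠ x) (hzp : InFace G W T x {z, p, q}) :
    ∃ e, Bd T (InFace G W T x) z e := by
  have hv : z ∈ verts T := (h.sphere.tedge hzp.1).left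
  have hzW : z ∈ W := ((h.vert z).1 hv).resolve_left hz
  obtain ⟨b, hb, hzb, _⟩ := h.deg z hzW z
  obtain ⟨d, hd, hnd⟩ := h.outer hzW hb hzb
  exact h.sphere.link_bd (h.vconn z hv) hzp.1 hzp hd hnd

theorem twist [Fintype α] {Z₀ Z : Sym2 α → ZMod 2} {σ : Finset α → ZMod 2}
    (hD : ∀ a b, Z₀ s(a, b) ≠ 0 → Bd T (InFace G W T x) a b)
    (hσ : ∀ a b d d', d ≠ d' → {a, b, d} ∈ T → {a, b, d'} ∈ T →
      Z₀ s(a, b) = σ {a, b, d} + σ {a, b, d'})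
    (hs : ∀ a b, Z s(a, b) ≠ 0 → a ∈ W ∧ b ∈ W ∧ G.Adj a b) (he : ∀ a, deg2 Z a = 0) :
    ∃ C : Sym2 α → ZMod 2, (∀ a, deg2 C a = 0) ∧
      (∀ a b, C s(a, b) ≠ 0 → Z s(a, b) ≠ 0) ∧
      ∀ a b d, {a, b, d} ∈ T → ¬ InFace G W T x {a, b, d} →
        C s(a, b) = Z s(a, b) * σ {a, b, d} := by
  obtain ⟨ρ, hρ, hρ0⟩ := h.dual hs he
  have key : ∀ a b d d', d ≠ d' → {a, b, d} ∈ T → {a, b, d'} ∈ T →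
      ¬ InFace G W T x {a, b, d} →
      (∑ t ∈ T, (ρ t * σ t) • bd t) s(a, b) = Z s(a, b) * σ {a, b, d} := by
    intro a b d d' hne h1 h2 hn
    rw [h.sphere.sum_bd (fun t => ρ t * σ t) h1 h2 hne, hρ a b d d' hne h1 h2]
    by_cases hf : InFace G W T x {a, b, d'}
    · rw [hρ0 _ hf]; ring
    · have h0 : Z₀ s(a, b) = 0 := by
        by_contra h0
        obtain ⟨e, e', f1, f2, f3, f4⟩ := hD a b h0
        rcases h.sphere.third h1 h2 hne f1 with rfl | rfl
        exacts [hn f3, hf f3]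
      rw [hσ a b d d' hne h1 h2] at h0
      rw [CharTwo.add_eq_zero.1 h0]; ring
  refine ⟨∑ t ∈ T, (ρ t * σ t) • bd t, fun a => ?_, fun a b hC hZ => ?_, fun a b d h1 hn => ?_⟩
  · rw [deg2_sum]
    refine Finset.sum_eq_zero fun t ht => ?_
    rw [deg2_smul, deg2_bd (h.sphere.card t ht), mul_zero]
  · by_cases hab : TEdge T a b
    · obtain ⟨d, d', hne, h1, h2, _⟩ := h.sphere.exists_two hab
      by_cases hf : InFace G W T x {a, b, d}
      · by_cases hf' : InFace G W T x {a, b, d'}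
        · rw [h.sphere.sum_bd (fun t => ρ t * σ t) h1 h2 hne, hρ0 _ hf, hρ0 _ hf'] at hC
          simp at hC
        · rw [key a b d' d hne.symm h2 h1 hf', hZ, zero_mul] at hC
          exact hC rfl
      · rw [key a b d d' hne h1 h2 hf, hZ, zero_mul] at hC
        exact hC rfl
    · apply hC
      rw [Finset.sum_apply]
      refine Finset.sum_eq_zero fun t ht => ?_
      rw [Pi.smul_apply, bd_mk, if_neg, smul_zero]
      rintro ⟨ha, hb, hne⟩
      exact hab ⟨hne, t, ht, ha, hb⟩
  · obtain ⟨d', hne, h2, _⟩ := h.sphere.two a b d h1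
    exact key a b d d' hne.symm h1 h2 hn

/-- The boundary of the face is a minimal even chain. -/
theorem minimal [Fintype α] {Z₀ : Sym2 α → ZMod 2}
    (hD : ∀ a b, Z₀ s(a, b) ≠ 0 → Bd T (InFace G W T x) a b) (he : ∀ a, deg2 Z₀ a = 0)
    {p q : α} (hpq : Z₀ s(p, q) ≠ 0) {a b : α} (hab : Bd T (InFace G W T x) a b) :
    Z₀ s(a, b) ≠ 0 := by
  intro hab0
  obtain ⟨σ, hσ, hσ0⟩ := h.dual (fun a b hZ => bd_edge (hD a b hZ)) he
  let E : α → α → Prop := fun u v => ∀ d, {u, v, d} ∈ T → ¬ InFace G W T x {u, v, d} →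
    σ {u, v, d} = 1
  have hEs : ∀ u v, E u v → E v u := by
    intro u v huv d h1 h2
    rw [insert_swap] at h1 h2 ⊢
    exact huv d h1 h2
  have hnE : ∀ u v, ¬ E u v → ∃ d, {u, v, d} ∈ T ∧ ¬ InFace G W T x {u, v, d} ∧
      σ {u, v, d} = 0 := by
    intro u v huv
    simp only [E, not_forall] at huv
    obtain ⟨d, h1, h2, h3⟩ := huv
    refine ⟨d, h1, h2, ?_⟩
    by_contra h0
    exact h3 (zmod2_ne_zero h0)
  have mixed : ∀ w ∈ W, ∀ u ∈ W, ∀ v ∈ W, G.Adj w u → G.Adj w v → E w u → ¬ E w v → False := by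
    intro w hw u hu v hv hwu hwv hEu hEv
    have huv : u ≠ v := by rintro rfl; exact hEv hEu
    obtain ⟨Z, hZ1, hZ2, P, hP, hZ⟩ := h.exists_even hw hu hv hwu hwv
    obtain ⟨C, hC1, hC2, hC3⟩ := h.twist hD hσ hZ1 hZ2
    obtain ⟨d, hd, hnd⟩ := h.outer hw hu hwu
    obtain ⟨e, hf, hnf, h0⟩ := hnE w v hEv
    have hZw : ∀ r, Z s(w, r) = (if r = u then 1 else 0) + (if r = v then 1 else 0) := by
      intro r
      have h1 := hwu.ne
      have h2 := hwv.ne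
      rw [hZ, Pi.add_apply, Pi.add_apply, hP, zero_add, Pi.single_apply, Pi.single_apply]
      congr 2
      · simp [h1]
      · simp [h2]
    have hCu : C s(w, u) ≠ 0 := by
      rw [hC3 w u d hd hnd, hEu d hd hnd, hZw]
      simp [huv]
    obtain ⟨r, hr, hCr⟩ := exists_other hC1 hCu
    have hrv : r = v := by
      have := hC2 w r hCr
      rw [hZw, if_neg hr, zero_add] at this
      by_contra hrv
      simp [hrv] at this
    subst hrv
    rw [hC3 w r e hf hnf, h0, mul_zero] at hCr
    exact hCr rfl
  have hpE : E p q := by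
    obtain ⟨d, d', h1, h2, h3, h4⟩ := hD p q hpq
    intro e he hne
    have hde : d ≠ e := by rintro rfl; exact hne h3
    have := hσ p q d e hde h1 he
    rw [hσ0 _ h3, zero_add] at this
    rw [← this]
    exact zmod2_ne_zero hpq
  have haE : ¬ E a b := by
    intro hE
    obtain ⟨d, d', h1, h2, h3, h4⟩ := hab
    have hdd : d ≠ d' := by rintro rfl; exact h4 h3
    have := hσ a b d d' hdd h1 h2
    rw [hσ0 _ h3, zero_add, hE d' h2 h4, hab0] at this
    simp at this
  obtain ⟨ha, hb, hab'⟩ := bd_edge hab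
  obtain ⟨hp, hq, hpq'⟩ := bd_edge (hD p q hpq)
  have hall := h.conn.2 {v | ∃ u ∈ W, G.Adj v u ∧ E v u} ⟨p, hp, q, hq, hpq', hpE⟩ (by
    rintro v hv ⟨u, hu, hvu, hE⟩ v' hv' hvv'
    refine ⟨v, hv, hvv'.symm, ?_⟩
    by_contra hE'
    exact mixed v hv u hu v' hv' hvu hvv' hE (fun hh => hE' (hEs _ _ hh)))
  obtain ⟨u, hu, hau, hE⟩ := hall ha
  exact mixed a ha u hu b hb hau hab' hE haE

/-- The face is bounded by a cycle. -/
theorem exists_cycle [Fintype α] : ∃ n c, IsCyc G n c ∧ (∀ k, c k ∈ W) ∧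
    (∀ a b, Bd T (InFace G W T x) a b ↔ ∃ k, s(a, b) = s(c k, c (k + 1))) ∧
    ∀ z p q, z ≠ x → InFace G W T x {z, p, q} → ∃ k, c k = z := by
  let D : SimpleGraph α :=
    { Adj := Bd T (InFace G W T x)
      symm := ⟨fun _ _ h => h.symm⟩
      loopless := ⟨fun _ h' => (h.sphere.tedge_of_bd h').1 rfl⟩ }
  obtain ⟨p, q, hpq⟩ := h.sphere.exists_tri_of_mem ((h.vert x).2 (Or.inl rfl))
  obtain ⟨e, he⟩ := h.exists_bd_at (z := p) (p := x) (q := q) (h.sphere.ne hpq).1.symm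
    (by rw [insert_swap]; exact h.star hpq)
  obtain ⟨n, c, hc⟩ := exists_isCyc (G := D) (fun a b hab => h.sphere.exists_other_bd hab) he
  obtain ⟨Z, hZ1, hZ2, hZ3⟩ := hc.exists_chain
  have hbd : ∀ a b, (∃ k, s(a, b) = s(c k, c (k + 1))) → Bd T (InFace G W T x) a b := by
    rintro a b ⟨k, hk⟩
    rcases Sym2.eq_iff.1 hk with ⟨rfl, rfl⟩ | ⟨rfl, rfl⟩
    exacts [hc.adj k, (hc.adj k).symm]
  have hiff : ∀ a b, Bd T (InFace G W T x) a b ↔ ∃ k, s(a, b) = s(c k, c (k + 1)) := fun a b =>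
    ⟨fun hab => hZ2 a b (h.minimal (fun a b hz => hbd a b (hZ2 a b hz)) hZ1 hZ3 hab), hbd a b⟩
  refine ⟨n, c, ⟨hc.three, hc.per, hc.inj, fun i => (bd_edge (hc.adj i)).2.2⟩,
    fun k => (bd_edge (hc.adj k)).1, hiff, fun z p q hz hzp => ?_⟩
  obtain ⟨e, he⟩ := h.exists_bd_at hz hzp
  obtain ⟨k, hk⟩ := (hiff z e).1 he
  rcases Sym2.eq_iff.1 hk with ⟨rfl, -⟩ | ⟨rfl, -⟩
  exacts [⟨k, rfl⟩, ⟨k + 1, rfl⟩]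

end Contracted

end

namespace IsCyc

variable {V : Type*} {G : SimpleGraph V} {n : ℕ} {c : ℕ → V}

theorem per_mul (hc : IsCyc G n c) (i m : ℕ) : c (i + m * n) = c i := by
  induction m with
  | zero => simp
  | succ m ih => rw [Nat.succ_mul, ← add_assoc, hc.per, ih]

theorem window (hc : IsCyc G n c) (m k : ℕ) : ∃ k', m ≤ k' ∧ k' < m + n ∧ c k' = c k := by
  have hn := hc.three
  have h1 := Nat.mod_lt (k + m * n - m) (show 0 < n by omega)
  have h2 := Nat.mod_add_div (k + m * n - m) n
  have h3 : m ≤ m * n := Nat.le_mul_of_pos_right m (by omega)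
  refine ⟨m + (k + m * n - m) % n, by omega, by omega, ?_⟩
  rw [← hc.per_mul k m, ← hc.per_mul _ ((k + m * n - m) / n), mul_comm (_ / n) n]
  congr 1
  omega

theorem eq_iff (hc : IsCyc G n c) {m i j : ℕ} (hi : m ≤ i) (hi' : i < m + n) (hj : m ≤ j)
    (hj' : j < m + n) : c i = c j ↔ i = j := by
  refine ⟨fun h => ?_, fun h => by rw [h]⟩
  rcases lt_trichotomy i j with hlt | hlt | hlt
  · exact absurd h (hc.inj i j hlt (by omega))
  · exact hlt
  · exact absurd h.symm (hc.inj j i hlt (by omega))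

theorem conn_arc (hc : IsCyc G n c) {i j : ℕ} (hij : i < j) : Conn G (c '' Set.Ico i j) :=
  conn_image_Ico hij fun k _ _ => hc.adj k

theorem disjoint_arc (hc : IsCyc G n c) {i j k l : ℕ} (hjk : j ≤ k) (hl : l ≤ i + n) :
    Disjoint (c '' Set.Ico i j) (c '' Set.Ico k l) := by
  rw [Set.disjoint_left]
  rintro _ ⟨p, ⟨hp1, hp2⟩, rfl⟩ ⟨q, ⟨hq1, hq2⟩, he⟩
  exact hc.inj p q (by omega) (by omega) he.symm

theorem touch_arc (hc : IsCyc G n c) {i j k : ℕ} (hij : i < j) (hjk : j < k) :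
    Touch G (c '' Set.Ico i j) (c '' Set.Ico j k) := by
  refine ⟨c (j - 1), ⟨j - 1, ⟨by omega, by omega⟩, rfl⟩, c j, ⟨j, ⟨le_rfl, hjk⟩, rfl⟩, ?_⟩
  have := hc.adj (j - 1)
  rwa [show j - 1 + 1 = j by omega] at this

theorem touch_arc' (hc : IsCyc G n c) {i j k : ℕ} (hij : i < j) (hjk : k < i + n) :
    Touch G (c '' Set.Ico k (i + n)) (c '' Set.Ico i j) := by
  refine ⟨c (i + n - 1), ⟨i + n - 1, ⟨by omega, by omega⟩, rfl⟩, c i, ⟨i, ⟨le_rfl, hij⟩, rfl⟩, ?_⟩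
  have := hc.adj (i + n - 1)
  rwa [show i + n - 1 + 1 = i + n by omega, hc.per] at this

theorem mem_arc {i j : ℕ} (hij : i < j) : c i ∈ c '' Set.Ico i j := ⟨i, ⟨le_rfl, hij⟩, rfl⟩

end IsCyc

section

variable {V : Type*} {G : SimpleGraph V} {s : Set V} {n : ℕ} {c : ℕ → V} {x y : V}

theorem Pl.no_alternation (hp : Pl G s) (hc : IsCyc G n c) (hcs : ∀ k, c k ∈ s)
    (hx : x ∈ s) (hy : y ∈ s) (hxc : ∀ k, c k ≠ x) (hyc : ∀ k, c k ≠ y) (hxy : G.Adj x y)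
    {i j k l : ℕ} (hij : i < j) (hjk : j < k) (hkl : k < l) (hl : l < i + n)
    (hi : G.Adj x (c i)) (hj : G.Adj y (c j)) (hk : G.Adj x (c k)) (hl' : G.Adj y (c l)) :
    False := by
  have hsub : ∀ p q, c '' Set.Ico p q ⊆ s := by rintro p q _ ⟨r, -, rfl⟩; exact hcs r
  have hdx : ∀ p q, Disjoint (c '' Set.Ico p q) {x} := by
    intro p q; rw [Set.disjoint_singleton_right]; rintro ⟨r, -, h⟩; exact hxc r h
  have hdy : ∀ p q, Disjoint (c '' Set.Ico p q) {y} := by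
    intro p q; rw [Set.disjoint_singleton_right]; rintro ⟨r, -, h⟩; exact hyc r h
  have hyx : Disjoint ({y} : Set V) {x} := by simpa using hxy.ne'
  refine hp.no_K33' (c '' Set.Ico i j) (c '' Set.Ico k l) {y} (c '' Set.Ico j k)
    (c '' Set.Ico l (i + n)) {x}
    ⟨hc.conn_arc hij, hc.conn_arc hkl, Conn.singleton _ _, hc.conn_arc hjk, hc.conn_arc hl,
      Conn.singleton _ _⟩
    ⟨hsub _ _, hsub _ _, Set.singleton_subset_iff.2 hy, hsub _ _, hsub _ _,
      Set.singleton_subset_iff.2 hx⟩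
    ⟨⟨hc.disjoint_arc (by omega) (by omega), hdy _ _, hdy _ _⟩,
      ⟨hc.disjoint_arc (by omega) (by omega), hdx _ _, hdx _ _⟩,
      ⟨hc.disjoint_arc (by omega) (by omega), hc.disjoint_arc (by omega) (by omega), hdx _ _⟩,
      ⟨(hc.disjoint_arc (by omega) (by omega)).symm, hc.disjoint_arc (by omega) (by omega),
        hdx _ _⟩, (hdy _ _).symm, (hdy _ _).symm, hyx⟩
    ⟨⟨hc.touch_arc hij hjk, (hc.touch_arc' hij hl).symm, ?_⟩,
      ⟨(hc.touch_arc hjk hkl).symm, hc.touch_arc hkl hl, ?_⟩, ?_, ?_, ?_⟩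
  · exact hi.symm.touch (IsCyc.mem_arc hij) rfl
  · exact hk.symm.touch (IsCyc.mem_arc hkl) rfl
  · exact hj.touch rfl (IsCyc.mem_arc hjk)
  · exact hl'.touch rfl (IsCyc.mem_arc hl)
  · exact hxy.symm.touch rfl rfl

theorem Pl.no_common_three (hp : Pl G s) (hc : IsCyc G n c) (hcs : ∀ k, c k ∈ s)
    (hx : x ∈ s) (hy : y ∈ s) (hxc : ∀ k, c k ≠ x) (hyc : ∀ k, c k ≠ y) (hxy : G.Adj x y)
    {i j k : ℕ} (hij : i < j) (hjk : j < k) (hk : k < i + n)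
    (hi : G.Adj x (c i) ∧ G.Adj y (c i)) (hj : G.Adj x (c j) ∧ G.Adj y (c j))
    (hk' : G.Adj x (c k) ∧ G.Adj y (c k)) : False := by
  have hsub : ∀ p q, c '' Set.Ico p q ⊆ s := by rintro p q _ ⟨r, -, rfl⟩; exact hcs r
  have hdx : ∀ p q, Disjoint (c '' Set.Ico p q) {x} := by
    intro p q; rw [Set.disjoint_singleton_right]; rintro ⟨r, -, h⟩; exact hxc r h
  have hdy : ∀ p q, Disjoint (c '' Set.Ico p q) {y} := by
    intro p q; rw [Set.disjoint_singleton_right]; rintro ⟨r, -, h⟩; exact hyc r h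
  have hyx : Disjoint ({x} : Set V) {y} := by simpa using hxy.ne
  refine hp.no_K5' (c '' Set.Ico i j) (c '' Set.Ico j k) (c '' Set.Ico k (i + n)) {x} {y}
    ⟨hc.conn_arc hij, hc.conn_arc hjk, hc.conn_arc hk, Conn.singleton _ _, Conn.singleton _ _⟩
    ⟨hsub _ _, hsub _ _, hsub _ _, Set.singleton_subset_iff.2 hx, Set.singleton_subset_iff.2 hy⟩
    ⟨⟨hc.disjoint_arc (by omega) (by omega), hc.disjoint_arc (by omega) (by omega), hdx _ _,
      hdy _ _⟩, ⟨hc.disjoint_arc (by omega) (by omega), hdx _ _, hdy _ _⟩, ⟨hdx _ _, hdy _ _⟩, hyx⟩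
    ⟨⟨hc.touch_arc hij hjk, (hc.touch_arc' hij hk).symm, ?_, ?_⟩,
      ⟨hc.touch_arc hjk hk, ?_, ?_⟩, ⟨?_, ?_⟩, ?_⟩
  · exact hi.1.symm.touch (IsCyc.mem_arc hij) rfl
  · exact hi.2.symm.touch (IsCyc.mem_arc hij) rfl
  · exact hj.1.symm.touch (IsCyc.mem_arc hjk) rfl
  · exact hj.2.symm.touch (IsCyc.mem_arc hjk) rfl
  · exact hk'.1.symm.touch (IsCyc.mem_arc hk) rfl
  · exact hk'.2.symm.touch (IsCyc.mem_arc hk) rfl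
  · exact hxy.touch rfl rfl

theorem Pl.split_of_private (hp : Pl G s) (hc : IsCyc G n c) (hcs : ∀ k, c k ∈ s)
    (hx : x ∈ s) (hy : y ∈ s) (hxc : ∀ k, c k ≠ x) (hyc : ∀ k, c k ≠ y) (hxy : G.Adj x y)
    (hx2 : ∃ k l, c k ≠ c l ∧ G.Adj x (c k) ∧ G.Adj x (c l)) {m : ℕ} (hm : G.Adj y (c m))
    (hm' : ¬ G.Adj x (c m)) :
    ∃ i j, i < j ∧ j < i + n ∧ (∀ k, j < k → k < i + n → ¬ G.Adj x (c k)) ∧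
      ∀ k, i < k → k < j → ¬ G.Adj y (c k) := by
  classical
  obtain ⟨k, l, hkl, hk, hl⟩ := hx2
  obtain ⟨k', hk1, hk2, hk3⟩ := hc.window m k
  obtain ⟨l', hl1, hl2, hl3⟩ := hc.window m l
  rw [← hk3, ← hl3] at hkl
  rw [← hk3] at hk
  rw [← hl3] at hl
  let S := (Finset.Ico m (m + n)).filter fun k => G.Adj x (c k)
  have hS : ∀ k, k ∈ S ↔ (m ≤ k ∧ k < m + n) ∧ G.Adj x (c k) := by
    intro k; simp [S]
  have hkS : k' ∈ S := (hS _).2 ⟨⟨hk1, hk2⟩, hk⟩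
  have hlS : l' ∈ S := (hS _).2 ⟨⟨hl1, hl2⟩, hl⟩
  obtain ⟨i, hi, himin⟩ := S.exists_min_image id ⟨k', hkS⟩
  obtain ⟨j, hj, hjmax⟩ := S.exists_max_image id ⟨k', hkS⟩
  simp only [id] at himin hjmax
  have hi' := (hS i).1 hi
  have hj' := (hS j).1 hj
  have hmi : m ≠ i := by rintro rfl; exact hm' hi'.2
  have hij : i < j := by
    have h1 := himin _ hkS
    have h2 := himin _ hlS
    have h3 := hjmax _ hkS
    have h4 := hjmax _ hlS
    have : k' ≠ l' := by rintro rfl; exact hkl rfl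
    omega
  refine ⟨i, j, hij, by omega, fun k hjk hk hxk => ?_, fun k hik hkj hyk => ?_⟩
  · rcases lt_trichotomy k (m + n) with hlt | rfl | hlt
    · have := hjmax k ((hS k).2 ⟨⟨by omega, hlt⟩, hxk⟩)
      omega
    · rw [hc.per] at hxk
      exact hm' hxk
    · have : c k = c (k - n) := by rw [← hc.per (k - n)]; congr 1; omega
      rw [this] at hxk
      have := himin (k - n) ((hS _).2 ⟨⟨by omega, by omega⟩, hxk⟩)
      omega
  · exact hp.no_alternation hc hcs hx hy hxc hyc hxy hik hkj (l := m + n) (by omega) (by omega)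
      hi'.2 hyk hj'.2 (by rwa [hc.per])

/-- The neighbours of `x` and `y` on a cycle do not interleave. -/
theorem Pl.split_cycle (hp : Pl G s) (hc : IsCyc G n c) (hcs : ∀ k, c k ∈ s)
    (hx : x ∈ s) (hy : y ∈ s) (hxc : ∀ k, c k ≠ x) (hyc : ∀ k, c k ≠ y) (hxy : G.Adj x y)
    (hx2 : ∃ k l, c k ≠ c l ∧ G.Adj x (c k) ∧ G.Adj x (c l))
    (hy2 : ∃ k l, c k ≠ c l ∧ G.Adj y (c k) ∧ G.Adj y (c l)) :
    ∃ i j, i < j ∧ j < i + n ∧ (∀ k, j < k → k < i + n → ¬ G.Adj x (c k)) ∧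
      ∀ k, i < k → k < j → ¬ G.Adj y (c k) := by
  by_cases h1 : ∃ m, G.Adj y (c m) ∧ ¬ G.Adj x (c m)
  · obtain ⟨m, hm, hm'⟩ := h1
    exact hp.split_of_private hc hcs hx hy hxc hyc hxy hx2 hm hm'
  by_cases h2 : ∃ m, G.Adj x (c m) ∧ ¬ G.Adj y (c m)
  · obtain ⟨m, hm, hm'⟩ := h2
    obtain ⟨i, j, hij, hj, h3, h4⟩ :=
      hp.split_of_private hc hcs hy hx hyc hxc hxy.symm hy2 hm hm'
    refine ⟨j, i + n, hj, by omega, fun k hk1 hk2 hk => ?_, h3⟩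
    refine h4 (k - n) (by omega) (by omega) ?_
    rwa [← hc.per, show k - n + n = k by omega]
  · push Not at h1 h2
    obtain ⟨k, l, hkl, hk, hl⟩ := hx2
    obtain ⟨k', hk1, hk2, hk3⟩ := hc.window 0 k
    obtain ⟨l', hl1, hl2, hl3⟩ := hc.window 0 l
    rw [← hk3, ← hl3] at hkl
    rw [← hk3] at hk
    rw [← hl3] at hl
    have key : ∀ i j, i < j → j < n → G.Adj x (c i) → G.Adj x (c j) →
        ∃ i j, i < j ∧ j < i + n ∧ (∀ k, j < k → k < i + n → ¬ G.Adj x (c k)) ∧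
          ∀ k, i < k → k < j → ¬ G.Adj y (c k) := by
      intro i j hij hj hxi hxj
      refine ⟨i, j, hij, by omega, fun k hjk hk hxk => ?_, fun k hik hkj hyk => ?_⟩
      · exact hp.no_common_three hc hcs hx hy hxc hyc hxy hij hjk hk ⟨hxi, h2 _ hxi⟩
          ⟨hxj, h2 _ hxj⟩ ⟨hxk, h2 _ hxk⟩
      · exact hp.no_common_three hc hcs hx hy hxc hyc hxy hik hkj (by omega) ⟨hxi, h2 _ hxi⟩
          ⟨h1 _ hyk, hyk⟩ ⟨hxj, h2 _ hxj⟩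
    rcases lt_trichotomy k' l' with h | h | h
    · exact key k' l' h (by omega) hk hl
    · exact absurd (by rw [h]) hkl
    · exact key l' k' h (by omega) hl hk

end

namespace IsCyc

variable {V : Type*} {G : SimpleGraph V} {n : ℕ} {c : ℕ → V}

theorem window' (hc : IsCyc G n c) (m k : ℕ) :
    ∃ k', m ≤ k' ∧ k' < m + n ∧ ∀ t, c (k' + t) = c (k + t) := by
  have hn := hc.three
  have h1 := Nat.mod_lt (k + m * n - m) (show 0 < n by omega)
  have h2 := Nat.mod_add_div (k + m * n - m) n
  have h3 : m ≤ m * n := Nat.le_mul_of_pos_right m (by omega)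
  refine ⟨m + (k + m * n - m) % n, by omega, by omega, fun t => ?_⟩
  rw [← hc.per_mul (k + t) m, ← hc.per_mul _ ((k + m * n - m) / n), mul_comm (_ / n) n]
  congr 1
  omega

theorem edge_inj (hc : IsCyc G n c) {k l : ℕ} (hk : k < n) (hl : l < n)
    (h : s(c k, c (k + 1)) = s(c l, c (l + 1))) : k = l := by
  have hn := hc.three
  rcases Sym2.eq_iff.1 h with ⟨h1, _⟩ | ⟨h1, h2⟩
  · exact (hc.eq_iff (m := 0) (by omega) (by omega) (by omega) (by omega)).1 h1
  · by_contra hne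
    rcases Nat.lt_or_ge k l with hkl | hkl
    · by_cases h : l = k + 1
      · exact hc.inj k (l + 1) (by omega) (by omega) h1
      · exact hc.inj (k + 1) l (by omega) (by omega) h2
    · by_cases h : k = l + 1
      · exact hc.inj l (k + 1) (by omega) (by omega) h2.symm
      · exact hc.inj (l + 1) k (by omega) (by omega) h1.symm

/-- Every vertex of a cycle has exactly two neighbours on it. -/
theorem two (hc : IsCyc G n c) {b d : V} (h : ∃ k, s(b, d) = s(c k, c (k + 1))) :
    ∃ d', d' ≠ d ∧ (∃ k, s(b, d') = s(c k, c (k + 1))) ∧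
      ∀ g, (∃ k, s(b, g) = s(c k, c (k + 1))) → g = d ∨ g = d' := by
  have hn := hc.three
  have key : ∀ i g, (∃ k, s(c i, g) = s(c k, c (k + 1))) → g = c (i + 1) ∨ g = c (i + n - 1) := by
    rintro i g ⟨l, hl⟩
    obtain ⟨l', h1, h2, h3⟩ := hc.window' i l
    rw [← h3 1, ← add_zero l, ← h3 0, add_zero] at hl
    rcases Sym2.eq_iff.1 hl with ⟨h4, rfl⟩ | ⟨h4, rfl⟩
    · left
      rw [(hc.eq_iff le_rfl (by omega) h1 h2).1 h4]
    · right
      by_cases hl' : l' + 1 = i + n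
      · congr 1; omega
      · exact absurd h4 (hc.inj _ _ (by omega) (by omega))
  have hne : ∀ i, c (i + 1) ≠ c (i + n - 1) := fun i => hc.inj _ _ (by omega) (by omega)
  obtain ⟨k, hk⟩ := h
  rcases Sym2.eq_iff.1 hk with ⟨rfl, rfl⟩ | ⟨rfl, rfl⟩
  · refine ⟨c (k + n - 1), (hne k).symm, ⟨k + n - 1, ?_⟩, fun g hg => key k g hg⟩
    rw [Sym2.eq_swap, show k + n - 1 + 1 = k + n by omega, hc.per]
  · have e : c k = c (k + 1 + n - 1) := by rw [← hc.per k]; congr 1; omega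
    refine ⟨c (k + 2), ?_, ⟨k + 1, rfl⟩, fun g hg => ?_⟩
    · rw [e]; exact hne (k + 1)
    · rw [e]; exact (key (k + 1) g hg).symm

end IsCyc

theorem card3 {α : Type*} [DecidableEq α] {a b d : α} (h1 : a ≠ b) (h2 : b ≠ d) (h3 : a ≠ d) :
    ({a, b, d} : Finset α).card = 3 := Finset.card_eq_three.2 ⟨a, b, d, h1, h3, h2, rfl⟩

theorem sym2_of_insert {α : Type*} [DecidableEq α] {x b d u v : α} (h1 : x ≠ b) (h2 : x ≠ d)
    (h3 : x ≠ u) (h4 : x ≠ v) (h : ({x, b, d} : Finset α) = {x, u, v}) : s(b, d) = s(u, v) := by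
  have : ({b, d} : Finset α) = {u, v} := by
    have := congrArg (fun t => t.erase x) h
    simpa [Finset.erase_insert, h1, h2, h3, h4] using this
  have e : ∀ w, w = b ∨ w = d ↔ w = u ∨ w = v := fun w => by
    have := congrArg (fun t => w ∈ t) this
    simpa using this
  rw [Sym2.eq_iff]
  have e1 := (e b).1 (Or.inl rfl)
  have e2 := (e d).1 (Or.inr rfl)
  have e3 := (e u).2 (Or.inl rfl)
  have e4 := (e v).2 (Or.inr rfl)
  grind

/-- Two fans with apexes `x` and `y` over complementary arcs of a cycle, and the two triangles on
`xy`. -/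
def IsFans {α : Type*} [DecidableEq α] (n j : ℕ) (c : ℕ → α) (x y : α) (t : Finset α) : Prop :=
  t = {x, y, c 0} ∨ t = {x, y, c j} ∨ (∃ k, k < j ∧ t = {x, c k, c (k + 1)}) ∨
    ∃ k, j ≤ k ∧ k < n ∧ t = {y, c k, c (k + 1)}

section

variable {α : Type*} [DecidableEq α] {G : SimpleGraph α} {n j : ℕ} {c : ℕ → α} {x y : α}

theorem IsFans.swap (hc : IsCyc G n c) (hj : j < n) {t : Finset α} :
    IsFans n j c x y t ↔ IsFans n (n - j) (fun k => c (k + j)) y x t := by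
  unfold IsFans
  beta_reduce
  rw [show n - j + j = 0 + n by omega, hc.per, zero_add, insert_swap y x, insert_swap y x]
  constructor
  · rintro (h | h | ⟨k, h1, h2⟩ | ⟨k, h1, h2, h3⟩)
    · exact Or.inr (Or.inl h)
    · exact Or.inl h
    · refine Or.inr (Or.inr (Or.inr ⟨k + n - j, by omega, by omega, ?_⟩))
      rw [h2, show k + n - j + j = k + n by omega, show k + n - j + 1 + j = k + 1 + n by omega,
        hc.per, hc.per]
    · refine Or.inr (Or.inr (Or.inl ⟨k - j, by omega, ?_⟩))
      rw [h3, show k - j + j = k by omega, show k - j + 1 + j = k + 1 by omega]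
  · rintro (h | h | ⟨k, h1, h2⟩ | ⟨k, h1, h2, h3⟩)
    · exact Or.inr (Or.inl h)
    · exact Or.inl h
    · refine Or.inr (Or.inr (Or.inr ⟨k + j, by omega, by omega, ?_⟩))
      rw [h2, show k + 1 + j = k + j + 1 by omega]
    · refine Or.inr (Or.inr (Or.inl ⟨k + j - n, by omega, ?_⟩))
      rw [h3, ← hc.per (k + j - n), ← hc.per (k + j - n + 1), show k + j - n + n = k + j by omega,
        show k + j - n + 1 + n = k + 1 + j by omega]

/-- The link of `x` in the two fans is a cycle. -/
theorem IsFans.link (hc : IsCyc G n c) (hj0 : 0 < j) (hj : j < n) (hxc : ∀ k, c k ≠ x)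
    (hyc : ∀ k, c k ≠ y) (hxy : x ≠ y) : ∃ e : ℕ → α, IsCyc ⊤ (j + 2) e ∧ (∀ k, e k ≠ x) ∧
      ∀ b d, x ≠ b → x ≠ d → (IsFans n j c x y {x, b, d} ↔ ∃ k, s(b, d) = s(e k, e (k + 1))) := by
  let e : ℕ → α := fun i => if i % (j + 2) = 0 then y else c (i % (j + 2) - 1)
  have hinj : ∀ p q, p < j + 2 → q < j + 2 → e p = e q → p = q := by
    intro p q hp hq h
    simp only [e, Nat.mod_eq_of_lt hp, Nat.mod_eq_of_lt hq] at h
    split_ifs at h with h1 h2 h2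
    · omega
    · exact absurd h.symm (hyc _)
    · exact absurd h (hyc _)
    · have := (hc.eq_iff (m := 0) (by omega) (by omega) (by omega) (by omega)).1 h
      omega
  have hmod : ∀ i, e i = e (i % (j + 2)) := fun i => by simp [e]
  have hlt : ∀ i, i % (j + 2) < j + 2 := fun i => Nat.mod_lt i (by omega)
  have hcyc : ∀ p q, p < q → q < p + (j + 2) → e p ≠ e q := by
    intro p q h1 h2 h
    rw [hmod p, hmod q] at h
    have := hinj _ _ (hlt p) (hlt q) h
    have := (Nat.modEq_iff_dvd' h1.le).1 this
    exact absurd (Nat.le_of_dvd (by omega) this) (by omega)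
  have e0 : e 0 = y := by simp [e]
  have eS : ∀ k, k ≤ j → e (k + 1) = c k := fun k hk => by
    simp [e, Nat.mod_eq_of_lt (show k + 1 < j + 2 by omega)]
  have eL : e (j + 2) = y := by simp [e]
  refine ⟨e, ⟨by omega, fun i => by simp [e], hcyc, fun i => hcyc _ _ (by omega) (by omega)⟩,
    fun k => ?_, fun b d hb hd => ⟨?_, ?_⟩⟩
  · simp only [e]
    split_ifs
    exacts [hxy.symm, hxc _]
  · rintro (h | h | ⟨k, h1, h2⟩ | ⟨k, h1, h2, h3⟩)
    · exact ⟨0, by rw [e0, eS 0 (by omega)]; exact sym2_of_insert hb hd hxy (hxc 0).symm h⟩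
    · refine ⟨j + 1, ?_⟩
      rw [eS j le_rfl, eL, Sym2.eq_swap (a := c j)]
      exact sym2_of_insert hb hd hxy (hxc j).symm h
    · refine ⟨k + 1, ?_⟩
      rw [eS k (by omega), eS (k + 1) (by omega)]
      exact sym2_of_insert hb hd (hxc _).symm (hxc _).symm h2
    · exfalso
      have : x ∈ ({y, c k, c (k + 1)} : Finset α) := by rw [← h3]; simp
      have h4 := hxc k
      have h5 := hxc (k + 1)
      simp only [Finset.mem_insert, Finset.mem_singleton] at this
      grind
  · rintro ⟨k, hk⟩
    have hk' : ∃ k < j + 2, s(b, d) = s(e k, e (k + 1)) := by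
      refine ⟨k % (j + 2), hlt k, ?_⟩
      rw [hk, hmod k, hmod (k + 1), hmod (k % (j + 2) + 1)]
      simp
    have hset : ∀ u v, s(b, d) = s(u, v) → ({x, b, d} : Finset α) = {x, u, v} := by
      intro u v h
      rcases Sym2.eq_iff.1 h with ⟨rfl, rfl⟩ | ⟨rfl, rfl⟩
      · rfl
      · rw [insert_swap']
    obtain ⟨k, hk1, hk2⟩ := hk'
    rcases Nat.eq_zero_or_pos k with rfl | hpos
    · rw [e0, eS 0 (by omega)] at hk2
      exact Or.inl (hset _ _ hk2)
    · obtain ⟨k, rfl⟩ : ∃ l, k = l + 1 := ⟨k - 1, by omega⟩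
      rw [eS k (by omega)] at hk2
      by_cases hkj : k = j
      · subst hkj
        rw [eL, Sym2.eq_swap (a := c k)] at hk2
        exact Or.inr (Or.inl (hset _ _ hk2))
      · rw [eS (k + 1) (by omega)] at hk2
        exact Or.inr (Or.inr (Or.inl ⟨k, by omega, hset _ _ hk2⟩))

theorem IsFans.two (hc : IsCyc G n c) (hj0 : 0 < j) (hj : j < n) (hxc : ∀ k, c k ≠ x)
    (hyc : ∀ k, c k ≠ y) (hxy : x ≠ y) (hcard : ∀ t, IsFans n j c x y t → t.card = 3) {b d : α}
    (h : IsFans n j c x y {x, b, d}) : ∃ d', d' ≠ d ∧ IsFans n j c x y {x, b, d'} ∧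
      ∀ g, IsFans n j c x y {x, b, g} → g = d ∨ g = d' := by
  obtain ⟨e, he, hex, hiff⟩ := IsFans.link hc hj0 hj hxc hyc hxy
  obtain ⟨n1, _, n3⟩ := card3_ne (hcard _ h)
  obtain ⟨d', h1, h2, h3⟩ := he.two ((hiff b d n1 n3).1 h)
  have hd' : x ≠ d' := by
    rintro rfl
    obtain ⟨k, hk⟩ := h2
    have := Sym2.mem_mk_right b x
    rw [hk, Sym2.mem_iff] at this
    rcases this with h | h
    exacts [hex _ h.symm, hex _ h.symm]
  refine ⟨d', h1, (hiff b d' n1 hd').2 h2, fun g hg => h3 g ?_⟩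
  exact (hiff b g n1 (card3_ne (hcard _ hg)).2.2).1 hg

theorem IsFans.exists_patch (hc : IsCyc G n c) (hj0 : 0 < j) (hj : j < n) (hxc : ∀ k, c k ≠ x)
    (hyc : ∀ k, c k ≠ y) (hxy : x ≠ y) :
    ∃ Δ : Finset (Finset α), IsPatch Δ ∧ ∀ t, t ∈ Δ ↔ IsFans n j c x y t := by
  have hn := hc.three
  have inj0 : ∀ p q, p < n → q < n → c p = c q → p = q := fun p q hp hq h =>
    (hc.eq_iff (m := 0) (by omega) (by omega) (by omega) (by omega)).1 h
  have cx : ∀ k, ({x, c k, c (k + 1)} : Finset α).card = 3 := fun k =>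
    card3 (hxc k).symm (hc.adj k).ne (hxc _).symm
  have cy : ∀ k, ({y, c k, c (k + 1)} : Finset α).card = 3 := fun k =>
    card3 (hyc k).symm (hc.adj k).ne (hyc _).symm
  have cxy : ∀ k, ({x, y, c k} : Finset α).card = 3 := fun k =>
    card3 hxy (hyc k).symm (hxc _).symm
  have A : ∀ m ≤ j, ∃ Δ : Finset (Finset α), IsPatch Δ ∧ ∀ t, t ∈ Δ ↔
      t = {x, y, c 0} ∨ ∃ k, k < m ∧ t = {x, c k, c (k + 1)} := by
    intro m hm
    induction m with
    | zero => exact ⟨{{x, y, c 0}}, IsPatch.single (cxy 0), by simp⟩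
    | succ m ih =>
      obtain ⟨Δ, h1, h2⟩ := ih (by omega)
      refine ⟨insert {x, c m, c (m + 1)} Δ, h1.add (cx m) ⟨(hxc m).symm, ?_⟩ (Or.inl ?_),
        fun t => ?_⟩
      · rcases Nat.eq_zero_or_pos m with rfl | hpos
        · exact ⟨_, (h2 _).2 (Or.inl rfl), by simp, by simp⟩
        · refine ⟨_, (h2 _).2 (Or.inr ⟨m - 1, by omega, rfl⟩), by simp, ?_⟩
          rw [Nat.sub_add_cancel hpos]; simp
      · rintro ⟨t, ht, hmem⟩
        rcases (h2 t).1 ht with rfl | ⟨k, hk, rfl⟩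
        · simp only [Finset.mem_insert, Finset.mem_singleton] at hmem
          rcases hmem with h | h | h
          · exact hxc _ h
          · exact hyc _ h
          · have := inj0 _ _ (by omega) (by omega) h
            omega
        · simp only [Finset.mem_insert, Finset.mem_singleton] at hmem
          rcases hmem with h | h | h
          · exact hxc _ h
          · have := inj0 _ _ (by omega) (by omega) h
            omega
          · have := inj0 _ _ (by omega) (by omega) h
            omega
      · rw [Finset.mem_insert, h2]
        constructor
        · rintro (rfl | rfl | ⟨k, hk, rfl⟩)
          · exact Or.inr ⟨m, by omega, rfl⟩
          · exact Or.inl rfl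
          · exact Or.inr ⟨k, by omega, rfl⟩
        · rintro (rfl | ⟨k, hk, rfl⟩)
          · exact Or.inr (Or.inl rfl)
          · by_cases hkm : k = m
            · subst hkm; exact Or.inl rfl
            · exact Or.inr (Or.inr ⟨k, by omega, rfl⟩)
  have B : ∀ m, j ≤ m → m ≤ n → ∃ Δ : Finset (Finset α), IsPatch Δ ∧ ∀ t, t ∈ Δ ↔
      IsFans m j c x y t := by
    intro m hjm
    induction m, hjm using Nat.le_induction with
    | base =>
      intro _
      obtain ⟨Δ, h1, h2⟩ := A j le_rfl
      refine ⟨insert {y, x, c j} Δ, h1.add (by rw [insert_swap]; exact cxy j)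
        ⟨hxy.symm, _, (h2 _).2 (Or.inl rfl), by simp, by simp⟩
        (Or.inr ⟨(hxc j).symm, _, (h2 _).2 (Or.inr ⟨j - 1, by omega, rfl⟩), by simp, ?_⟩),
        fun t => ?_⟩
      · rw [Nat.sub_add_cancel hj0]; simp
      · rw [Finset.mem_insert, h2, insert_swap y x]
        unfold IsFans
        constructor
        · rintro (h | h | h)
          exacts [Or.inr (Or.inl h), Or.inl h, Or.inr (Or.inr (Or.inl h))]
        · rintro (h | h | h | ⟨k, h3, h4, _⟩)
          exacts [Or.inr (Or.inl h), Or.inl h, Or.inr (Or.inr h), absurd h4 (by omega)]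
    | succ m hjm ih =>
      intro hm
      obtain ⟨Δ, h1, h2⟩ := ih (by omega)
      have hym : TEdge Δ y (c m) := by
        refine ⟨(hyc m).symm, ?_⟩
        by_cases hjm' : m = j
        · subst hjm'
          exact ⟨_, (h2 _).2 (Or.inr (Or.inl rfl)), by simp, by simp⟩
        · refine ⟨_, (h2 _).2 (Or.inr (Or.inr (Or.inr ⟨m - 1, by omega, by omega, rfl⟩))),
            by simp, ?_⟩
          rw [Nat.sub_add_cancel (by omega)]; simp
      have hchar : ∀ t, t ∈ insert {y, c m, c (m + 1)} Δ ↔ IsFans (m + 1) j c x y t := by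
        intro t
        rw [Finset.mem_insert, h2]
        unfold IsFans
        constructor
        · rintro (h | h | h | h | ⟨k, h3, h4, h5⟩)
          · exact Or.inr (Or.inr (Or.inr ⟨m, hjm, by omega, h⟩))
          · exact Or.inl h
          · exact Or.inr (Or.inl h)
          · exact Or.inr (Or.inr (Or.inl h))
          · exact Or.inr (Or.inr (Or.inr ⟨k, h3, by omega, h5⟩))
        · rintro (h | h | h | ⟨k, h3, h4, h5⟩)
          · exact Or.inr (Or.inl h)
          · exact Or.inr (Or.inr (Or.inl h))
          · exact Or.inr (Or.inr (Or.inr (Or.inl h)))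
          · by_cases hkm : k = m
            · subst hkm; exact Or.inl h5
            · exact Or.inr (Or.inr (Or.inr (Or.inr ⟨k, h3, by omega, h5⟩)))
      refine ⟨insert {y, c m, c (m + 1)} Δ, ?_, hchar⟩
      by_cases hmn : m + 1 = n
      · have e : ({y, c m, c (m + 1)} : Finset α) = {c m, y, c (m + 1)} := insert_swap _ _ _
        have h0 : c (m + 1) = c 0 := by rw [hmn, ← zero_add n, hc.per]
        rw [e]
        refine h1.add (by rw [← e]; exact cy m) hym.symm (Or.inr ⟨(hyc _).symm, ?_⟩)
        rw [h0]
        exact ⟨_, (h2 _).2 (Or.inl rfl), by simp, by simp⟩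
      · refine h1.add (cy m) hym (Or.inl ?_)
        rintro ⟨t, ht, hmem⟩
        rcases (h2 t).1 ht with rfl | rfl | ⟨k, hk, rfl⟩ | ⟨k, hk, hk', rfl⟩ <;>
        simp only [Finset.mem_insert, Finset.mem_singleton] at hmem <;>
        rcases hmem with h | h | h
        all_goals first
          | exact hxc _ h
          | exact hyc _ h
          | (have := inj0 _ _ (by omega) (by omega) h; omega)
  exact B n hj.le le_rfl

/-- Splitting the vertex `x` of a sphere into two adjacent vertices `x` and `y`. -/
theorem IsSphere.split {T Γ : Finset (Finset α)} (hT : IsSphere T) (hΓ : Γ ⊆ T)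
    (hΓc : Conn (tgraph Γ) (verts Γ)) (hx : x ∈ verts T) (hxΓ : ∀ t ∈ T, x ∈ t → t ∈ Γ)
    (hy : y ∉ verts T) (hc : IsCyc G n c)
    (hD : ∀ a b, Bd T (· ∈ Γ) a b ↔ ∃ k, s(a, b) = s(c k, c (k + 1)))
    (hxc : ∀ k, c k ≠ x) (hj0 : 0 < j) (hj : j < n) :
    ∃ Δ, IsSphere (T \ Γ ∪ Δ) ∧ ∀ t, t ∈ Δ ↔ IsFans n j c x y t := by
  have hxy : x ≠ y := by rintro rfl; exact hy hx
  have hcv : ∀ k, c k ∈ verts Γ := fun k => by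
    obtain ⟨d, d', h1, h2, h3, h4⟩ := (hD (c k) (c (k + 1))).2 ⟨k, rfl⟩
    exact ⟨_, h3, by simp⟩
  have hyc : ∀ k, c k ≠ y := fun k h => hy (verts_mono hΓ (h ▸ hcv k))
  obtain ⟨Δ, hΔ, hmem⟩ := IsFans.exists_patch hc hj0 hj hxc hyc hxy
  have hcard : ∀ t, IsFans n j c x y t → t.card = 3 := fun t ht => hΔ.card t ((hmem t).2 ht)
  have hxv : x ∈ verts Γ := by
    obtain ⟨t, ht, hxt⟩ := hx
    exact ⟨t, hxΓ t ht hxt, hxt⟩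
  have hxory : ∀ t ∈ Δ, x ∈ t ∨ y ∈ t := by
    intro t ht
    rcases (hmem t).1 ht with rfl | rfl | ⟨k, hk, rfl⟩ | ⟨k, hk, hk', rfl⟩ <;> simp
  have two_x : ∀ b d, {x, b, d} ∈ Δ → ∃ d', d' ≠ d ∧ {x, b, d'} ∈ Δ ∧
      ∀ g, {x, b, g} ∈ Δ → g = d ∨ g = d' := by
    intro b d h
    simp only [hmem] at h ⊢
    exact IsFans.two hc hj0 hj hxc hyc hxy hcard h
  have two_y : ∀ b d, {y, b, d} ∈ Δ → ∃ d', d' ≠ d ∧ {y, b, d'} ∈ Δ ∧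
      ∀ g, {y, b, g} ∈ Δ → g = d ∨ g = d' := by
    intro b d h
    simp only [hmem, IsFans.swap hc hj] at h hcard ⊢
    exact IsFans.two (hc.shift j) (by omega) (by omega) (fun k => hyc _) (fun k => hxc _) hxy.symm
      hcard h
  refine ⟨Δ, hT.replace hΓ ?_ hΓc hΔ ?_ ?_ ?_ ?_, hmem⟩
  · obtain ⟨t, ht, _⟩ := hxv
    exact ⟨t, ht⟩
  · intro t ht htΓ htΔ
    rcases hxory t htΔ with h | h
    · exact htΓ (hxΓ t ht h)
    · exact hy ⟨t, ht, h⟩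
  · intro a b d e h1 h2 h3
    have key : ∀ k < n, ∃ f, {c k, c (k + 1), f} ∈ Δ ∧ ∀ g, {c k, c (k + 1), g} ∈ Δ → g = f := by
      intro k hk
      have hrot : ∀ f, ({c k, c (k + 1), f} : Finset α) = {f, c k, c (k + 1)} := fun f =>
        (insert_rot f _ _).symm
      have hg : ∀ g, {c k, c (k + 1), g} ∈ Δ → (k < j ∧ g = x) ∨ (j ≤ k ∧ g = y) := by
        intro g hg
        have hgc := card3_ne (hΔ.card _ hg)
        have hgxy : g = x ∨ g = y := by
          have := hxory _ hg
          simp only [Finset.mem_insert, Finset.mem_singleton] at this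
          have h1 := hxc k
          have h2 := hxc (k + 1)
          have h3 := hyc k
          have h4 := hyc (k + 1)
          grind
        rw [hrot] at hg
        rcases (hmem _).1 hg with h | h | ⟨l, hl, h⟩ | ⟨l, hl, hl', h⟩
        · exfalso
          have m1 : c k ∈ ({x, y, c 0} : Finset α) := by rw [← h]; simp
          have m2 : c (k + 1) ∈ ({x, y, c 0} : Finset α) := by rw [← h]; simp
          simp only [Finset.mem_insert, Finset.mem_singleton, hxc, hyc, false_or] at m1 m2
          exact (hc.adj k).ne (m1.trans m2.symm)
        · exfalso
          have m1 : c k ∈ ({x, y, c j} : Finset α) := by rw [← h]; simp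
          have m2 : c (k + 1) ∈ ({x, y, c j} : Finset α) := by rw [← h]; simp
          simp only [Finset.mem_insert, Finset.mem_singleton, hxc, hyc, false_or] at m1 m2
          exact (hc.adj k).ne (m1.trans m2.symm)
        · have hgx : g = x := by
            have : x ∈ ({g, c k, c (k + 1)} : Finset α) := by rw [h]; simp
            simp only [Finset.mem_insert, Finset.mem_singleton, (hxc _).symm, or_false] at this
            exact this.symm
          subst hgx
          have := hc.edge_inj hk (by omega) (sym2_of_insert (hxc _).symm (hxc _).symm
            (hxc _).symm (hxc _).symm h)
          exact Or.inl ⟨by omega, rfl⟩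
        · have hgy : g = y := by
            have : y ∈ ({g, c k, c (k + 1)} : Finset α) := by rw [h]; simp
            simp only [Finset.mem_insert, Finset.mem_singleton, (hyc _).symm, or_false] at this
            exact this.symm
          subst hgy
          have := hc.edge_inj hk (by omega) (sym2_of_insert (hyc _).symm (hyc _).symm
            (hyc _).symm (hyc _).symm h)
          exact Or.inr ⟨by omega, rfl⟩
      by_cases hkj : k < j
      · refine ⟨x, ?_, fun g hg' => ?_⟩
        · rw [hrot, hmem]
          exact Or.inr (Or.inr (Or.inl ⟨k, hkj, rfl⟩))
        · rcases hg g hg' with h | h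
          exacts [h.2, absurd h.1 (by omega)]
      · refine ⟨y, ?_, fun g hg' => ?_⟩
        · rw [hrot, hmem]
          exact Or.inr (Or.inr (Or.inr ⟨k, by omega, hk, rfl⟩))
        · rcases hg g hg' with h | h
          exacts [absurd h.1 hkj, h.2]
    obtain ⟨k, hk⟩ := (hD a b).1 ⟨d, e, hΓ h1, h2, h1, h3⟩
    obtain ⟨l, -, hl, hl'⟩ := hc.window' 0 k
    rw [← hl' 1, ← add_zero k, ← hl' 0, add_zero] at hk
    obtain ⟨f, hf1, hf2⟩ := key l (by omega)
    rcases Sym2.eq_iff.1 hk with ⟨rfl, rfl⟩ | ⟨rfl, rfl⟩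
    · exact ⟨f, hf1, hf2⟩
    · refine ⟨f, by rwa [insert_swap], fun g hg => hf2 g (by rwa [insert_swap])⟩
  · intro a b d h
    by_cases hax : a = x
    · subst hax
      exact Or.inr ⟨fun e he => hxΓ _ he (by simp), two_x b d h⟩
    by_cases hay : a = y
    · subst hay
      exact Or.inr ⟨fun e he => absurd ⟨_, he, by simp⟩ hy, two_y b d h⟩
    by_cases hbx : b = x
    · subst hbx
      simp only [insert_swap a b] at h ⊢
      exact Or.inr ⟨fun e he => hxΓ _ he (by simp), two_x a d h⟩
    by_cases hby : b = y
    · subst hby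
      simp only [insert_swap a b] at h ⊢
      exact Or.inr ⟨fun e he => absurd ⟨_, he, by simp⟩ hy, two_y a d h⟩
    left
    have hb : ∃ k, s(a, b) = s(c k, c (k + 1)) := by
      obtain ⟨m1, m2, m3⟩ := card3_ne (hΔ.card _ h)
      have hrot : ({a, b, d} : Finset α) = {d, a, b} := (insert_rot d _ _).symm
      rw [hrot] at h
      have two_out : ∀ k, ({d, a, b} : Finset α) ≠ {x, y, c k} := by
        intro k h
        have m1 : a ∈ ({x, y, c k} : Finset α) := by rw [← h]; simp
        have m2 : b ∈ ({x, y, c k} : Finset α) := by rw [← h]; simp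
        simp only [Finset.mem_insert, Finset.mem_singleton] at m1 m2
        grind
      rcases (hmem _).1 h with h | h | ⟨l, hl, h⟩ | ⟨l, hl, hl', h⟩
      · exact absurd h (two_out 0)
      · exact absurd h (two_out j)
      · have hgx : d = x := by
          have : x ∈ ({d, a, b} : Finset α) := by rw [h]; simp
          simp only [Finset.mem_insert, Finset.mem_singleton] at this
          grind
        subst hgx
        exact ⟨l, sym2_of_insert m3.symm m2.symm (hxc _).symm (hxc _).symm h⟩
      · have hgx : d = y := by
          have : y ∈ ({d, a, b} : Finset α) := by rw [h]; simp
          simp only [Finset.mem_insert, Finset.mem_singleton] at this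
          grind
        subst hgx
        exact ⟨l, sym2_of_insert m3.symm m2.symm (hyc _).symm (hyc _).symm h⟩
    obtain ⟨e, f, h1, h2, h3, h4⟩ := (hD a b).2 hb
    exact ⟨e, f, h3, h2, h4⟩
  · rintro v ⟨t, ht, hvt⟩ hvT
    rcases (hmem t).1 ht with rfl | rfl | ⟨k, hk, rfl⟩ | ⟨k, hk, hk', rfl⟩ <;>
    simp only [Finset.mem_insert, Finset.mem_singleton] at hvt <;>
    rcases hvt with rfl | rfl | rfl
    all_goals first
      | exact hcv _
      | exact hxv
      | exact absurd (verts_mono Finset.sdiff_subset hvT) hy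

end

namespace SimpleGraph

/-- The graph in which `x` also takes over the neighbours of `y`. -/
def absorb {V : Type*} (G : SimpleGraph V) (x y : V) : SimpleGraph V where
  Adj a b := a ≠ b ∧ (G.Adj a b ∨ (a = x ∧ G.Adj y b) ∨ (b = x ∧ G.Adj y a))
  symm := ⟨fun _ _ h => ⟨h.1.symm, h.2.elim (fun h => Or.inl h.symm)
    (fun h => Or.inr h.symm)⟩⟩
  loopless := ⟨fun _ h => h.1 rfl⟩

end SimpleGraph

section

variable {V : Type*} [DecidableEq V] {G : SimpleGraph V} {s : Finset V} {x y : V}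

theorem Pl.absorb (hp : Pl G (s : Set V)) (hx : x ∈ s) (hy : y ∈ s) (hxy : G.Adj x y) :
    Pl (G.absorb x y) ((s.erase y : Finset V) : Set V) := by
  refine hp.minor (fun v => if v = x then {x, y} else {v}) ?_ ?_ ?_
  · intro v hv
    simp only [Finset.coe_erase, Set.mem_sdiff, Finset.mem_coe, Set.mem_singleton_iff] at hv
    split_ifs with h
    · refine ⟨(Conn.singleton G y).insert ⟨y, rfl, hxy⟩, ?_⟩
      rintro w (rfl | rfl)
      · exact hx
      · exact hy
    · exact ⟨Conn.singleton G v, by simpa using hv.1⟩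
  · intro v hv w hw hvw
    simp only [Finset.coe_erase, Set.mem_sdiff, Finset.mem_coe, Set.mem_singleton_iff] at hv hw
    rw [Set.disjoint_left]
    intro u
    split_ifs <;> simp only [Set.mem_insert_iff, Set.mem_singleton_iff] <;> grind
  · intro v hv w hw hvw
    have hmem : ∀ u : V, u ∈ (if u = x then {x, y} else {u} : Set V) := fun u => by
      split_ifs with h
      · exact Or.inl h
      · rfl
    rcases hvw.2 with h | ⟨rfl, h⟩ | ⟨rfl, h⟩
    · exact h.touch (hmem v) (hmem w)
    · refine h.touch ?_ (hmem w)
      rw [if_pos rfl]; exact Or.inr rfl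
    · refine h.symm.touch (hmem v) ?_
      rw [if_pos rfl]; exact Or.inr rfl

/-- The contraction of an edge whose two ends are not part of a separating triple, embedded. -/
theorem contracted_of_absorb (hs : 5 ≤ s.card)
    (hcon : ∀ y ∈ s, ∀ z ∈ s, y ≠ z → Conn G (((s.erase y).erase z : Finset V) : Set V))
    (hx : x ∈ s) (hy : y ∈ s) (hxy : G.Adj x y) (hc : ∀ z ∈ s, z ≠ x → z ≠ y →
      Conn G ((((s.erase x).erase y).erase z : Finset V) : Set V)) {T : Finset (Finset V)}
    (hT : IsSphere T) (hv : verts T = ((s.erase y : Finset V) : Set V))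
    (he : ∀ a ∈ s.erase y, ∀ b ∈ s.erase y, (G.absorb x y).Adj a b → TEdge T a b) :
    Contracted G {v | v ∈ s ∧ v ≠ x ∧ v ≠ y} T x := by
  have hbig : ∀ a b d e : V, ∃ v ∈ s, v ≠ a ∧ v ≠ b ∧ v ≠ d ∧ v ≠ e := fun a b d e => by
    by_contra! hno
    have : s ⊆ {a, b, d, e} := fun v hv => by
      have := hno v hv
      simp only [Finset.mem_insert, Finset.mem_singleton]
      tauto
    exact absurd (Finset.card_le_card this) (by have := Finset.card_le_four (a := a) (b := b) (c := d) (d := e); omega)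
  have hvm : ∀ v, v ∈ verts T ↔ v ∈ s ∧ v ≠ y := fun v => by
    rw [hv]; simp
  have hadj : ∀ a ∈ s, a ≠ y → ∀ b ∈ s, b ≠ y → G.Adj a b → TEdge T a b :=
    fun a ha hay b hb hby hab => he a (by simp [ha, hay]) b (by simp [hb, hby])
      ⟨hab.ne, Or.inl hab⟩
  have hW : Conn G {v | v ∈ s ∧ v ≠ x ∧ v ≠ y} := by
    convert hcon x hx y hy hxy.ne using 1
    ext v; simp; tauto
  have hW' : ∀ w ∈ {v | v ∈ s ∧ v ≠ x ∧ v ≠ y},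
      Conn G {v | v ∈ {v | v ∈ s ∧ v ≠ x ∧ v ≠ y} ∧ v ≠ w} := fun w hw => by
    convert hc w hw.1 hw.2.1 hw.2.2 using 1
    ext v; simp; tauto
  refine ⟨hT, hW, hW', ?_, fun h => h.2.1 rfl, ?_, ?_, ?_⟩
  · intro a ha b
    by_cases hb : (b ∈ s ∧ b ≠ x ∧ b ≠ y) ∧ b ≠ a
    · obtain ⟨w, hw, h1, h2, h3, h4⟩ := hbig x y a b
      obtain ⟨d, hd, had⟩ := (hW' b hb.1).exists_adj (a := a) (b := w) ⟨ha, hb.2.symm⟩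
        ⟨⟨hw, h1, h2⟩, h4⟩ h3
      exact ⟨d, hd.1, had, hd.2⟩
    · obtain ⟨w, hw, h1, h2, h3, _⟩ := hbig x y a b
      obtain ⟨d, hd, had⟩ := hW.exists_adj (a := a) (b := w) ha ⟨hw, h1, h2⟩ h3
      refine ⟨d, hd, had, ?_⟩
      rintro rfl
      exact hb ⟨hd, had.ne'⟩
  · intro v
    rw [hvm]
    constructor
    · intro h
      by_cases hvx : v = x
      · exact Or.inl hvx
      · exact Or.inr ⟨h.1, hvx, h.2⟩
    · rintro (rfl | h)
      · exact ⟨hx, hxy.ne⟩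
      · exact ⟨h.1, h.2.2⟩
  · intro z hz
    rw [hvm] at hz
    by_cases hzx : z = x
    · subst hzx
      have : {v | v ∈ verts T ∧ v ≠ z} = {v | v ∈ s ∧ v ≠ z ∧ v ≠ y} := by
        ext v; simp only [Set.mem_ofPred_eq, hvm]; tauto
      rw [this]
      exact hW.congr fun a ha b hb hab => hadj a ha.1 ha.2.2 b hb.1 hb.2.2 hab
    · have : {v | v ∈ verts T ∧ v ≠ z} =
          insert x {v | v ∈ {v | v ∈ s ∧ v ≠ x ∧ v ≠ y} ∧ v ≠ z} := by
        ext v; simp only [Set.mem_ofPred_eq, hvm, Set.mem_insert_iff]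
        have := hxy.ne
        grind
      rw [this]
      refine ((hW' z ⟨hz.1, hzx, hz.2⟩).congr fun a ha b hb hab =>
        hadj a ha.1.1 ha.1.2.2 b hb.1.1 hb.1.2.2 hab).insert ?_
      obtain ⟨w, hw, h1, h2, h3, _⟩ := hbig x y z z
      obtain ⟨d, hd, had⟩ := (hcon z hz.1 y hy hz.2).exists_adj (a := x) (b := w)
        (by simp [hx, hxy.ne, Ne.symm hzx]) (by simp [hw, h2, h3]) h1
      simp only [Finset.coe_erase, Set.mem_sdiff, Finset.mem_coe, Set.mem_singleton_iff] at hd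
      exact ⟨d, ⟨⟨hd.1.1, had.ne', hd.2⟩, hd.1.2⟩, hadj x hx hxy.ne d hd.1.1 hd.2 had⟩
  · intro a ha b hb hab
    exact hadj a ha.1 ha.2.2 b hb.1 hb.2.2 hab

end

section

variable {V : Type*} [DecidableEq V] [Fintype V] {G : SimpleGraph V} {s : Finset V} {x y : V}

theorem Contracted.emb {W : Set V} {T : Finset (Finset V)} (h : Contracted G W T x)
    (hp : Pl G (s : Set V)) (hW : ∀ v, v ∈ W ↔ v ∈ s ∧ v ≠ x ∧ v ≠ y) (hx : x ∈ s) (hy : y ∈ s)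
    (hxy : G.Adj x y) (hxa : ∀ a ∈ W, G.Adj x a ∨ G.Adj y a → TEdge T x a)
    (hx2 : ∃ a ∈ W, ∃ b ∈ W, a ≠ b ∧ G.Adj x a ∧ G.Adj x b)
    (hy2 : ∃ a ∈ W, ∃ b ∈ W, a ≠ b ∧ G.Adj y a ∧ G.Adj y b) : Emb G s := by
  classical
  obtain ⟨n, c, hc, hcW, hbd, hface⟩ := h.exists_cycle
  have hn := hc.three
  have honc : ∀ a ∈ W, G.Adj x a ∨ G.Adj y a → ∃ k, c k = a := fun a ha hxa' => by
    obtain ⟨d, hd⟩ := h.sphere.exists_tri (hxa a ha hxa')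
    have := h.star hd
    rw [insert_swap] at this
    exact hface a x d ((hW a).1 ha).2.1 this
  have hxc : ∀ k, c k ≠ x := fun k => ((hW _).1 (hcW k)).2.1
  have hyc : ∀ k, c k ≠ y := fun k => ((hW _).1 (hcW k)).2.2
  have hyT : y ∉ verts T := by
    rw [h.vert, hW]
    rintro (rfl | h')
    · exact hxy.ne rfl
    · exact h'.2.2 rfl
  have hxT : x ∈ verts T := (h.vert x).2 (Or.inl rfl)
  have hxv : ∀ t ∈ T, x ∈ t → InFace G W T x t := fun t ht hxt => by
    obtain ⟨u, hu, hux⟩ : ∃ u ∈ t, u ≠ x := by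
      by_contra! hno
      have := Finset.card_le_card (show t ⊆ {x} from fun v hv => by simp [hno v hv])
      rw [h.sphere.card t ht] at this
      simp at this
    obtain ⟨d, rfl⟩ := eq_of_mem3 (h.sphere.card t ht) (Ne.symm hux) hxt hu
    exact h.star ht
  set Γ := T.filter (InFace G W T x) with hΓ
  have hΓm : ∀ t, t ∈ Γ ↔ InFace G W T x t := fun t => by
    rw [hΓ, Finset.mem_filter]; exact ⟨fun h => h.2, fun h => ⟨h.1, h⟩⟩
  have hvΓ : verts Γ = insert x (c '' Set.Ico 0 n) := by
    ext v
    rw [Set.mem_insert_iff]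
    constructor
    · rintro ⟨t, ht, hvt⟩
      rw [hΓm] at ht
      by_cases hvx : v = x
      · exact Or.inl hvx
      · right
        obtain ⟨u, hu, huv⟩ : ∃ u ∈ t, u ≠ v := by
          by_contra! hno
          have := Finset.card_le_card (show t ⊆ {v} from fun u hu => by simp [hno u hu])
          rw [h.sphere.card t ht.1] at this
          simp at this
        obtain ⟨d, rfl⟩ := eq_of_mem3 (h.sphere.card t ht.1) (Ne.symm huv) hvt hu
        obtain ⟨k, rfl⟩ := hface v u d hvx ht
        obtain ⟨k', h1, h2, h3⟩ := hc.window' 0 k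
        exact ⟨k', ⟨h1, by omega⟩, h3 0⟩
    · rintro (rfl | ⟨k, _, rfl⟩)
      · obtain ⟨t, ht, hvt⟩ := hxT
        exact ⟨t, (hΓm t).2 (hxv t ht hvt), hvt⟩
      · obtain ⟨d, d', h1, h2, h3, h4⟩ := (hbd (c k) (c (k + 1))).2 ⟨k, rfl⟩
        exact ⟨_, (hΓm _).2 h3, by simp⟩
  have hΓc : Conn (tgraph Γ) (verts Γ) := by
    rw [hvΓ]
    refine (conn_image_Ico (by omega) fun k _ _ => ?_).insert ?_
    · obtain ⟨d, d', h1, h2, h3, h4⟩ := (hbd (c k) (c (k + 1))).2 ⟨k, rfl⟩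
      exact ⟨(hc.adj k).ne, _, (hΓm _).2 h3, by simp, by simp⟩
    · obtain ⟨a, ha, b, hb, hab, h1, h2⟩ := hx2
      obtain ⟨k, rfl⟩ := honc a ha (Or.inl h1)
      obtain ⟨d, hd⟩ := h.sphere.exists_tri (hxa _ ha (Or.inl h1))
      obtain ⟨k', h1, h2, h3⟩ := hc.window' 0 k
      refine ⟨c k, ⟨k', ⟨h1, by omega⟩, h3 0⟩, (hxc k).symm, _,
        (hΓm _).2 (h.star hd), by simp, by simp⟩
  have hcs : ∀ k, c k ∈ (s : Set V) := fun k => ((hW _).1 (hcW k)).1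
  have two : ∀ z, z = x ∨ z = y → (∃ a ∈ W, ∃ b ∈ W, a ≠ b ∧ G.Adj z a ∧ G.Adj z b) →
      ∃ k l, c k ≠ c l ∧ G.Adj z (c k) ∧ G.Adj z (c l) := by
    rintro z hz ⟨a, ha, b, hb, hab, h1, h2⟩
    obtain ⟨k, rfl⟩ := honc a ha (by grind)
    obtain ⟨l, rfl⟩ := honc b hb (by grind)
    exact ⟨k, l, hab, h1, h2⟩
  obtain ⟨i, j, hij, hj, hxn, hyn⟩ := hp.split_cycle hc hcs hx hy hxc hyc hxy
    (two x (Or.inl rfl) hx2) (two y (Or.inr rfl) hy2)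
  have hc' : IsCyc G n (fun k => c (i + k)) := by
    have := hc.shift i
    simp only [Nat.add_comm _ i] at this
    exact this
  have hΓe : (fun t => t ∈ Γ) = InFace G W T x := funext fun t => propext (hΓm t)
  obtain ⟨Δ, hΔ, hΔm⟩ := h.sphere.split (Γ := Γ) (x := x) (y := y) (j := j - i)
    (Finset.filter_subset _ _) hΓc hxT (fun t ht hxt => (hΓm t).2 (hxv t ht hxt)) hyT hc'
    (fun a b => by
      rw [hΓe, hbd]
      constructor
      · rintro ⟨k, hk⟩
        obtain ⟨k', h1, h2, h3⟩ := hc.window' i k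
        refine ⟨k' - i, ?_⟩
        rw [← Nat.add_assoc, show i + (k' - i) = k' by omega, h3 1, hk]
        exact congrArg (fun z => s(z, c (k + 1))) (h3 0).symm
      · rintro ⟨k, hk⟩
        exact ⟨i + k, hk⟩) (fun k => hxc _) (by omega) (by omega)
  set T' := T \ Γ ∪ Δ with hT'
  have old : ∀ t ∈ T, ¬ InFace G W T x t → t ∈ T' := fun t ht hnt => by
    rw [hT', Finset.mem_union, Finset.mem_sdiff, hΓm]
    exact Or.inl ⟨ht, hnt⟩
  have new : ∀ t, IsFans n (j - i) (fun k => c (i + k)) x y t → t ∈ T' := fun t ht => by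
    rw [hT', Finset.mem_union]
    exact Or.inr ((hΔm t).2 ht)
  have exy : TEdge T' x y := ⟨hxy.ne, _, new _ (Or.inl rfl), by simp, by simp⟩
  -- every cycle vertex at position `p ≤ j - i` sees `x`, and at position `≥ j - i` sees `y`
  have ex : ∀ p, p ≤ j - i → TEdge T' x (c (i + p)) := fun p hp => by
    refine ⟨(hxc _).symm, ?_⟩
    by_cases h0 : p = j - i
    · exact ⟨_, new _ (Or.inr (Or.inl rfl)), by simp, by simp [h0]⟩
    · exact ⟨_, new _ (Or.inr (Or.inr (Or.inl ⟨p, by omega, rfl⟩))), by simp, by simp⟩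
  have ey : ∀ p, j - i ≤ p → p ≤ n → TEdge T' y (c (i + p)) := fun p hp hpn => by
    refine ⟨(hyc _).symm, ?_⟩
    by_cases h0 : p = n
    · exact ⟨_, new _ (Or.inl rfl), by simp, by simp [h0, hc.per]⟩
    · exact ⟨_, new _ (Or.inr (Or.inr (Or.inr ⟨p, by omega, by omega, rfl⟩))), by simp, by simp⟩
  have pos : ∀ a ∈ W, G.Adj x a ∨ G.Adj y a → ∃ p, p < n ∧ c (i + p) = a := by
    intro a ha hxa'
    obtain ⟨k, rfl⟩ := honc a ha hxa'
    obtain ⟨k', h1, h2, h3⟩ := hc.window' i k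
    exact ⟨k' - i, by omega, by rw [show i + (k' - i) = k' by omega]; exact h3 0⟩
  have fx : ∀ a ∈ W, G.Adj x a → TEdge T' x a := fun a ha hadj => by
    obtain ⟨p, hp, rfl⟩ := pos a ha (Or.inl hadj)
    refine ex p ?_
    by_contra hlt
    exact hxn (i + p) (by omega) (by omega) hadj
  have fy : ∀ a ∈ W, G.Adj y a → TEdge T' y a := fun a ha hadj => by
    obtain ⟨p, hp, rfl⟩ := pos a ha (Or.inr hadj)
    by_cases h0 : p = 0
    · subst h0
      have := ey n (by omega) le_rfl
      rwa [hc.per] at this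
    · refine ey p ?_ hp.le
      by_contra hlt
      exact hyn (i + p) (by omega) (by omega) hadj
  refine ⟨T', hΔ, ?_, ?_⟩
  · apply Set.Subset.antisymm
    · rintro v ⟨t, ht, hvt⟩
      rw [hT', Finset.mem_union, Finset.mem_sdiff] at ht
      rcases ht with ht | ht
      · have : v ∈ verts T := ⟨t, ht.1, hvt⟩
        rw [h.vert, hW] at this
        rcases this with rfl | h'
        · exact hx
        · exact h'.1
      · rw [hΔm] at ht
        rcases ht with rfl | rfl | ⟨k, _, rfl⟩ | ⟨k, _, _, rfl⟩ <;>
        · simp only [Finset.mem_insert, Finset.mem_singleton] at hvt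
          rcases hvt with rfl | rfl | rfl <;> first | exact hx | exact hy | exact hcs _
    · intro v hv
      by_cases hvx : v = x
      · exact hvx ▸ exy.left
      by_cases hvy : v = y
      · exact hvy ▸ exy.right
      obtain ⟨p, q, hpq⟩ := h.sphere.exists_tri_of_mem ((h.vert v).2 (Or.inr ((hW v).2 ⟨hv, hvx, hvy⟩)))
      by_cases hin : InFace G W T x {v, p, q}
      · obtain ⟨k, rfl⟩ := hface v p q hvx hin
        obtain ⟨k', h1, h2, h3⟩ := hc.window' i k
        have e : c k = c (i + (k' - i)) := by
          rw [show i + (k' - i) = k' by omega]; exact (h3 0).symm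
        rw [e]
        rcases le_total (k' - i) (j - i) with h' | h'
        · exact (ex _ h').right
        · exact (ey _ h' (by omega)).right
      · exact ⟨_, old _ hpq hin, by simp⟩
  · intro a ha b hb hab
    by_cases hax : a = x
    · subst hax
      by_cases hby : b = y
      · exact hby ▸ exy
      · exact fx b ((hW b).2 ⟨hb, hab.ne', hby⟩) hab
    by_cases hay : a = y
    · subst hay
      by_cases hbx : b = x
      · exact hbx ▸ exy.symm
      · exact fy b ((hW b).2 ⟨hb, hbx, hab.ne'⟩) hab
    have haW := (hW a).2 ⟨ha, hax, hay⟩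
    by_cases hbx : b = x
    · subst hbx
      exact (fx a haW hab.symm).symm
    by_cases hby : b = y
    · subst hby
      exact (fy a haW hab.symm).symm
    obtain ⟨d, hd, hnd⟩ := h.outer haW ((hW b).2 ⟨hb, hbx, hby⟩) hab
    exact ⟨hab.ne, _, old _ hd hnd, by simp, by simp⟩

end

/-- Wagner's theorem: a finite graph with neither a `K₅` nor a `K₃,₃` minor, on at least four
vertices, is a subgraph of a triangulated sphere on the same vertices. -/
theorem Pl.emb {V : Type*} [DecidableEq V] [Fintype V] {G : SimpleGraph V} {s : Finset V}
    (hp : Pl G (s : Set V)) (h4 : 4 ≤ s.card) : Emb G s := by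
  induction hn : s.card using Nat.strong_induction_on generalizing G s with
  | _ n ihn =>
  subst hn
  have ih : ∀ (G' : SimpleGraph V) (s' : Finset V), s'.card < s.card → 4 ≤ s'.card →
      Pl G' (s' : Set V) → Emb G' s' := fun G' s' h1 h2 h3 => ihn _ h1 h3 h2 rfl
  rcases h4.eq_or_lt with h4 | h4
  · exact emb_of_card_four G h4.symm
  by_cases hδ : ∀ a ∈ s, ∀ y z, ∃ b ∈ s, G.Adj a b ∧ b ≠ y ∧ b ≠ z
  swap
  · push Not at hδ
    obtain ⟨a, ha, y, z, h⟩ := hδ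
    refine emb_of_low_degree hp ih h4 ha (y := y) (z := z) fun b hb hab => ?_
    by_cases hby : b = y
    · exact Or.inl hby
    · exact Or.inr (h b hb hab hby)
  by_cases hcon1 : ∀ y ∈ s, Conn G ((s.erase y : Finset V) : Set V)
  swap
  · push Not at hcon1
    obtain ⟨y, hy, hcon⟩ := hcon1
    have hc := Finset.card_erase_of_mem hy
    obtain ⟨X, Y, h1, h2, h3, h4, h5⟩ := exists_split_of_not_conn
      (Finset.card_pos.1 (by omega)) hcon
    have hyn : ¬ (y ∈ X ∨ y ∈ Y) := by rw [← h1]; simp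
    refine emb_of_cut_vertex hp ih hδ hy (fun v => ?_) (fun h => hyn (Or.inl h))
      (fun h => hyn (Or.inr h)) h2 h3 h4 h5
    rw [← h1, Finset.mem_erase]
    grind
  by_cases hcon : ∀ y ∈ s, ∀ z ∈ s, y ≠ z → Conn G (((s.erase y).erase z : Finset V) : Set V)
  swap
  · push Not at hcon
    obtain ⟨y, hy, z, hz, hyz, hcon⟩ := hcon
    have hc := Finset.card_erase_of_mem hy
    have hc' := Finset.card_erase_of_mem (show z ∈ s.erase y by simp [hz, hyz.symm])
    obtain ⟨X, Y, h1, h2, h3, h4, h5⟩ := exists_split_of_not_conn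
      (Finset.card_pos.1 (by omega)) hcon
    exact emb_of_cut_pair hp ih hδ hcon1 hy hz hyz h1 h2 h3 h4 h5
  obtain ⟨x, hx, y, hy, hxy, hc⟩ := exists_contractible h4 hcon fun a ha =>
    (hδ a ha a a).imp fun b hb => ⟨hb.1, hb.2.1⟩
  have hce := Finset.card_erase_of_mem hy
  obtain ⟨T, hT, hv, he⟩ := ih (G.absorb x y) (s.erase y) (by omega) (by omega)
    (hp.absorb hx hy hxy)
  have hC := contracted_of_absorb h4 hcon hx hy hxy hc hT hv he
  have two : ∀ z w, (z = x ∧ w = y) ∨ (z = y ∧ w = x) →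
      ∃ a ∈ {v | v ∈ s ∧ v ≠ x ∧ v ≠ y}, ∃ b ∈ {v | v ∈ s ∧ v ≠ x ∧ v ≠ y}, a ≠ b ∧
        G.Adj z a ∧ G.Adj z b := by
    intro z w hzw
    have hz : z ∈ s := by grind
    obtain ⟨a, ha, hza, haw, _⟩ := hδ z hz w w
    obtain ⟨b, hb, hzb, hbw, hba⟩ := hδ z hz w a
    have := hza.ne
    have := hzb.ne
    exact ⟨a, ⟨ha, by grind, by grind⟩, b, ⟨hb, by grind, by grind⟩, hba.symm, hza, hzb⟩
  refine hC.emb hp (fun v => Iff.rfl) hx hy hxy (fun a ha hxa => ?_) (two x y (Or.inl ⟨rfl, rfl⟩))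
    (two y x (Or.inr ⟨rfl, rfl⟩))
  refine he x (by simp [hx, hxy.ne]) a (by simp [ha.1, ha.2.2]) ⟨ha.2.1.symm, ?_⟩
  rcases hxa with h | h
  · exact Or.inl h
  · exact Or.inr (Or.inl ⟨rfl, h⟩)

section

variable {α : Type*} [DecidableEq α] [Fintype α]

/-- The triples of a ternary relation, as finite sets. -/
noncomputable def triples (R : α → α → α → Prop) : Finset (Finset α) := by
  classical exact Finset.univ.filter fun h => ∃ u v w, h = {u, v, w} ∧ R u v w

theorem mem_triples {R : α → α → α → Prop} {h : Finset α} :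
    h ∈ triples R ↔ ∃ u v w, h = {u, v, w} ∧ R u v w := by
  simp [triples]

theorem insert_mem_triples {R : α → α → α → Prop}
    (hd : ∀ u v w, R u v w → u ≠ v ∧ v ≠ w ∧ u ≠ w) (h1 : ∀ u v w, R u v w → R v u w)
    (h2 : ∀ u v w, R u v w → R u w v) {u v w : α} : {u, v, w} ∈ triples R ↔ R u v w := by
  rw [mem_triples]
  refine ⟨?_, fun h => ⟨u, v, w, rfl, h⟩⟩
  rintro ⟨a, b, d, he, h⟩
  obtain ⟨d1, d2, d3⟩ := hd _ _ _ h
  have e : ∀ z, z = u ∨ z = v ∨ z = w ↔ z = a ∨ z = b ∨ z = d := fun z => by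
    have := congrArg (fun t => z ∈ t) he
    simpa using this
  have e1 := (e u).1 (by simp)
  have e2 := (e v).1 (by simp)
  have e3 := (e w).1 (by simp)
  have f1 := (e a).2 (by simp)
  have f2 := (e b).2 (by simp)
  have f3 := (e d).2 (by simp)
  have p1 := h1 _ _ _ h
  have p2 := h2 _ _ _ h
  have p3 := h2 _ _ _ p1
  have p4 := h1 _ _ _ p2
  have p5 := h1 _ _ _ p3
  rcases e1 with rfl | rfl | rfl <;> rcases e2 with rfl | rfl | rfl <;>
    rcases e3 with rfl | rfl | rfl <;> first | assumption | (exfalso; grind)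

end

section

variable {V : Type*}

/-- `t` and `t'` are the two triangles on an edge at `a` which is not an edge of `G`. -/
def Flipped (G : SimpleGraph V) (T : Finset (Finset V)) (a : V) (t t' : Finset V) : Prop :=
  t ≠ t' ∧ t ∈ T ∧ t' ∈ T ∧ ∃ b, b ≠ a ∧ ¬ G.Adj a b ∧ a ∈ t ∧ b ∈ t ∧ a ∈ t' ∧ b ∈ t'

def Kept (G : SimpleGraph V) (T : Finset (Finset V)) (a b : V) (t : Finset V) : Prop :=
  G.Adj a b ∧ t ∈ T ∧ a ∈ t ∧ b ∈ t

/-- Triangles obtained by subdividing each triangle of `T` at a new centre and flipping the edges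
of `T` that do not belong to `G`. -/
def FlipTri (G : SimpleGraph V) (T : Finset (Finset V)) :
    V ⊕ Finset V → V ⊕ Finset V → V ⊕ Finset V → Prop
  | .inl a, .inl b, .inr t => Kept G T a b t
  | .inl a, .inr t, .inl b => Kept G T a b t
  | .inr t, .inl a, .inl b => Kept G T a b t
  | .inl a, .inr t, .inr t' => Flipped G T a t t'
  | .inr t, .inl a, .inr t' => Flipped G T a t t'
  | .inr t, .inr t', .inl a => Flipped G T a t t'
  | .inl _, .inl _, .inl _ => False
  | .inr _, .inr _, .inr _ => False

variable {G : SimpleGraph V} {T : Finset (Finset V)}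

theorem Flipped.symm {a : V} {t t' : Finset V} (h : Flipped G T a t t') : Flipped G T a t' t := by
  obtain ⟨h1, h2, h3, b, h4, h5, h6, h7, h8, h9⟩ := h
  exact ⟨h1.symm, h3, h2, b, h4, h5, h8, h9, h6, h7⟩

theorem Kept.symm {a b : V} {t : Finset V} (h : Kept G T a b t) : Kept G T b a t :=
  ⟨h.1.symm, h.2.1, h.2.2.2, h.2.2.1⟩

namespace FlipTri

variable {u v w : V ⊕ Finset V}

theorem ne (h : FlipTri G T u v w) : u ≠ v ∧ v ≠ w ∧ u ≠ w := by
  rcases u with a | t <;> rcases v with b | t' <;> rcases w with d | t'' <;>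
    simp only [FlipTri, Kept, Flipped] at h <;>
    simp only [ne_eq, Sum.inl.injEq, Sum.inr.injEq, reduceCtorEq, not_false_eq_true, true_and,
      and_true] <;> first | exact h.1.ne | exact h.1

theorem swap (h : FlipTri G T u v w) : FlipTri G T v u w := by
  rcases u with a | t <;> rcases v with b | t' <;> rcases w with d | t'' <;>
    simp only [FlipTri] at h ⊢ <;> first | exact h | exact h.symm

theorem swap' (h : FlipTri G T u v w) : FlipTri G T u w v := by
  rcases u with a | t <;> rcases v with b | t' <;> rcases w with d | t'' <;>
    simp only [FlipTri] at h ⊢ <;> first | exact h | exact h.symm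

end FlipTri

/-- The third vertex of the triangle of `flipped G T` sitting in `t` at `a` along `ap`. -/
def Corner (G : SimpleGraph V) (T : Finset (Finset V)) (a p : V) (t : Finset V) :
    V ⊕ Finset V → Prop
  | .inl b => G.Adj a p ∧ b = p
  | .inr t' => ¬ G.Adj a p ∧ t' ≠ t ∧ t' ∈ T ∧ a ∈ t' ∧ p ∈ t'

theorem flipTri_iff {a : V} {t : Finset V} {x : V ⊕ Finset V} :
    FlipTri G T (.inl a) (.inr t) x ↔ t ∈ T ∧ a ∈ t ∧ ∃ p ∈ t, p ≠ a ∧ Corner G T a p t x := by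
  rcases x with b | t' <;> simp only [FlipTri, Kept, Flipped, Corner]
  · constructor
    · rintro ⟨h1, h2, h3, h4⟩
      exact ⟨h2, h3, b, h4, h1.ne', h1, rfl⟩
    · rintro ⟨h1, h2, p, h3, h4, h5, rfl⟩
      exact ⟨h5, h1, h2, h3⟩
  · constructor
    · rintro ⟨h1, h2, h3, b, h4, h5, h6, h7, h8, h9⟩
      exact ⟨h2, h6, b, h7, h4, h5, h1.symm, h3, h8, h9⟩
    · rintro ⟨h1, h2, p, h3, h4, h5, h6, h7, h8, h9⟩
      exact ⟨h6.symm, h1, h7, p, h4, h5, h2, h3, h8, h9⟩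

variable [DecidableEq V]

theorem IsSphere.eq_of_three (hT : IsSphere T) {t t' : Finset V} (ht : t ∈ T) (ht' : t' ∈ T)
    {a b d : V} (hab : a ≠ b) (had : a ≠ d) (hbd : b ≠ d) (ha : a ∈ t) (hb : b ∈ t) (hd : d ∈ t)
    (ha' : a ∈ t') (hb' : b ∈ t') (hd' : d ∈ t') : t = t' := by
  obtain ⟨e, rfl⟩ := eq_of_mem3 (hT.card t ht) hab ha hb
  obtain ⟨e', rfl⟩ := eq_of_mem3 (hT.card t' ht') hab ha' hb'
  simp only [Finset.mem_insert, Finset.mem_singleton] at hd hd'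
  grind

/-- The other triangle on an edge of a triangle. -/
theorem IsSphere.exists_opposite (hT : IsSphere T) {t : Finset V} (ht : t ∈ T) {a b : V}
    (hab : a ≠ b) (ha : a ∈ t) (hb : b ∈ t) : ∃ t' ∈ T, t' ≠ t ∧ a ∈ t' ∧ b ∈ t' ∧
      ∀ t'' ∈ T, a ∈ t'' → b ∈ t'' → t'' = t ∨ t'' = t' := by
  obtain ⟨d, rfl⟩ := eq_of_mem3 (hT.card t ht) hab ha hb
  obtain ⟨d', h1, h2, h3⟩ := hT.two a b d ht
  have := card3_ne (hT.card _ ht)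
  have := card3_ne (hT.card _ h2)
  refine ⟨_, h2, fun he => ?_, by simp, by simp, fun t'' ht'' ha' hb' => ?_⟩
  · have : d' ∈ ({a, b, d} : Finset V) := he ▸ (by simp)
    simp only [Finset.mem_insert, Finset.mem_singleton] at this
    grind
  · obtain ⟨e, rfl⟩ := eq_of_mem3 (hT.card t'' ht'') hab ha' hb'
    rcases h3 e ht'' with rfl | rfl <;> simp

theorem IsSphere.exists_corner (hT : IsSphere T) {a p : V} {t : Finset V} (ht : t ∈ T)
    (hap : p ≠ a) (ha : a ∈ t) (hp : p ∈ t) :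
    ∃ x, Corner G T a p t x ∧ ∀ y, Corner G T a p t y → y = x := by
  obtain ⟨t', h1, h2, h3, h4, h5⟩ := hT.exists_opposite ht hap.symm ha hp
  by_cases h : G.Adj a p
  · refine ⟨.inl p, ⟨h, rfl⟩, ?_⟩
    rintro (b | t'') hy
    · rw [hy.2]
    · exact absurd h hy.1
  · refine ⟨.inr t', ⟨h, h2, h1, h3, h4⟩, ?_⟩
    rintro (b | t'') hy
    · exact absurd hy.1 h
    · rcases h5 t'' hy.2.2.1 hy.2.2.2.1 hy.2.2.2.2 with rfl | rfl
      · exact absurd rfl hy.2.1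
      · rfl

theorem IsSphere.corner_inj (hT : IsSphere T) {a p q : V} {t : Finset V} (ht : t ∈ T)
    (ha : a ∈ t) (hap : p ≠ a) (hp : p ∈ t) (haq : q ≠ a) (hq : q ∈ t) {x : V ⊕ Finset V}
    (h1 : Corner G T a p t x) (h2 : Corner G T a q t x) : p = q := by
  rcases x with b | t'
  · exact h1.2.symm.trans h2.2
  · by_contra hne
    exact h1.2.1 (hT.eq_of_three h1.2.2.1 ht hap.symm haq.symm hne h1.2.2.2.1 h1.2.2.2.2
      h2.2.2.2.2 ha hp hq)

theorem flipped_two (hT : IsSphere T) {u v w : V ⊕ Finset V} (h : FlipTri G T u v w) :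
    ∃ w', w' ≠ w ∧ FlipTri G T u v w' ∧ ∀ x, FlipTri G T u v x → x = w ∨ x = w' := by
  have mixed : ∀ a t w, FlipTri G T (.inl a) (.inr t) w → ∃ w', w' ≠ w ∧
      FlipTri G T (.inl a) (.inr t) w' ∧ ∀ x, FlipTri G T (.inl a) (.inr t) x → x = w ∨ x = w' := by
    intro a t w h
    simp only [flipTri_iff] at h ⊢
    obtain ⟨h1, h2, p, h3, h4, h5⟩ := h
    obtain ⟨q, rfl⟩ := eq_of_mem3 (hT.card t h1) h4.symm h2 h3
    have hne := card3_ne (hT.card _ h1)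
    have hqa : q ≠ a := by grind
    obtain ⟨x, hx1, hx2⟩ := hT.exists_corner (G := G) h1 h4 h2 h3
    obtain ⟨y, hy1, hy2⟩ := hT.exists_corner (G := G) (p := q) h1 hqa h2 (by simp)
    have hwx := hx2 _ h5
    subst hwx
    refine ⟨y, ?_, ⟨h1, h2, q, by simp, hqa, hy1⟩, ?_⟩
    · rintro rfl
      have := hT.corner_inj h1 h2 h4 h3 hqa (by simp) h5 hy1
      grind
    · rintro z ⟨_, _, p', hp', hp'a, hz⟩
      simp only [Finset.mem_insert, Finset.mem_singleton] at hp'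
      rcases hp' with rfl | rfl | rfl
      · exact absurd rfl hp'a
      · exact Or.inl (hx2 z hz)
      · exact Or.inr (hy2 z hz)
  rcases u with a | t <;> rcases v with b | t'
  · rcases w with d | t
    · exact h.elim
    · obtain ⟨h1, h2, h3, h4⟩ := h
      obtain ⟨t', g1, g2, g3, g4, g5⟩ := hT.exists_opposite h2 h1.ne h3 h4
      refine ⟨.inr t', by simpa using g2, ⟨h1, g1, g3, g4⟩, ?_⟩
      rintro (d | t'') hx
      · exact hx.elim
      · rcases g5 t'' hx.2.1 hx.2.2.1 hx.2.2.2 with rfl | rfl <;> simp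
  · exact mixed a t' w h
  · obtain ⟨w', h1, h2, h3⟩ := mixed b t w h.swap
    exact ⟨w', h1, h2.swap, fun x hx => h3 x hx.swap⟩
  · rcases w with a | t''
    · obtain ⟨h1, h2, h3, b, h4, h5, h6, h7, h8, h9⟩ := h
      refine ⟨.inl b, by simpa using h4, ⟨h1, h2, h3, a, h4.symm, fun h => h5 h.symm, h7, h6, h9,
        h8⟩, ?_⟩
      rintro (e | t'') hx
      · obtain ⟨-, -, -, b', -, -, k6, k7, k8, k9⟩ := hx
        by_contra hne
        simp only [Sum.inl.injEq, not_or] at hne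
        exact h1 (hT.eq_of_three h2 h3 h4.symm (Ne.symm hne.1) (Ne.symm hne.2) h6 h7 k6 h8 h9 k8)
      · exact hx.elim
    · exact h.elim

variable [Fintype V]

variable (G T) in
/-- The triangulation described by `FlipTri`. -/
noncomputable def flipped : Finset (Finset (V ⊕ Finset V)) := triples (FlipTri G T)

theorem mem_flipped {u v w : V ⊕ Finset V} : {u, v, w} ∈ flipped G T ↔ FlipTri G T u v w :=
  insert_mem_triples (fun _ _ _ h => h.ne) (fun _ _ _ h => h.swap) (fun _ _ _ h => h.swap')

end

section

variable {V : Type*} [DecidableEq V] [Fintype V] {G : SimpleGraph V} {T : Finset (Finset V)}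

theorem exists_of_mem_flipped {h : Finset (V ⊕ Finset V)} (hh : h ∈ flipped G T) :
    ∃ a p t x, h = {.inl a, .inr t, x} ∧ t ∈ T ∧ a ∈ t ∧ p ∈ t ∧ p ≠ a ∧ Corner G T a p t x := by
  obtain ⟨u, v, w, rfl, h⟩ := mem_triples.1 hh
  have key : ∀ a t w, FlipTri G T (.inl a) (.inr t) w →
      ∃ a' p t' x, ({.inl a, .inr t, w} : Finset (V ⊕ Finset V)) = {.inl a', .inr t', x} ∧
        t' ∈ T ∧ a' ∈ t' ∧ p ∈ t' ∧ p ≠ a' ∧ Corner G T a' p t' x := by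
    intro a t w h
    obtain ⟨h1, h2, p, h3, h4, h5⟩ := flipTri_iff.1 h
    exact ⟨a, p, t, w, rfl, h1, h2, h3, h4, h5⟩
  rcases u with a | t <;> rcases v with b | t'
  · rcases w with d | t
    · exact h.elim
    · rw [insert_swap']; exact key _ _ _ h.swap'
  · exact key _ _ _ h
  · rw [insert_swap]; exact key _ _ _ h.swap
  · rcases w with a | t''
    · rw [← insert_rot]; exact key _ _ _ h.swap'.swap
    · exact h.elim

theorem tedge_flipped {u v : V ⊕ Finset V} :
    TEdge (flipped G T) u v ↔ ∃ w, FlipTri G T u v w := by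
  constructor
  · rintro ⟨huv, h, hh, hu, hv⟩
    obtain ⟨a, b, d, rfl, h'⟩ := mem_triples.1 hh
    obtain ⟨w, hw⟩ := eq_of_mem3 (Finset.card_eq_three.2
      ⟨a, b, d, h'.ne.1, h'.ne.2.2, h'.ne.2.1, rfl⟩) huv hu hv
    rw [hw] at hh
    exact ⟨w, mem_flipped.1 hh⟩
  · rintro ⟨w, hw⟩
    exact ⟨hw.ne.1, _, mem_flipped.2 hw, by simp, by simp⟩

theorem flipped_strong (hT : IsSphere T) (P : Finset (V ⊕ Finset V) → Prop)
    (hne : ∃ h ∈ flipped G T, P h)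
    (hP : ∀ a b d d', {a, b, d} ∈ flipped G T → {a, b, d'} ∈ flipped G T → P {a, b, d} →
      P {a, b, d'}) : ∀ h ∈ flipped G T, P h := by
  simp only [mem_flipped] at hP
  let F : V → V → Finset V → Prop := fun a p t => ∀ x, Corner G T a p t x → P {.inl a, .inr t, x}
  have f1 : ∀ a p q t, t ∈ T → a ∈ t → p ∈ t → q ∈ t → p ≠ a → q ≠ a → F a p t → F a q t := by
    intro a p q t ht ha hp hq hpa hqa h x hx
    obtain ⟨y, hy, -⟩ := hT.exists_corner (G := G) ht hpa ha hp
    exact hP _ _ y x (flipTri_iff.2 ⟨ht, ha, p, hp, hpa, hy⟩)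
      (flipTri_iff.2 ⟨ht, ha, q, hq, hqa, hx⟩) (h y hy)
  have f2 : ∀ a p t, t ∈ T → a ∈ t → p ∈ t → p ≠ a → F a p t → F p a t := by
    intro a p t ht ha hp hpa h x hx
    rcases x with b | t'
    · obtain ⟨h1, rfl⟩ := hx
      have := h (.inl p) ⟨h1.symm, rfl⟩
      rwa [insert_rot, insert_swap] at this
    · have hx' : Corner G T a p t (.inr t') := ⟨fun h => hx.1 h.symm, hx.2.1, hx.2.2.1,
        hx.2.2.2.2, hx.2.2.2.1⟩
      have := h _ hx'
      rw [insert_rot] at this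
      rw [insert_rot]
      exact hP _ _ _ _ (flipTri_iff.2 ⟨ht, ha, p, hp, hpa, hx'⟩).swap.swap'
        (flipTri_iff.2 ⟨ht, hp, a, ha, hpa.symm, hx⟩).swap.swap' this
  have f3 : ∀ a p t t', t ∈ T → t' ∈ T → a ∈ t → p ∈ t → a ∈ t' → p ∈ t' → p ≠ a →
      F a p t → F a p t' := by
    intro a p t t' ht ht' ha hp ha' hp' hpa h x hx
    by_cases he : t' = t
    · exact he ▸ h x (he ▸ hx)
    rcases x with b | t''
    · obtain ⟨h1, rfl⟩ := hx
      have := h (.inl b) ⟨h1, rfl⟩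
      rw [insert_swap'] at this ⊢
      exact hP _ _ (.inr t) (.inr t') ⟨h1, ht, ha, hp⟩ ⟨h1, ht', ha', hp'⟩ this
    · obtain ⟨s, h1, h2, h3, h4, h5⟩ := hT.exists_opposite ht' hpa.symm ha' hp'
      have e1 : t'' = s := (h5 t'' hx.2.2.1 hx.2.2.2.1 hx.2.2.2.2).resolve_left hx.2.1
      have e2 : t = s := (h5 t ht ha hp).resolve_left (Ne.symm he)
      rw [e1, ← e2, insert_swap']
      exact h _ ⟨hx.1, he, ht', ha', hp'⟩
  let Q : Finset V → Prop := fun t => ∀ a ∈ t, ∀ p ∈ t, p ≠ a → F a p t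
  have fQ : ∀ a p t, t ∈ T → a ∈ t → p ∈ t → p ≠ a → F a p t → Q t := by
    intro a p t ht ha hp hpa h
    have g1 : ∀ q ∈ t, q ≠ a → F a q t := fun q hq hqa => f1 a p q t ht ha hp hq hpa hqa h
    intro b hb q hq hqb
    by_cases hba : b = a
    · exact hba ▸ g1 q hq (hba ▸ hqb)
    · exact f1 b a q t ht hb ha hq (Ne.symm hba) hqb (f2 a b t ht ha hb hba (g1 b hb hba))
  have hQ : ∀ t ∈ T, Q t := by
    refine hT.strong Q ?_ ?_
    · obtain ⟨h, hh, hPh⟩ := hne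
      obtain ⟨a, p, t, x, rfl, h1, h2, h3, h4, h5⟩ := exists_of_mem_flipped hh
      refine ⟨t, h1, fQ a p t h1 h2 h3 h4 fun y hy => ?_⟩
      obtain ⟨z, _, hz⟩ := hT.exists_corner (G := G) h1 h4 h2 h3
      rw [hz y hy, ← hz x h5]
      exact hPh
    · intro a b d d' h1 h2 h3
      have hab := (hT.ne h1).1.symm
      exact fQ a b _ h2 (by simp) (by simp) hab (f3 a b _ _ h1 h2 (by simp) (by simp) (by simp)
        (by simp) hab (h3 a (by simp) b (by simp) hab))
  intro h hh
  obtain ⟨a, p, t, x, rfl, h1, h2, h3, h4, h5⟩ := exists_of_mem_flipped hh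
  exact hQ t h1 a h2 p h3 h4 x h5

theorem flipped_h1 (hT : IsSphere T) (c : V ⊕ Finset V → V ⊕ Finset V → ZMod 2)
    (hs : ∀ a b, c a b = c b a)
    (hc : ∀ a b d, {a, b, d} ∈ flipped G T → c a b + c b d + c a d = 0) :
    ∃ φ : V ⊕ Finset V → ZMod 2, ∀ a b, TEdge (flipped G T) a b → c a b = φ a + φ b := by
  classical
  simp only [mem_flipped] at hc
  have z1 : ∀ p q r : ZMod 2, p + q + r = 0 → r = p + q := by decide
  let e : V → Finset V → ZMod 2 := fun a t => c (.inl a) (.inr t)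
  have kept : ∀ a b t, Kept G T a b t → c (.inl a) (.inl b) = e a t + e b t := by
    intro a b t h
    have := z1 _ _ _ (hc (.inl a) (.inr t) (.inl b) h)
    rw [this, hs (.inr t)]
  have flip : ∀ a t t', Flipped G T a t t' → c (.inr t) (.inr t') = e a t + e a t' := by
    intro a t t' h
    have := z1 _ _ _ (hc (.inr t) (.inl a) (.inr t') h)
    rw [this, hs (.inr t)]
  have e_eq : ∀ a b t t', t ∈ T → t' ∈ T → a ∈ t → b ∈ t → a ∈ t' → b ∈ t' → a ≠ b →
      e a t + e b t = e a t' + e b t' := by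
    intro a b t t' ht ht' ha hb ha' hb' hab
    by_cases he : t = t'
    · rw [he]
    by_cases h : G.Adj a b
    · rw [← kept a b t ⟨h, ht, ha, hb⟩, ← kept a b t' ⟨h, ht', ha', hb'⟩]
    · have h1 := flip a t t' ⟨he, ht, ht', b, hab.symm, h, ha, hb, ha', hb'⟩
      have h2 := flip b t t' ⟨he, ht, ht', a, hab, fun h' => h h'.symm, hb, ha, hb', ha'⟩
      have h3 := h1.symm.trans h2
      revert h3
      generalize e a t = p, e b t = q, e a t' = r, e b t' = s
      revert p q r s; decide
  let d : V → V → ZMod 2 := fun a b =>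
    if h : ∃ t ∈ T, a ∈ t ∧ b ∈ t then e a h.choose + e b h.choose else 0
  have hd : ∀ a b t, t ∈ T → a ∈ t → b ∈ t → a ≠ b → d a b = e a t + e b t := by
    intro a b t ht ha hb hab
    have h : ∃ t ∈ T, a ∈ t ∧ b ∈ t := ⟨t, ht, ha, hb⟩
    have := h.choose_spec
    simp only [d, dif_pos h]
    exact e_eq a b _ _ this.1 ht this.2.1 this.2.2 ha hb hab
  obtain ⟨φ, hφ⟩ := hT.h1 d (fun a b => by
      by_cases hab : a = b
      · rw [hab]
      by_cases h : ∃ t ∈ T, a ∈ t ∧ b ∈ t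
      · obtain ⟨t, ht, ha, hb⟩ := h
        rw [hd a b t ht ha hb hab, hd b a t ht hb ha (Ne.symm hab), add_comm]
      · have h' : ¬ ∃ t ∈ T, b ∈ t ∧ a ∈ t := fun ⟨t, ht, hb, ha⟩ => h ⟨t, ht, ha, hb⟩
        simp only [d, dif_neg h, dif_neg h'])
    (fun a b g h => by
      obtain ⟨n1, n2, n3⟩ := hT.ne h
      rw [hd a b _ h (by simp) (by simp) n1, hd b g _ h (by simp) (by simp) n2,
        hd a g _ h (by simp) (by simp) n3]
      generalize e a _ = p, e b _ = q, e g _ = r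
      revert p q r; decide)
  have hφ' : ∀ a b t, t ∈ T → a ∈ t → b ∈ t → φ a + e a t = φ b + e b t := by
    intro a b t ht ha hb
    by_cases hab : a = b
    · rw [hab]
    have h1 := hφ a b ⟨hab, t, ht, ha, hb⟩
    rw [hd a b t ht ha hb hab] at h1
    revert h1
    generalize e a t = p, e b t = q, φ a = r, φ b = s
    revert p q r s; decide
  let ψ : Finset V → ZMod 2 := fun t => if h : ∃ a, a ∈ t then φ h.choose + e h.choose t else 0
  have hψ : ∀ a t, t ∈ T → a ∈ t → ψ t = φ a + e a t := by
    intro a t ht ha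
    have h : ∃ a, a ∈ t := ⟨a, ha⟩
    simp only [ψ, dif_pos h]
    exact hφ' _ _ t ht h.choose_spec ha
  refine ⟨Sum.elim φ ψ, ?_⟩
  have mixed : ∀ a t, t ∈ T → a ∈ t → c (.inl a) (.inr t) = φ a + ψ t := by
    intro a t ht ha
    rw [hψ a t ht ha, ← add_assoc, CharTwo.add_self_eq_zero, zero_add]
  intro u v huv
  obtain ⟨w, hw⟩ := tedge_flipped.1 huv
  rcases u with a | t <;> rcases v with b | t' <;>
    simp only [Sum.elim_inl, Sum.elim_inr]
  · rcases w with d | t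
    · exact hw.elim
    · obtain ⟨h1, h2, h3, h4⟩ := hw
      rw [kept a b t ⟨h1, h2, h3, h4⟩, ← hd a b t h2 h3 h4 h1.ne]
      exact hφ a b ⟨h1.ne, t, h2, h3, h4⟩
  · obtain ⟨h1, h2, _⟩ := flipTri_iff.1 hw
    exact mixed a t' h1 h2
  · obtain ⟨h1, h2, _⟩ := flipTri_iff.1 hw.swap
    rw [hs, mixed b t h1 h2, add_comm]
  · rcases w with a | t''
    · obtain ⟨h1, h2, h3, b, h4, h5, h6, h7, h8, h9⟩ := id hw
      rw [flip a t t' hw, hψ a t h2 h6, hψ a t' h3 h8]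
      generalize e a t = p, e a t' = q, φ a = r
      revert p q r; decide
    · exact hw.elim

theorem isSphere_flipped (hT : IsSphere T) : IsSphere (flipped G T) where
  card := by
    intro h hh
    obtain ⟨u, v, w, rfl, h⟩ := mem_triples.1 hh
    exact card3 h.ne.1 h.ne.2.1 h.ne.2.2
  nonempty := by
    obtain ⟨t, ht⟩ := hT.nonempty
    obtain ⟨a, b, d, h1, h2, h3, rfl⟩ := Finset.card_eq_three.1 (hT.card t ht)
    obtain ⟨x, hx, -⟩ := hT.exists_corner (G := G) (a := a) (p := b) ht h1.symm (by simp) (by simp)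
    exact ⟨_, mem_flipped.2 (flipTri_iff.2 ⟨ht, by simp, b, by simp, h1.symm, hx⟩)⟩
  two := by
    intro a b d h
    simp only [mem_flipped] at h ⊢
    exact flipped_two hT h
  strong := flipped_strong hT
  h1 := flipped_h1 hT

end

/-- Links of vertices are connected. -/
theorem IsSphere.link_subset {α : Type*} [DecidableEq α] {T : Finset (Finset α)} (hT : IsSphere T)
    {a b g : α} {L : Set α} (hL : ∀ p q, {a, p, q} ∈ T → p ∈ L → q ∈ L) (hb : b ∈ L)
    (hab : TEdge T a b) (hag : TEdge T a g) : g ∈ L := by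
  classical
  have hL' : ∀ p q, {a, p, q} ∈ T → (p ∈ L ↔ q ∈ L) := fun p q h =>
    ⟨hL p q h, hL q p (insert_swap' a p q ▸ h)⟩
  let c : α → α → ZMod 2 := fun u v => if (u = a ∧ v ∈ L) ∨ (v = a ∧ u ∈ L) then 1 else 0
  have c0 : ∀ u v, u ≠ a → v ≠ a → c u v = 0 := fun u v hu hv => by simp [c, hu, hv]
  have ca : ∀ v, v ≠ a → c a v = if v ∈ L then 1 else 0 := fun v hv => by simp [c, hv]
  have cs : ∀ u v, c u v = c v u := fun u v => by simp only [c, or_comm]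
  have key : ∀ v w, {a, v, w} ∈ T → c a v + c v w + c a w = 0 := by
    intro v w h
    obtain ⟨h1, h2, h3⟩ := hT.ne h
    rw [c0 v w h1.symm h3.symm, ca v h1.symm, ca w h3.symm, if_congr (hL' v w h) rfl rfl, add_zero,
      CharTwo.add_self_eq_zero]
  obtain ⟨φ, hφ⟩ := hT.h1 c cs (by
    intro u v w h
    by_cases hu : u = a
    · exact hu ▸ key v w (hu ▸ h)
    by_cases hv : v = a
    · subst hv
      rw [insert_swap] at h
      have := key u w h
      rw [cs u v, ← this]; ring
    by_cases hw : w = a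
    · subst hw
      rw [← insert_rot] at h
      have := key u v h
      rw [cs u w, cs v w, ← this]; ring
    rw [c0 u v hu hv, c0 v w hv hw, c0 u w hu hw]; rfl)
  have same : ∀ t ∈ T, ∀ u ∈ t, ∀ v ∈ t, u ≠ a → v ≠ a → φ u = φ v := by
    intro t ht u hu v hv hua hva
    by_cases huv : u = v
    · rw [huv]
    have := hφ u v ⟨huv, t, ht, hu, hv⟩
    rw [c0 u v hua hva] at this
    exact CharTwo.add_eq_zero.1 this.symm
  have all := hT.strong (fun t => ∃ v ∈ t, v ≠ a ∧ φ v = φ b)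
    (by obtain ⟨hne, t, ht, _, hbt⟩ := hab; exact ⟨t, ht, b, hbt, hne.symm, rfl⟩) (by
    rintro x y d d' h1 h2 ⟨v, hv, hva, hvb⟩
    have hxy := (hT.ne h1).1
    by_cases hxa : x = a
    · have hya : y ≠ a := fun h => hxy (hxa.trans h.symm)
      exact ⟨y, by simp, hya, (same _ h1 y (by simp) v hv hya hva).trans hvb⟩
    · exact ⟨x, by simp, hxa, (same _ h1 x (by simp) v hv hxa hva).trans hvb⟩)
  obtain ⟨hga, t, ht, hat, hgt⟩ := id hag
  obtain ⟨v, hv, hva, hvb⟩ := all t ht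
  have h1 := same t ht g hgt v hv hga.symm hva
  have h2 := hφ a g hag
  have h3 := hφ a b hab
  rw [h1, hvb, ← h3, ca g hga.symm, ca b hab.1.symm, if_pos hb] at h2
  by_contra hg
  rw [if_neg hg] at h2
  exact absurd h2 (by decide)

section

variable {V : Type*} [DecidableEq V] [Fintype V] {G : SimpleGraph V} {T : Finset (Finset V)}

theorem tedge_flipped_real {a b : V} :
    TEdge (flipped G T) (.inl a) (.inl b) ↔ G.Adj a b ∧ TEdge T a b := by
  rw [tedge_flipped]
  constructor
  · rintro ⟨d | t, h⟩
    · exact h.elim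
    · exact ⟨h.1, h.1.ne, t, h.2⟩
  · rintro ⟨h1, _, t, h2⟩
    exact ⟨.inr t, h1, h2⟩

theorem tedge_flipped_mixed (hT : IsSphere T) {a : V} {t : Finset V} :
    TEdge (flipped G T) (.inl a) (.inr t) ↔ t ∈ T ∧ a ∈ t := by
  rw [tedge_flipped]
  constructor
  · rintro ⟨w, h⟩
    obtain ⟨h1, h2, _⟩ := flipTri_iff.1 h
    exact ⟨h1, h2⟩
  · rintro ⟨h1, h2⟩
    obtain ⟨p, hp, hpa⟩ : ∃ p ∈ t, p ≠ a := by
      by_contra! hno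
      have := Finset.card_le_card (show t ⊆ {a} from fun v hv => by simp [hno v hv])
      rw [hT.card t h1] at this
      simp at this
    obtain ⟨x, hx, -⟩ := hT.exists_corner (G := G) h1 hpa h2 hp
    exact ⟨x, flipTri_iff.2 ⟨h1, h2, p, hp, hpa, hx⟩⟩

theorem tedge_flipped_new {t t' : Finset V} :
    TEdge (flipped G T) (.inr t) (.inr t') ↔ ∃ a, Flipped G T a t t' := by
  rw [tedge_flipped]
  constructor
  · rintro ⟨a | t'', h⟩
    · exact ⟨a, h⟩
    · exact h.elim
  · rintro ⟨a, h⟩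
    exact ⟨.inl a, h⟩

omit [Fintype V] in
theorem IsSphere.no_three_flips (hT : IsSphere T)
    (hiso : ∀ a ∈ verts T, ∃ b, G.Adj a b ∧ TEdge T a b) {a b d : V} {t' t'' : Finset V}
    (ht : {a, b, d} ∈ T) (ht' : t' ∈ T) (ht'' : t'' ∈ T) (h1 : t' ≠ {a, b, d})
    (h2 : t'' ≠ {a, b, d}) (ha' : a ∈ t') (hb' : b ∈ t') (ha'' : a ∈ t'') (hd'' : d ∈ t'')
    (hab : ¬ G.Adj a b) (had : ¬ G.Adj a d) {u v : V} (huv : v ≠ u) (hu' : u ∈ t') (hv' : v ∈ t')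
    (hu'' : u ∈ t'') (hv'' : v ∈ t'') (hn : ¬ G.Adj u v) : False := by
  obtain ⟨n1, n2, n3⟩ := hT.ne ht
  obtain ⟨x, rfl⟩ := eq_of_mem3 (hT.card t' ht') n1 ha' hb'
  obtain ⟨y, rfl⟩ := eq_of_mem3 (hT.card t'' ht'') n3 ha'' hd''
  obtain ⟨m1, m2, m3⟩ := hT.ne ht'
  obtain ⟨k1, k2, k3⟩ := hT.ne ht''
  have hxd : x ≠ d := by rintro rfl; exact h1 rfl
  have hyb : y ≠ b := by rintro rfl; exact h2 (insert_swap' _ _ _)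
  simp only [Finset.mem_insert, Finset.mem_singleton] at hu' hv' hu'' hv''
  have hxy : x = y := by grind
  subst hxy
  have hax : ¬ G.Adj a x := by
    have := G.adj_comm u v
    grind
  have e1 : ∀ {p q r}, {p, q, r} ∈ T → {p, r, q} ∈ T := fun h => by rwa [insert_swap']
  obtain ⟨g, hg, hag⟩ := hiso a ⟨_, ht, by simp⟩
  have : g ∈ ({b, d, x} : Set V) := by
    refine hT.link_subset (a := a) (b := b) ?_ (by simp) (hT.tedge ht) hag
    rintro p q h (rfl | rfl | rfl)
    · rcases hT.third ht ht' hxd.symm h with rfl | rfl <;> simp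
    · rcases hT.third (e1 ht) ht'' hyb.symm h with rfl | rfl <;> simp
    · rcases hT.third (e1 ht') (e1 ht'') n2 h with rfl | rfl <;> simp
  rcases this with rfl | rfl | rfl
  · exact hab hg
  · exact had hg
  · exact hax hg

theorem flipped_flag (hT : IsSphere T) (htf : ∀ a b d, G.Adj a b → G.Adj b d → ¬ G.Adj a d)
    (hiso : ∀ a ∈ verts T, ∃ b, G.Adj a b ∧ TEdge T a b) (u v w : V ⊕ Finset V)
    (h1 : TEdge (flipped G T) u v) (h2 : TEdge (flipped G T) v w)
    (h3 : TEdge (flipped G T) u w) : {u, v, w} ∈ flipped G T := by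
  rw [mem_flipped]
  have k1 : ∀ a b t, TEdge (flipped G T) (.inl a) (.inl b) → TEdge (flipped G T) (.inl a) (.inr t) →
      TEdge (flipped G T) (.inl b) (.inr t) → Kept G T a b t := by
    intro a b t h1 h2 h3
    rw [tedge_flipped_mixed hT] at h2 h3
    exact ⟨(tedge_flipped_real.1 h1).1, h2.1, h2.2, h3.2⟩
  have k2 : ∀ a t t', TEdge (flipped G T) (.inl a) (.inr t) →
      TEdge (flipped G T) (.inl a) (.inr t') → TEdge (flipped G T) (.inr t) (.inr t') →
      Flipped G T a t t' := by
    intro a t t' h1 h2 h3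
    rw [tedge_flipped_mixed hT] at h1 h2
    obtain ⟨x, h4⟩ := tedge_flipped_new.1 h3
    obtain ⟨n, -, -, y, h5, h6, h7, h8, h9, h10⟩ := id h4
    by_cases hax : a = x
    · exact hax ▸ h4
    by_cases hay : a = y
    · subst hay
      exact ⟨n, h1.1, h2.1, x, h5.symm, fun h => h6 h.symm, h8, h7, h10, h9⟩
    · exact absurd (hT.eq_of_three h1.1 h2.1 hax hay h5.symm h1.2 h7 h8 h2.2 h9 h10) n
  rcases u with a | t <;> rcases v with b | t' <;> rcases w with d | t''
  · rw [tedge_flipped_real] at h1 h2 h3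
    exact htf a b d h1.1 h2.1 h3.1
  · exact k1 a b t'' h1 h3 h2
  · exact k1 a d t' h3 h1 h2.symm
  · exact k2 a t' t'' h1 h3 h2
  · exact k1 b d t h2 h1.symm h3.symm
  · exact k2 b t t'' h1.symm h2 h3
  · exact k2 d t t' h3.symm h2.symm h1
  · exfalso
    rw [tedge_flipped_new] at h1 h2 h3
    obtain ⟨a, n1, ht, ht', b, hba, hab, a1, b1, a2, b2⟩ := h1
    obtain ⟨u, n2, -, ht'', v, hvu, huv, u1, v1, u2, v2⟩ := h2
    obtain ⟨p, n3, -, -, q, hqp, hpq, p1, q1, p2, q2⟩ := h3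
    have main : ∀ a b d, a ≠ b → d ≠ a → ¬ G.Adj a b → ¬ G.Adj a d → a ∈ t → b ∈ t → d ∈ t →
        a ∈ t' → b ∈ t' → a ∈ t'' → d ∈ t'' → False := by
      intro a b d hab' hda hab had at' bt dt at'' bt' at₃ dt''
      by_cases hbd : b = d
      · subst hbd
        obtain ⟨s, -, -, -, -, hs⟩ := hT.exists_opposite ht hab' at' bt
        exact n2 (((hs t' ht' at'' bt').resolve_left n1.symm).trans
          ((hs t'' ht'' at₃ dt'').resolve_left n3.symm).symm)
      obtain ⟨e, rfl⟩ := eq_of_mem3 (hT.card t ht) hab' at' bt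
      have : d = e := by
        simp only [Finset.mem_insert, Finset.mem_singleton] at dt
        grind
      subst this
      exact hT.no_three_flips hiso ht ht' ht'' n1.symm n3.symm at'' bt' at₃ dt'' hab had hvu u1
        v1 u2 v2 huv
    have hba' : ¬ G.Adj b a := fun h => hab h.symm
    have hqp' : ¬ G.Adj q p := fun h => hpq h.symm
    have hmeet : a = p ∨ a = q ∨ b = p ∨ b = q := by
      by_contra! hno
      obtain ⟨e, rfl⟩ := eq_of_mem3 (hT.card t ht) hba.symm a1 b1
      simp only [Finset.mem_insert, Finset.mem_singleton] at p1 q1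
      grind
    rcases hmeet with rfl | rfl | rfl | rfl
    · exact main a b q hba.symm hqp hab hpq a1 b1 q1 a2 b2 p2 q2
    · exact main a b p hba.symm hqp.symm hab hqp' a1 b1 p1 a2 b2 q2 p2
    · exact main b a q hba hqp hba' hpq b1 a1 q1 b2 a2 p2 q2
    · exact main b a p hba hqp.symm hba' hqp' b1 a1 p1 b2 a2 q2 p2

end

/-! ### Sweeping a front across a sphere -/

/-- If only vertices of an acyclic set are affected, then `E` can be enlarged to `E'`. -/
theorem Completable.eat {V : Type*} [Finite V] {G : SimpleGraph V} {E E' S : Set V}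
    (hE : E ⊆ E') (hS : ForestOn G S)
    (h : ∀ w, w ∉ E → (w ∈ E' ∨ ∃ w' ∈ E', G.Adj w w') → w ∈ S)
    (hc : Completable G E') : Completable G E := by
  induction hn : (E' \ E).ncard using Nat.strong_induction_on generalizing E with
  | _ n ih =>
  by_cases h0 : E' ⊆ E
  · rwa [hE.antisymm h0]
  obtain ⟨x, hx, hxE⟩ := Set.not_subset.mp h0
  have hsub : insert x E ⊆ E' := Set.insert_subset hx hE
  refine Completable.step E x hxE (hS.mono ?_) (ih _ ?_ hsub ?_ rfl)
  · rintro w ⟨hw, rfl | ⟨w', hw', ha⟩⟩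
    · exact h _ hw (Or.inl hx)
    · exact h _ hw (Or.inr ⟨w', hsub hw', ha⟩)
  · rw [← hn]
    refine Set.ncard_lt_ncard ⟨fun a ha => ⟨ha.1, fun h' => ha.2 (Or.inr h')⟩, fun h' => ?_⟩
    exact (h' ⟨hx, hxE⟩).2 (Or.inl rfl)
  · intro w hw
    exact h w fun h' => hw (Or.inr h')

/-- A planar graph on `X` in which every separator has at least four vertices, and whose
subgraph on `ρ` is triangle-free. -/
structure Host {β : Type*} (H : SimpleGraph β) (X ρ : Set β) : Prop where
  pl : Pl H Set.univ
  supp : ∀ a b, H.Adj a b → a ∈ X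
  four : ∀ (A : Set β) (b₀ : β), A.Nonempty → A ⊆ X → b₀ ∈ X → b₀ ∉ A →
    (∀ a ∈ A, ¬ H.Adj a b₀) →
    ∀ x y z, ∃ w, w ∉ A ∧ (∃ a ∈ A, H.Adj a w) ∧ w ≠ x ∧ w ≠ y ∧ w ≠ z
  tri : ∀ a b d, a ∈ ρ → b ∈ ρ → d ∈ ρ → H.Adj a b → H.Adj b d → ¬ H.Adj a d

/-- Disjoint connected sets `U` and `R` without an edge between them, all remaining vertices
being adjacent to both, together with `r ∈ R` and a remaining vertex `v` adjacent to `r`. -/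
structure Front {β : Type*} (H : SimpleGraph β) (X U R : Set β) (v r : β) : Prop where
  US : U ⊆ X
  RS : R ⊆ X
  connU : Conn H U
  connR : Conn H R
  sep : ∀ a ∈ U, ∀ b ∈ R, ¬ H.Adj a b
  disj : ∀ a ∈ U, a ∉ R
  bd : ∀ b ∈ X, b ∉ U → b ∉ R → (∃ a ∈ U, H.Adj b a) ∧ ∃ a ∈ R, H.Adj b a
  rR : r ∈ R
  vX : v ∈ X
  vU : v ∉ U
  vR : v ∉ R
  vr : H.Adj v r

theorem Front.exists_good {β : Type*} [Finite β] {H : SimpleGraph β} {X ρ U R : Set β} {v r : β}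
    (hH : Host H X ρ) (hF : Front H X U R v r)
    (hx : ∃ x ∈ X, x ∉ U ∧ x ∉ R ∧ ¬ H.Adj x r) :
    ∃ x K, (x ∈ X ∧ x ∉ U ∧ x ∉ R) ∧ r ∈ K ∧ Conn H K ∧ K ⊆ R ∧ (∀ k ∈ K, ¬ H.Adj x k) ∧
      ∀ q ∈ R, q ∉ K → H.Adj x q ∧ ∃ k ∈ K, H.Adj q k := by
  obtain ⟨x, ⟨hxX, hxU, hxR, hxr⟩, hmax⟩ := Set.exists_max_image
    {x | x ∈ X ∧ x ∉ U ∧ x ∉ R ∧ ¬ H.Adj x r}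
    (fun x => (comp H {q | q ∈ R ∧ ¬ H.Adj x q} r).ncard) (Set.toFinite _) hx
  have rW : r ∈ {q | q ∈ R ∧ ¬ H.Adj x q} := ⟨hF.rR, hxr⟩
  have rK := mem_comp_self H rW
  have cK := conn_comp (G := H) rW
  have KW := comp_subset H {q | q ∈ R ∧ ¬ H.Adj x q} r
  have nK : ∀ k q, k ∈ comp H {q | q ∈ R ∧ ¬ H.Adj x q} r →
      q ∉ comp H {q | q ∈ R ∧ ¬ H.Adj x q} r → q ∈ R → H.Adj k q → H.Adj x q := by
    intro k q hk hq hqR hkq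
    by_contra h
    exact hq (comp_closed hk ⟨hqR, h⟩ hkq)
  have hmax' : ∀ x' ∈ X, x' ∉ U → x' ∉ R → ¬ H.Adj x' r →
      comp H {q | q ∈ R ∧ ¬ H.Adj x q} r ⊆ comp H {q | q ∈ R ∧ ¬ H.Adj x' q} r →
      comp H {q | q ∈ R ∧ ¬ H.Adj x' q} r ⊆ comp H {q | q ∈ R ∧ ¬ H.Adj x q} r := by
    intro x' h1 h2 h3 h4 h5
    exact (Set.eq_of_subset_of_ncard_le h5 (hmax x' ⟨h1, h2, h3, h4⟩)).ge
  generalize comp H {q | q ∈ R ∧ ¬ H.Adj x q} r = K at *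
  have KR : K ⊆ R := fun k hk => (KW hk).1
  have xK : ∀ k ∈ K, ¬ H.Adj x k := fun k hk => (KW hk).2
  have claim1 : ∀ x' ∈ X, x' ∉ U → x' ∉ R → (∀ k ∈ K, ¬ H.Adj x' k) →
      ∀ q ∈ R, q ∉ K → (∃ k ∈ K, H.Adj q k) → H.Adj x' q := by
    intro x' h1 h2 h3 h4 q hq hqK hk
    obtain ⟨k, hk, hqk⟩ := hk
    by_contra hn
    have hsub := cK.subset_comp (S := {q | q ∈ R ∧ ¬ H.Adj x' q})
      (fun k hk => ⟨KR hk, h4 k hk⟩) rK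
    exact hqK (hmax' x' h1 h2 h3 (h4 r rK) hsub (comp_closed (hsub hk) ⟨hq, hn⟩ hqk.symm))
  refine ⟨x, K, ⟨hxX, hxU, hxR⟩, rK, cK, KR, xK, ?_⟩
  by_contra! hcon
  obtain ⟨p, pR, pK, hp⟩ := hcon
  have pN : ∀ k ∈ K, ¬ H.Adj p k := fun k hk hpk => hp (nK k p hk pK pR hpk.symm) k hk hpk
  have pW : p ∈ {q | q ∈ R ∧ q ∉ K ∧ ∀ k ∈ K, ¬ H.Adj q k} := ⟨pR, pK, pN⟩
  have pP := mem_comp_self H pW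
  have cP := conn_comp (G := H) pW
  have PW := comp_subset H {q | q ∈ R ∧ q ∉ K ∧ ∀ k ∈ K, ¬ H.Adj q k} p
  have Pcl : ∀ a b, a ∈ comp H {q | q ∈ R ∧ q ∉ K ∧ ∀ k ∈ K, ¬ H.Adj q k} p →
      b ∉ comp H {q | q ∈ R ∧ q ∉ K ∧ ∀ k ∈ K, ¬ H.Adj q k} p → H.Adj a b → b ∈ R →
      b ∉ K ∧ ∃ k ∈ K, H.Adj b k := by
    intro a b ha hb hab hbR
    have hbK : b ∉ K := fun h => (PW ha).2.2 b h hab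
    refine ⟨hbK, ?_⟩
    by_contra! h
    exact hb (comp_closed ha ⟨hbR, hbK, h⟩ hab)
  generalize comp H {q | q ∈ R ∧ q ∉ K ∧ ∀ k ∈ K, ¬ H.Adj q k} p = P at *
  have PR : P ⊆ R := fun a ha => (PW ha).1
  have PK : ∀ a ∈ P, a ∉ K := fun a ha => (PW ha).2.1
  -- the two kinds of neighbours of `P`
  let Y : Set β := {y | y ∈ X ∧ y ∉ U ∧ (∃ a ∈ P, H.Adj a y) ∧ (∃ k ∈ K, H.Adj y k) ∧
    (y ∈ R → y ∉ K ∧ H.Adj x y)}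
  let Z : Set β := {y | y ∈ X ∧ y ∉ U ∧ y ∉ R ∧ (∃ a ∈ P, H.Adj a y) ∧ ∀ k ∈ K, ¬ H.Adj y k}
  have split : ∀ a ∈ P, ∀ b, b ∉ P → H.Adj a b → b ∈ Y ∨ b ∈ Z := by
    intro a ha b hb hab
    have hbX := hH.supp b a hab.symm
    have hbU : b ∉ U := fun h => hF.sep b h a (PR ha) hab.symm
    by_cases hbR : b ∈ R
    · obtain ⟨h1, k, hk, h2⟩ := Pcl a b ha hb hab hbR
      exact Or.inl ⟨hbX, hbU, ⟨a, ha, hab⟩, ⟨k, hk, h2⟩, fun _ =>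
        ⟨h1, nK k b hk h1 hbR h2.symm⟩⟩
    · by_cases hk : ∃ k ∈ K, H.Adj b k
      · exact Or.inl ⟨hbX, hbU, ⟨a, ha, hab⟩, hk, fun h => absurd h hbR⟩
      · push Not at hk
        exact Or.inr ⟨hbX, hbU, hbR, ⟨a, ha, hab⟩, hk⟩
  obtain ⟨q₁, q₁R, q₁P, q₁Y⟩ : ∃ q ∈ R, q ∉ P ∧ q ∈ Y := by
    by_contra! h
    refine PK r (hF.connR.2 P ⟨p, pR, pP⟩ ?_ hF.rR) rK
    intro a _ ha b hbR hab
    by_contra hb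
    rcases split a ha b hb hab with h' | h'
    · exact h b hbR hb h'
    · exact h'.2.2.1 hbR
  have q₁K := (q₁Y.2.2.2.2 q₁R).1
  have YU : ∀ y ∈ Y, ∃ a ∈ insert x U, H.Adj a y := by
    intro y hy
    by_cases hyR : y ∈ R
    · exact ⟨x, Or.inl rfl, (hy.2.2.2.2 hyR).2⟩
    · obtain ⟨a, ha, h⟩ := (hF.bd y hy.1 hy.2.1 hyR).1
      exact ⟨a, Or.inr ha, h.symm⟩
  have YK : ∀ y ∈ Y, y ∉ K := fun y hy hyK => (hy.2.2.2.2 (KR hyK)).1 hyK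
  have Yx : ∀ y ∈ Y, y ≠ x := by
    rintro y hy rfl
    obtain ⟨k, hk, h⟩ := hy.2.2.2.1
    exact xK k hk h
  have YP : ∀ y ∈ Y, y ∉ P := by
    intro y hy hyP
    obtain ⟨k, hk, h⟩ := hy.2.2.2.1
    exact (PW hyP).2.2 k hk h
  have dPK : Disjoint P K := Set.disjoint_left.2 PK
  have dRU : Disjoint R U := Set.disjoint_left.2 fun a h h' => hF.disj a h' h
  have dPU : Disjoint P U := dRU.mono_left PR
  have dKU : Disjoint K U := dRU.mono_left KR
  have xP : x ∉ P := fun h => hxR (PR h)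
  have xK' : x ∉ K := fun h => hxR (KR h)
  have RP : ∀ a, a ∉ R → a ∉ P := fun a h h' => h (PR h')
  have RK : ∀ a, a ∉ R → a ∉ K := fun a h h' => h (KR h')
  have cUx : Conn H (insert x U) := hF.connU.insert (hF.bd x hxX hxU hxR).1
  have Ythree : ∀ a ∈ Y, ∀ b ∈ Y, ∀ d ∈ Y, a ≠ b → a ≠ d → b ≠ d → False := by
    intro a ha b hb d hd hab had hbd
    refine hH.pl.no_K33' P K (insert x U) {a} {b} {d}
      ⟨cP, cK, cUx, Conn.singleton _ _, Conn.singleton _ _, Conn.singleton _ _⟩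
      ⟨Set.subset_univ _, Set.subset_univ _, Set.subset_univ _, Set.subset_univ _,
        Set.subset_univ _, Set.subset_univ _⟩ ?_ ?_
    · simp [Set.disjoint_insert_right, dPK, dPU, dKU, xP, xK', YP a ha,
        YP b hb, YP d hd, YK a ha, YK b hb, YK d hd, Yx a ha, Yx b hb, Yx d hd, ha.2.1, hb.2.1,
        hd.2.1, hab, had, hbd]
    · have t1 : ∀ y ∈ Y, Touch H P {y} := fun y hy =>
        let ⟨a, ha, h⟩ := hy.2.2.1; h.touch ha rfl
      have t2 : ∀ y ∈ Y, Touch H K {y} := fun y hy =>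
        let ⟨a, ha, h⟩ := hy.2.2.2.1; h.symm.touch ha rfl
      have t3 : ∀ y ∈ Y, Touch H (insert x U) {y} := fun y hy =>
        let ⟨a, ha, h⟩ := YU y hy; h.touch ha rfl
      exact ⟨⟨t1 a ha, t1 b hb, t1 d hd⟩, ⟨t2 a ha, t2 b hb, t2 d hd⟩, t3 a ha, t3 b hb, t3 d hd⟩
  have Zq : ∀ z ∈ Z, H.Adj z q₁ := fun z hz =>
    claim1 z hz.1 hz.2.1 hz.2.2.1 hz.2.2.2.2 q₁ q₁R q₁K q₁Y.2.2.2.1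
  have ZU : ∀ z ∈ Z, Touch H U {z} := fun z hz =>
    let ⟨a, ha, h⟩ := (hF.bd z hz.1 hz.2.1 hz.2.2.1).1; h.symm.touch ha rfl
  have ZP : ∀ z ∈ Z, Touch H P {z} := fun z hz =>
    let ⟨a, ha, h⟩ := hz.2.2.2.1; h.touch ha rfl
  have Zthree : ∀ a ∈ Z, ∀ b ∈ Z, ∀ d ∈ Z, a ≠ b → a ≠ d → b ≠ d → False := by
    intro a ha b hb d hd hab had hbd
    refine hH.pl.no_K33' P U {q₁} {a} {b} {d}
      ⟨cP, hF.connU, Conn.singleton _ _, Conn.singleton _ _, Conn.singleton _ _,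
        Conn.singleton _ _⟩
      ⟨Set.subset_univ _, Set.subset_univ _, Set.subset_univ _, Set.subset_univ _,
        Set.subset_univ _, Set.subset_univ _⟩ ?_ ?_
    · have ne : ∀ z ∈ Z, q₁ ≠ z := by
        rintro z hz rfl
        exact hz.2.2.1 q₁R
      simp [dPU, q₁P, q₁Y.2.1, RP a ha.2.2.1, RP b hb.2.2.1, RP d hd.2.2.1, ha.2.1, hb.2.1,
        hd.2.1, hab, had, hbd, ne a ha, ne b hb, ne d hd]
    · exact ⟨⟨ZP a ha, ZP b hb, ZP d hd⟩, ⟨ZU a ha, ZU b hb, ZU d hd⟩,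
        (Zq a ha).symm.touch rfl rfl, (Zq b hb).symm.touch rfl rfl, (Zq d hd).symm.touch rfl rfl⟩
  obtain ⟨b₀, hb₀⟩ := hF.connU.1
  have four : ∀ x y z, ∃ w, (w ∈ Y ∨ w ∈ Z) ∧ w ≠ x ∧ w ≠ y ∧ w ≠ z := by
    intro x y z
    obtain ⟨w, h1, ⟨a, ha, h2⟩, h3⟩ := hH.four P b₀ ⟨p, pP⟩ (PR.trans hF.RS) (hF.US hb₀)
      (fun h => hF.disj _ hb₀ (PR h)) (fun a ha h => hF.sep _ hb₀ a (PR ha) h.symm) x y z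
    exact ⟨w, split a ha w h1 h2, h3⟩
  obtain ⟨y, hy, hyq⟩ : ∃ y ∈ Y, y ≠ q₁ := by
    by_contra! h
    obtain ⟨w₁, h1, h1', -⟩ := four q₁ q₁ q₁
    obtain ⟨w₂, h2, h2', h2'', -⟩ := four q₁ w₁ w₁
    obtain ⟨w₃, h3, h3', h3'', h3t⟩ := four q₁ w₁ w₂
    exact Zthree w₁ (by grind) w₂ (by grind) w₃ (by grind) h2''.symm h3''.symm h3t.symm
  obtain ⟨x₁, h1, h1q, h1y, -⟩ := four q₁ y y
  obtain ⟨x₂, h2, h2q, h2y, h21⟩ := four q₁ y x₁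
  have x₁Z : x₁ ∈ Z := h1.resolve_left fun h => Ythree q₁ q₁Y y hy x₁ h hyq.symm h1q.symm h1y.symm
  have x₂Z : x₂ ∈ Z := h2.resolve_left fun h => Ythree q₁ q₁Y y hy x₂ h hyq.symm h2q.symm h2y.symm
  obtain ⟨k, hk, hyk⟩ := hy.2.2.2.1
  obtain ⟨k₁, hk₁, hqk₁⟩ := q₁Y.2.2.2.1
  have z1 := x₁Z.2.1
  have z2 := x₂Z.2.1
  have z1' := x₁Z.2.2.1
  have z2' := x₂Z.2.2.1
  by_cases hyR : y ∈ R
  · have hyK := YK y hy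
    have Zy : ∀ z ∈ Z, H.Adj z y := fun z hz =>
      claim1 z hz.1 hz.2.1 hz.2.2.1 hz.2.2.2.2 y hyR hyK ⟨k, hk, hyk⟩
    have Zv : ∀ z ∈ Z, z ≠ v := by
      rintro z hz rfl
      exact hz.2.2.2.2 r rK hF.vr
    have v1 := Zv _ x₁Z
    have v2 := Zv _ x₂Z
    have vU := hF.vU
    have ne : ∀ q ∈ R, q ≠ v := fun q hq h => hF.vR (h ▸ hq)
    have ne1 := ne _ q₁R
    have ne2 := ne _ hyR
    refine hH.pl.no_K33' {x₁} {x₂} (insert v K) {q₁} {y} U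
      ⟨Conn.singleton _ _, Conn.singleton _ _, cK.insert ⟨r, rK, hF.vr⟩, Conn.singleton _ _,
        Conn.singleton _ _, hF.connU⟩
      ⟨Set.subset_univ _, Set.subset_univ _, Set.subset_univ _, Set.subset_univ _,
        Set.subset_univ _, Set.subset_univ _⟩ ?_ ?_
    · simp [Set.disjoint_insert_left, h21.symm, v1, v2, RK x₁ z1', RK x₂ z2', hyq.symm,
        q₁Y.2.1, hy.2.1, h1q, h1y, h2q, h2y, z1, z2, vU, q₁K, hyK, dKU, ne1, ne2]
    · obtain ⟨a, ha, hva⟩ := (hF.bd v hF.vX hF.vU hF.vR).1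
      exact ⟨⟨(Zq _ x₁Z).touch rfl rfl, (Zy _ x₁Z).touch rfl rfl, (ZU _ x₁Z).symm⟩,
        ⟨(Zq _ x₂Z).touch rfl rfl, (Zy _ x₂Z).touch rfl rfl, (ZU _ x₂Z).symm⟩,
        hqk₁.symm.touch (Or.inr hk₁) rfl, hyk.symm.touch (Or.inr hk) rfl,
        hva.touch (Or.inl rfl) ha⟩
  · have yU := hy.2.1
    have q₁U := q₁Y.2.1
    have yP := YP y hy
    refine hH.pl.no_K33' P (insert q₁ K) U {x₁} {x₂} {y}
      ⟨cP, cK.insert ⟨k₁, hk₁, hqk₁⟩, hF.connU, Conn.singleton _ _, Conn.singleton _ _,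
        Conn.singleton _ _⟩
      ⟨Set.subset_univ _, Set.subset_univ _, Set.subset_univ _, Set.subset_univ _,
        Set.subset_univ _, Set.subset_univ _⟩ ?_ ?_
    · simp [Set.disjoint_insert_left, Set.disjoint_insert_right, q₁P, dPK, dPU, dKU, q₁U, h21.symm,
        h1q, h2q, hyq, h1y, h2y, RP x₁ z1', RP x₂ z2', yP, z1, z2, yU,
        RK x₁ z1', RK x₂ z2', YK y hy]
    · obtain ⟨a, ha, hya⟩ := (hF.bd y hy.1 hy.2.1 hyR).1
      obtain ⟨a', ha', hya'⟩ := hy.2.2.1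
      exact ⟨⟨ZP _ x₁Z, ZP _ x₂Z, hya'.touch ha' rfl⟩,
        ⟨(Zq _ x₁Z).symm.touch (Or.inl rfl) rfl, (Zq _ x₂Z).symm.touch (Or.inl rfl) rfl,
          hyk.symm.touch (Or.inr hk) rfl⟩, ZU _ x₁Z, ZU _ x₂Z, hya.symm.touch ha rfl⟩

section

variable {β : Type*} {H : SimpleGraph β} {X ρ U R K : Set β} {v r x : β} {n : ℕ} {c : ℕ → β}

/-- The outcome of `Front.exists_good`. -/
structure Good (H : SimpleGraph β) (X U R K : Set β) (r x : β) : Prop where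
  xX : x ∈ X
  xU : x ∉ U
  xR : x ∉ R
  rK : r ∈ K
  conn : Conn H K
  sub : K ⊆ R
  xK : ∀ k ∈ K, ¬ H.Adj x k
  rest : ∀ q ∈ R, q ∉ K → H.Adj x q ∧ ∃ k ∈ K, H.Adj q k

theorem Front.conn_side (hF : Front H X U R v r) : Conn H (insert v U) :=
  hF.connU.insert (hF.bd v hF.vX hF.vU hF.vR).1

theorem Front.disjoint_side (hF : Front H X U R v r) : Disjoint R (insert v U) := by
  rw [Set.disjoint_left]
  rintro a ha (rfl | h)
  · exact hF.vR ha
  · exact hF.disj a h ha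

theorem Front.touch_side (hF : Front H X U R v r) {b : β} {B : Set β} (hb : b ∈ B) (hX : b ∈ X)
    (hU : b ∉ U) (hR : b ∉ R) : Touch H B (insert v U) :=
  let ⟨_, ha, h⟩ := (hF.bd b hX hU hR).1
  h.touch hb (Or.inr ha)

/-- Two vertices of `R \ K` cannot be joined by a path through remaining vertices. -/
theorem Front.no_path (hH : Host H X ρ) (hF : Front H X U R v r) (hg : Good H X U R K r x)
    (hc : IsCyc H n c) (hX : ∀ k, c k ∈ X ∧ c k ∉ U ∧ c k ∉ K ∧ c k ≠ v) {i j : ℕ}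
    (hij : i + 1 < j) (hj : j < i + n) (hi : c i ∈ R) (hjR : c j ∈ R)
    (hk : ∀ k, i < k → k < j → c k ∉ R ∧ c k ≠ x) : False := by
  have dU : Disjoint (c '' Set.Ico (i + 1) j) (insert v U) := by
    rw [Set.disjoint_left]
    rintro _ ⟨k, _, rfl⟩ (h | h)
    · exact (hX k).2.2.2 h
    · exact (hX k).2.1 h
  have dK : Disjoint (c '' Set.Ico (i + 1) j) K := by
    rw [Set.disjoint_left]
    rintro _ ⟨k, _, rfl⟩ h
    exact (hX k).2.2.1 h
  have dR : ∀ q ∈ R, q ∉ c '' Set.Ico (i + 1) j := by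
    rintro _ hq ⟨k, ⟨h1, h2⟩, rfl⟩
    exact (hk k h1 h2).1 hq
  have dx : x ∉ c '' Set.Ico (i + 1) j := by
    rintro ⟨k, ⟨h1, h2⟩, h⟩
    exact (hk k h1 h2).2 h
  have xv : x ≠ v := by
    rintro rfl
    exact hg.xK r hg.rK hF.vr
  have hne := hc.inj i j (by omega) hj
  obtain ⟨ai, k₁, hk₁, ai'⟩ := hg.rest _ hi (hX i).2.2.1
  obtain ⟨aj, k₂, hk₂, aj'⟩ := hg.rest _ hjR (hX j).2.2.1
  have xi : x ≠ c i := fun h => hg.xR (h ▸ hi)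
  have xj : x ≠ c j := fun h => hg.xR (h ▸ hjR)
  have dKU := hF.disjoint_side.mono_left hg.sub
  have h1 := hc.adj (j - 1)
  rw [show j - 1 + 1 = j by omega] at h1
  refine hH.pl.no_K33' (c '' Set.Ico (i + 1) j) {x} K {c i} {c j} (insert v U)
    ⟨hc.conn_arc hij, Conn.singleton _ _, hg.conn, Conn.singleton _ _, Conn.singleton _ _,
      hF.conn_side⟩
    ⟨Set.subset_univ _, Set.subset_univ _, Set.subset_univ _, Set.subset_univ _,
      Set.subset_univ _, Set.subset_univ _⟩ ?_ ?_
  · have e1 : x ∉ K := fun h => hg.xR (hg.sub h)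
    have e2 := dR _ hi
    have e3 := dR _ hjR
    have e4 := hX i
    have e5 := hX j
    have e6 := hg.xU
    rw [Set.disjoint_singleton_right, Set.disjoint_singleton_left, Set.disjoint_singleton_left,
      Set.disjoint_singleton_left, Set.disjoint_singleton_left, Set.disjoint_singleton_right,
      Set.disjoint_singleton_right, Set.disjoint_singleton_left, Set.disjoint_singleton_left,
      Set.disjoint_singleton_left, Set.disjoint_singleton_right, Set.disjoint_singleton_right]
    simp only [Set.mem_singleton_iff, Set.mem_insert_iff, not_or]
    exact ⟨⟨dx, dK, e1⟩, ⟨hne, ⟨e4.2.2.2, e4.2.1⟩, e5.2.2.2, e5.2.1⟩, ⟨e2, e3, dU⟩,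
      ⟨xi, xj, xv, e6⟩, e4.2.2.1, e5.2.2.1, dKU⟩
  · exact ⟨⟨(hc.adj i).symm.touch (IsCyc.mem_arc hij) rfl, h1.touch ⟨j - 1, ⟨by omega, by omega⟩, rfl⟩ rfl,
      hF.touch_side (IsCyc.mem_arc hij) (hX _).1 (hX _).2.1 (hk _ (by omega) hij).1⟩,
      ⟨ai.touch rfl rfl, aj.touch rfl rfl, hF.touch_side rfl hg.xX hg.xU hg.xR⟩,
      ai'.symm.touch hk₁ rfl, aj'.symm.touch hk₂ rfl, hF.vr.symm.touch hg.rK (Or.inl rfl)⟩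

/-- A cycle all of whose vertices are joined to two adjacent connected sets is impossible. -/
theorem IsCyc.no_wheel (hp : Pl H Set.univ) (hc : IsCyc H n c) {A B : Set β} (hA : Conn H A)
    (hB : Conn H B) (hAB : Touch H A B) (dAB : Disjoint A B)
    (h : ∀ k, c k ∉ A ∧ c k ∉ B ∧ (∃ a ∈ A, H.Adj (c k) a) ∧ ∃ b ∈ B, H.Adj (c k) b) :
    False := by
  have h3 := hc.three
  have dA : ∀ i j, Disjoint (c '' Set.Ico i j) A := by
    intro i j
    rw [Set.disjoint_left]
    rintro _ ⟨k, _, rfl⟩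
    exact (h k).1
  have dB : ∀ i j, Disjoint (c '' Set.Ico i j) B := by
    intro i j
    rw [Set.disjoint_left]
    rintro _ ⟨k, _, rfl⟩
    exact (h k).2.1
  have tA : ∀ i j, i < j → Touch H (c '' Set.Ico i j) A := fun i j hij =>
    let ⟨_, ha, h'⟩ := (h i).2.2.1
    h'.touch (IsCyc.mem_arc hij) ha
  have tB : ∀ i j, i < j → Touch H (c '' Set.Ico i j) B := fun i j hij =>
    let ⟨_, ha, h'⟩ := (h i).2.2.2
    h'.touch (IsCyc.mem_arc hij) ha
  have hw : Touch H (c '' Set.Ico 2 n) (c '' Set.Ico 0 1) := by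
    have := hc.touch_arc' (i := 0) (j := 1) (k := 2) (by omega) (by omega)
    rwa [zero_add] at this
  exact hp.no_K5' (c '' Set.Ico 0 1) (c '' Set.Ico 1 2) (c '' Set.Ico 2 n) A B
    ⟨hc.conn_arc (by omega), hc.conn_arc (by omega), hc.conn_arc (by omega), hA, hB⟩
    ⟨Set.subset_univ _, Set.subset_univ _, Set.subset_univ _, Set.subset_univ _,
      Set.subset_univ _⟩
    ⟨⟨hc.disjoint_arc (by omega) (by omega), hc.disjoint_arc (by omega) (by omega), dA _ _,
      dB _ _⟩, ⟨hc.disjoint_arc (by omega) (by omega), dA _ _, dB _ _⟩, ⟨dA _ _, dB _ _⟩, dAB⟩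
    ⟨⟨hc.touch_arc (by omega) (by omega), hw.symm, tA _ _ (by omega), tB _ _ (by omega)⟩,
      ⟨hc.touch_arc (by omega) (by omega), tA _ _ (by omega), tB _ _ (by omega)⟩,
      ⟨tA _ _ (by omega), tB _ _ (by omega)⟩, hAB⟩

/-- A cycle through remaining vertices and a single vertex of `R \ K` contains a triangle. -/
theorem Front.no_single (hH : Host H X ρ) (hF : Front H X U R v r) (hg : Good H X U R K r x)
    (hc : IsCyc H n c) (hX : ∀ k, c k ∈ X ∧ c k ∉ U ∧ c k ∉ K ∧ c k ≠ v) (hρ : ∀ k, c k ∈ ρ)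
    (h0 : c 0 ∈ R) (hk : ∀ k, 0 < k → k < n → c k ∉ R) : False := by
  have h3 := hc.three
  have hn0 := hc.per 0
  rw [zero_add] at hn0
  have hn : 4 ≤ n := by
    by_contra hlt
    obtain rfl : n = 3 := by omega
    have a2 := hc.adj 2
    rw [hn0] at a2
    exact hH.tri _ _ _ (hρ 0) (hρ 1) (hρ 2) (hc.adj 0) (hc.adj 1) a2.symm
  obtain ⟨-, k₁, hk₁, a0⟩ := hg.rest _ h0 (hX 0).2.2.1
  have cT : Conn H (K ∪ {q | q ∈ R ∧ q ∉ K ∧ q ≠ c 0}) :=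
    hg.conn.union_of_adj fun q hq => (hg.rest q hq.1 hq.2.1).2
  have TR : K ∪ {q | q ∈ R ∧ q ∉ K ∧ q ≠ c 0} ⊆ R := Set.union_subset hg.sub fun q hq => hq.1
  have T0 : c 0 ∉ K ∪ {q | q ∈ R ∧ q ∉ K ∧ q ≠ c 0} := by
    rintro (h | h)
    · exact (hX 0).2.2.1 h
    · exact h.2.2 rfl
  have mT : ∀ q ∈ R, q ≠ c 0 → q ∈ K ∪ {q | q ∈ R ∧ q ∉ K ∧ q ≠ c 0} := by
    intro q hq h
    by_cases hqK : q ∈ K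
    · exact Or.inl hqK
    · exact Or.inr ⟨hq, hqK, h⟩
  generalize K ∪ {q | q ∈ R ∧ q ∉ K ∧ q ≠ c 0} = T at *
  have rT : r ∈ T := mT r hF.rR fun h => (hX 0).2.2.1 (h ▸ hg.rK)
  have k₁T : k₁ ∈ T := mT _ (hg.sub hk₁) fun h => (hX 0).2.2.1 (h ▸ hk₁)
  obtain ⟨t, htR, ht⟩ := (hF.bd _ (hX 2).1 (hX 2).2.1 (hk 2 (by omega) (by omega))).2
  have htT : t ∈ T := mT t htR fun h => by
    subst h
    exact hH.tri _ _ _ (hρ 0) (hρ 1) (hρ 2) (hc.adj 0) (hc.adj 1) ht.symm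
  have dU : ∀ k, c k ∉ insert v U := by
    rintro k (h | h)
    · exact (hX k).2.2.2 h
    · exact (hX k).2.1 h
  have dT : ∀ k, 0 < k → k < n → c k ∉ T := fun k h1 h2 h => hk k h1 h2 (TR h)
  have hne : ∀ i j, i < j → j < n → c i ≠ c j := fun i j h1 h2 => hc.inj i j h1 (by omega)
  have al := hc.adj (n - 1)
  rw [show n - 1 + 1 = n by omega, hn0] at al
  have al' := hc.adj (n - 2)
  rw [show n - 2 + 1 = n - 1 by omega] at al'
  have arc : ∀ i, i < n → (i < 2 ∨ n - 1 ≤ i) → c i ∉ c '' Set.Ico 2 (n - 1) := by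
    rintro i hi h ⟨k, ⟨h1, h2⟩, h'⟩
    rcases lt_or_ge k i with hlt | hlt
    · exact hne k i hlt hi h'
    · exact hne i k (by omega) (by omega) h'.symm
  refine hH.pl.no_K33' {c 1} {c (n - 1)} T {c 0} (insert v U) (c '' Set.Ico 2 (n - 1))
    ⟨Conn.singleton _ _, Conn.singleton _ _, cT, Conn.singleton _ _, hF.conn_side,
      hc.conn_arc (by omega)⟩
    ⟨Set.subset_univ _, Set.subset_univ _, Set.subset_univ _, Set.subset_univ _,
      Set.subset_univ _, Set.subset_univ _⟩ ?_ ?_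
  · have d1 : Disjoint (insert v U) (c '' Set.Ico 2 (n - 1)) := by
      rw [Set.disjoint_right]
      rintro _ ⟨k, _, rfl⟩
      exact dU k
    have d2 : Disjoint T (c '' Set.Ico 2 (n - 1)) := by
      rw [Set.disjoint_right]
      rintro _ ⟨k, ⟨h1, h2⟩, rfl⟩
      exact dT k (by omega) (by omega)
    simp only [Set.disjoint_singleton_right, Set.disjoint_singleton_left, Set.mem_singleton_iff]
    exact ⟨⟨(hne 1 (n - 1) (by omega) (by omega)).symm, dT _ (by omega) (by omega), dT _ (by omega) (by omega)⟩,
      ⟨dU _, arc _ (by omega) (by omega), d1⟩,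
      ⟨hne 0 1 (by omega) (by omega), dU _, arc _ (by omega) (by omega)⟩,
      ⟨hne 0 (n - 1) (by omega) (by omega), dU _, arc _ (by omega) (by omega)⟩,
      T0, hF.disjoint_side.mono_left TR, d2⟩
  · have tU : ∀ k, 0 < k → k < n → Touch H {c k} (insert v U) := fun k h1 h2 =>
      hF.touch_side rfl (hX k).1 (hX k).2.1 (hk k h1 h2)
    exact ⟨⟨(hc.adj 0).symm.touch rfl rfl, tU _ (by omega) (by omega),
        (hc.adj 1).touch rfl (IsCyc.mem_arc (by omega))⟩,
      ⟨al.touch rfl rfl, tU _ (by omega) (by omega),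
        al'.symm.touch rfl ⟨n - 2, ⟨by omega, by omega⟩, rfl⟩⟩,
      a0.symm.touch k₁T rfl, hF.vr.symm.touch rT (Or.inl rfl),
      ht.symm.touch htT (IsCyc.mem_arc (by omega))⟩

/-- The remaining vertices together with `R \ K` contain no cycle of `ρ`. -/
theorem Front.no_cycle (hH : Host H X ρ) (hF : Front H X U R v r) (hg : Good H X U R K r x)
    (hvρ : v ∉ ρ) (hc : IsCyc H n c) (hX' : ∀ k, c k ∈ X ∧ c k ∉ U ∧ c k ∉ K)
    (hρ : ∀ k, c k ∈ ρ) : False := by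
  classical
  have hX : ∀ k, c k ∈ X ∧ c k ∉ U ∧ c k ∉ K ∧ c k ≠ v := fun k =>
    ⟨(hX' k).1, (hX' k).2.1, (hX' k).2.2, fun h => hvρ (h ▸ hρ k)⟩
  have h3 := hc.three
  have dU : ∀ k, c k ∉ insert v U := by
    rintro k (h | h)
    · exact (hX k).2.2.2 h
    · exact (hX k).2.1 h
  by_cases hB : ∀ k, c k ∉ R
  · refine hc.no_wheel hH.pl hF.connR hF.conn_side (hF.vr.symm.touch hF.rR (Or.inl rfl))
      hF.disjoint_side fun k => ⟨hB k, dU k, (hF.bd _ (hX k).1 (hX k).2.1 (hB k)).2, ?_⟩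
    obtain ⟨a, ha, h⟩ := (hF.bd _ (hX k).1 (hX k).2.1 (hB k)).1
    exact ⟨a, Or.inr ha, h⟩
  push Not at hB
  by_cases hS : ∀ k, c k ∈ R
  · refine hc.no_wheel hH.pl hg.conn (B := insert x (insert v U))
      (hF.conn_side.insert ?_) (hF.vr.symm.touch hg.rK (Or.inr (Or.inl rfl))) ?_ fun k => ?_
    · obtain ⟨a, ha, h⟩ := (hF.bd _ hg.xX hg.xU hg.xR).1
      exact ⟨a, Or.inr ha, h⟩
    · rw [Set.disjoint_insert_right]
      exact ⟨fun h => hg.xR (hg.sub h), hF.disjoint_side.mono_left hg.sub⟩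
    · obtain ⟨h1, h2⟩ := hg.rest _ (hS k) (hX k).2.2.1
      refine ⟨(hX k).2.2.1, ?_, h2, x, Or.inl rfl, h1.symm⟩
      rintro (h | h)
      · exact hg.xR (h ▸ hS k)
      · exact dU k h
  push Not at hS
  by_cases h1 : ∃ i, c i ∈ R ∧ ∀ j, i < j → j < i + n → c j ∉ R
  · obtain ⟨i, hi, hij⟩ := h1
    refine hF.no_single hH hg (hc.shift i) (fun k => hX _) (fun k => hρ _) (by simpa using hi) ?_
    intro k hk hkn
    exact hij _ (by omega) (by omega)
  push Not at h1
  by_cases hx : ∃ k, c k = x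
  · obtain ⟨m, rfl⟩ := hx
    have ind : ∀ i j, c i ∈ R → c j ∈ R → ¬ H.Adj (c i) (c j) := by
      intro i j hi hj hij
      exact hH.tri _ _ _ (hρ m) (hρ i) (hρ j) (hg.rest _ hi (hX i).2.2.1).1 hij
        (hg.rest _ hj (hX j).2.2.1).1
    have ex : ∃ i, m < i ∧ c i ∈ R := by
      obtain ⟨k, hk⟩ := hB
      obtain ⟨k', e1, -, e3⟩ := hc.window (m + 1) k
      exact ⟨k', by omega, e3 ▸ hk⟩
    obtain ⟨hmi, hi⟩ := Nat.find_spec ex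
    have mini : ∀ k, m < k → k < Nat.find ex → c k ∉ R := fun k e1 e2 h =>
      Nat.find_min ex e2 ⟨e1, h⟩
    generalize Nat.find ex = i at *
    obtain ⟨j₀, hj₀, hj₀n, hj₀R⟩ := h1 i hi
    have ex' : ∃ j, i < j ∧ c j ∈ R := ⟨j₀, hj₀, hj₀R⟩
    have hjle : Nat.find ex' ≤ j₀ := Nat.find_le ⟨hj₀, hj₀R⟩
    obtain ⟨hij, hj⟩ := Nat.find_spec ex'
    have minj : ∀ k, i < k → k < Nat.find ex' → c k ∉ R := fun k e1 e2 h =>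
      Nat.find_min ex' e2 ⟨e1, h⟩
    generalize Nat.find ex' = j at *
    have hjm : j < m + n := by
      by_contra hlt
      have e1 := hc.per (j - n)
      rw [show j - n + n = j by omega] at e1
      rw [e1] at hj
      rcases eq_or_ne (j - n) m with e | e
      · exact hg.xR (e ▸ hj)
      · exact mini _ (by omega) (by omega) hj
    refine hF.no_path hH hg hc hX (i := i) (j := j) ?_ (by omega) hi hj fun k e1 e2 =>
      ⟨minj k e1 e2, (hc.inj m k (by omega) (by omega)).symm⟩
    by_contra hlt
    obtain rfl : j = i + 1 := by omega
    exact ind _ _ hi hj (hc.adj i)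
  · push Not at hx
    obtain ⟨i, hi, hi'⟩ : ∃ i, c i ∈ R ∧ c (i + 1) ∉ R := by
      by_contra! h
      obtain ⟨k, hk⟩ := hB
      obtain ⟨l, hl⟩ := hS
      obtain ⟨l', e1, -, e3⟩ := hc.window k l
      have : ∀ j, k ≤ j → c j ∈ R := by
        intro j hj
        induction j, hj using Nat.le_induction with
        | base => exact hk
        | succ j _ ih => exact h j ih
      exact hl (e3 ▸ this l' e1)
    obtain ⟨j₀, hj₀, hj₀n, hj₀R⟩ := h1 i hi
    have ex' : ∃ j, i < j ∧ c j ∈ R := ⟨j₀, hj₀, hj₀R⟩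
    have hjle : Nat.find ex' ≤ j₀ := Nat.find_le ⟨hj₀, hj₀R⟩
    obtain ⟨hij, hj⟩ := Nat.find_spec ex'
    have minj : ∀ k, i < k → k < Nat.find ex' → c k ∉ R := fun k e1 e2 h =>
      Nat.find_min ex' e2 ⟨e1, h⟩
    generalize Nat.find ex' = j at *
    refine hF.no_path hH hg hc hX (i := i) (j := j) ?_ (by omega) hi hj fun k e1 e2 =>
      ⟨minj k e1 e2, hx k⟩
    by_contra hlt
    obtain rfl : j = i + 1 := by omega
    exact hi' hj

end

section

variable {β : Type*} {H : SimpleGraph β} {X ρ U R K : Set β} {v r x : β}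

/-- Advance `U` by the remaining vertices without a neighbour in `K`. -/
theorem Front.next (hF : Front H X U R v r) (hg : Good H X U R K r x) :
    Front H X (U ∪ {b | b ∈ X ∧ b ∉ U ∧ b ∉ R ∧ ∀ k ∈ K, ¬ H.Adj b k}) K v r where
  US := Set.union_subset hF.US fun b hb => hb.1
  RS := hg.sub.trans hF.RS
  connU := hF.connU.union_of_adj fun b hb => (hF.bd b hb.1 hb.2.1 hb.2.2.1).1
  connR := hg.conn
  sep := by
    rintro a (ha | ha) b hb
    · exact hF.sep a ha b (hg.sub hb)
    · exact ha.2.2.2 b hb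
  disj := by
    rintro a (ha | ha) hb
    · exact hF.disj a ha (hg.sub hb)
    · exact ha.2.2.1 (hg.sub hb)
  bd := by
    intro b hbX hbU hbK
    by_cases hbR : b ∈ R
    · obtain ⟨h1, h2⟩ := hg.rest b hbR hbK
      exact ⟨⟨x, Or.inr ⟨hg.xX, hg.xU, hg.xR, hg.xK⟩, h1.symm⟩, h2⟩
    · have hbU' : b ∉ U := fun h => hbU (Or.inl h)
      obtain ⟨a, ha, h⟩ := (hF.bd b hbX hbU' hbR).1
      refine ⟨⟨a, Or.inl ha, h⟩, ?_⟩
      by_contra! hk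
      exact hbU (Or.inr ⟨hbX, hbU', hbR, hk⟩)
  rR := hg.rK
  vX := hF.vX
  vU := by
    rintro (h | h)
    · exact hF.vU h
    · exact h.2.2.2 r hg.rK hF.vr
  vR := fun h => hF.vR (hg.sub h)
  vr := hF.vr

/-- If `r` is adjacent to all remaining vertices, then `R` consists of `r` only. -/
theorem Front.eq_of_all_adj (hH : Host H X ρ) (hF : Front H X U R v r)
    (hx : ∀ x ∈ X, x ∉ U → x ∉ R → H.Adj x r) : ∀ p ∈ R, p = r := by
  intro p hp
  by_contra hpr
  have pW : p ∈ {q | q ∈ R ∧ q ≠ r} := ⟨hp, hpr⟩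
  have pP := mem_comp_self H pW
  have cP := conn_comp (G := H) pW
  have PW := comp_subset H {q | q ∈ R ∧ q ≠ r} p
  have Pcl : ∀ a b, a ∈ comp H {q | q ∈ R ∧ q ≠ r} p → b ∈ R → b ≠ r → H.Adj a b →
      b ∈ comp H {q | q ∈ R ∧ q ≠ r} p := fun a b ha h1 h2 hab => comp_closed ha ⟨h1, h2⟩ hab
  generalize comp H {q | q ∈ R ∧ q ≠ r} p = P at *
  have PR : P ⊆ R := fun a ha => (PW ha).1
  have rP : r ∉ P := fun h => (PW h).2 rfl
  obtain ⟨b₀, hb₀⟩ := hF.connU.1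
  have four : ∀ y z, ∃ w, (w ∈ X ∧ w ∉ U ∧ w ∉ R ∧ ∃ a ∈ P, H.Adj a w) ∧ w ≠ y ∧ w ≠ z := by
    intro y z
    obtain ⟨w, h1, ⟨a, ha, h2⟩, h3, h4, h5⟩ := hH.four P b₀ ⟨p, pP⟩ (PR.trans hF.RS) (hF.US hb₀)
      (fun h => hF.disj _ hb₀ (PR h)) (fun a ha h => hF.sep _ hb₀ a (PR ha) h.symm) r y z
    exact ⟨w, ⟨hH.supp w a h2.symm, fun h => hF.sep w h a (PR ha) h2.symm,
      fun h => h1 (Pcl a w ha h h3 h2), a, ha, h2⟩, h4, h5⟩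
  obtain ⟨a, ⟨haX, haU, haR, a', ha', ha⟩, -⟩ := four r r
  obtain ⟨b, ⟨hbX, hbU, hbR, b', hb', hb⟩, hba, -⟩ := four a a
  obtain ⟨d, ⟨hdX, hdU, hdR, d', hd', hd⟩, hda, hdb⟩ := four a b
  have tU : ∀ y ∈ X, y ∉ U → y ∉ R → Touch H U {y} := fun y h1 h2 h3 =>
    let ⟨_, hq, h⟩ := (hF.bd y h1 h2 h3).1
    h.symm.touch hq rfl
  refine hH.pl.no_K33' P U {r} {a} {b} {d}
    ⟨cP, hF.connU, Conn.singleton _ _, Conn.singleton _ _, Conn.singleton _ _,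
      Conn.singleton _ _⟩
    ⟨Set.subset_univ _, Set.subset_univ _, Set.subset_univ _, Set.subset_univ _,
      Set.subset_univ _, Set.subset_univ _⟩ ?_ ?_
  · have dPU : Disjoint P U := Set.disjoint_left.2 fun q h h' => hF.disj q h' (PR h)
    have rU : r ∉ U := fun h => hF.disj r h hF.rR
    have ne : ∀ q, q ∉ R → r ≠ q := fun q hq h => hq (h ▸ hF.rR)
    have nP : ∀ q, q ∉ R → q ∉ P := fun q hq h => hq (PR h)
    simp [dPU, rP, rU, ne a haR, ne b hbR, ne d hdR, nP a haR, nP b hbR, nP d hdR, haU, hbU, hdU,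
      hba.symm, hda.symm, hdb.symm]
  · exact ⟨⟨ha.touch ha' rfl, hb.touch hb' rfl, hd.touch hd' rfl⟩,
      ⟨tU a haX haU haR, tU b hbX hbU hbR, tU d hdX hdU hdR⟩,
      (hx a haX haU haR).symm.touch rfl rfl, (hx b hbX hbU hbR).symm.touch rfl rfl,
      (hx d hdX hdU hdR).symm.touch rfl rfl⟩

theorem Front.completable {V : Type*} [Finite V] [Finite β] {G : SimpleGraph V} {ι : V → β}
    {r₀ : V} (hι : Function.Injective ι) (hadj : ∀ a b, G.Adj a b → H.Adj (ι a) (ι b))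
    (hH : Host H X (Set.range ι)) (hvρ : v ∉ Set.range ι) (hF : Front H X U R v (ι r₀)) :
    Completable G {a | ι a ∈ U ∨ ι a ∉ X} := by
  induction hn : R.ncard using Nat.strong_induction_on generalizing U R with
  | _ n ih =>
  by_cases hx : ∃ x ∈ X, x ∉ U ∧ x ∉ R ∧ ¬ H.Adj x (ι r₀)
  · obtain ⟨x, K, ⟨xX, xU, xR⟩, rK, cK, KR, xK, rest⟩ := hF.exists_good hH hx
    have hg : Good H X U R K (ι r₀) x := ⟨xX, xU, xR, rK, cK, KR, xK, rest⟩
    have hlt : K.ncard < R.ncard := by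
      refine Set.ncard_lt_ncard ⟨KR, fun h => ?_⟩
      obtain ⟨a, ha, hxa⟩ := (hF.bd x xX xU xR).2
      exact xK a (h ha) hxa
    refine Completable.eat (S := {a | ι a ∈ X ∧ ι a ∉ U ∧ ι a ∉ K}) ?_ ?_ ?_
      (ih _ (hn ▸ hlt) (hF.next hg) rfl)
    · rintro a (h | h)
      · exact Or.inl (Or.inl h)
      · exact Or.inr h
    · intro n c hc
      by_contra! h
      exact hF.no_cycle hH hg hvρ (hc.map ι hι hadj) h fun k => ⟨c k, rfl⟩
    · intro a ha h
      simp only [Set.mem_ofPred_eq, not_or, not_not] at ha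
      refine ⟨ha.2, ha.1, fun haK => ?_⟩
      rcases h with (h | h) | ⟨b, h, hab⟩
      · exact (hF.next hg).disj _ h haK
      · exact h ha.2
      · rcases h with h | h
        · exact (hF.next hg).sep _ h _ haK (hadj _ _ hab).symm
        · exact h (hH.supp _ _ (hadj _ _ hab).symm)
  · push Not at hx
    have hR := hF.eq_of_all_adj hH hx
    refine Completable.eat (S := {a | ι a ∈ X ∧ ι a ∉ U}) (Set.subset_univ _)
      (ForestOn.star r₀ ?_) ?_ Completable.done
    · rintro a ⟨haX, haU⟩ b ⟨hbX, hbU⟩ hab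
      by_contra! h
      have ha := hx _ haX haU fun h' => h.1 (hι (hR _ h'))
      have hb := hx _ hbX hbU fun h' => h.2 (hι (hR _ h'))
      exact hH.tri _ _ _ ⟨a, rfl⟩ ⟨b, rfl⟩ ⟨r₀, rfl⟩ (hadj _ _ hab) hb ha
    · intro a ha _
      simp only [Set.mem_ofPred_eq, not_or, not_not] at ha
      exact ⟨ha.2, ha.1⟩

end

/-- The 1-skeleton of a flag sphere is a host. -/
theorem IsSphere.host {α : Type*} [DecidableEq α] [Fintype α] {T : Finset (Finset α)} {ρ : Set α}
    (hT : IsSphere T)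
    (hF : ∀ a b d, TEdge T a b → TEdge T b d → TEdge T a d → {a, b, d} ∈ T)
    (htri : ∀ a b d, a ∈ ρ → b ∈ ρ → d ∈ ρ → TEdge T a b → TEdge T b d → ¬ TEdge T a d) :
    Host (tgraph T) (verts T) ρ where
  pl := hT.pl _
  supp _ _ h := TEdge.left h
  four A b₀ hA hAX hb hbA h x y z := by
    obtain ⟨a, ha⟩ := hA
    exact hT.four_conn hF ⟨a, ha, hAX ha⟩ hb hbA h x y z
  tri := htri

/-- In a flag sphere, the vertices not adjacent to `u` form the far side of a front. -/
theorem IsSphere.front {α : Type*} [DecidableEq α] [Fintype α] {T : Finset (Finset α)}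
    (hT : IsSphere T) (hF : ∀ a b d, TEdge T a b → TEdge T b d → TEdge T a d → {a, b, d} ∈ T)
    {u r v : α} (hr : r ∈ verts T) (hru : r ≠ u) (hur : ¬ TEdge T u r) (huv : TEdge T u v)
    (hvr : TEdge T v r) :
    Front (tgraph T) (verts T) {w | w ∈ verts T ∧ (w = u ∨ TEdge T u w) ∧
      ∀ k ∈ verts T, k ≠ u → ¬ TEdge T u k → ¬ TEdge T w k}
      {w | w ∈ verts T ∧ w ≠ u ∧ ¬ TEdge T u w} v r where
  US _ h := h.1
  RS _ h := h.1
  connU := by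
    have hu : u ∈ {w | w ∈ verts T ∧ (w = u ∨ TEdge T u w) ∧
        ∀ k ∈ verts T, k ≠ u → ¬ TEdge T u k → ¬ TEdge T w k} :=
      ⟨huv.left, Or.inl rfl, fun k _ _ h => h⟩
    have := (Conn.singleton (tgraph T) u).union_of_adj (M := {w | w ∈ verts T ∧
      (w = u ∨ TEdge T u w) ∧ ∀ k ∈ verts T, k ≠ u → ¬ TEdge T u k → ¬ TEdge T w k} \ {u})
      fun w hw => ⟨u, rfl, (hw.1.2.1.resolve_left hw.2).symm⟩
    rwa [Set.union_sdiff_cancel (Set.singleton_subset_iff.2 hu)] at this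
  connR := hT.conn_non_nbrs hF hr hru hur
  sep a ha b hb := ha.2.2 b hb.1 hb.2.1 hb.2.2
  disj a ha hb := ha.2.1.elim hb.2.1 hb.2.2
  bd b hbX hbU hbR := by
    have hub : b = u ∨ TEdge T u b := by
      by_contra! h
      exact hbR ⟨hbX, h⟩
    have hu : b ≠ u := by
      rintro rfl
      exact hbU ⟨hbX, hub, fun k _ _ h => h⟩
    refine ⟨⟨u, ⟨huv.left, Or.inl rfl, fun k _ _ h => h⟩, (hub.resolve_left hu).symm⟩, ?_⟩
    by_contra! h
    exact hbU ⟨hbX, hub, fun k h1 h2 h3 => h k ⟨h1, h2, h3⟩⟩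
  rR := ⟨hr, hru, hur⟩
  vX := huv.right
  vU h := h.2.2 r hr hru hur hvr
  vR h := h.2.2 huv
  vr := hvr

theorem inl_mem_verts_flipped {V : Type*} [DecidableEq V] [Fintype V] {G : SimpleGraph V}
    {T : Finset (Finset V)} (hT : IsSphere T) {a : V} :
    Sum.inl a ∈ verts (flipped G T) ↔ a ∈ verts T := by
  constructor
  · rintro ⟨h, hh, ha⟩
    obtain ⟨x, hx, hxa⟩ := Finset.exists_mem_ne
      (by rw [(isSphere_flipped hT).card h hh]; omega) (Sum.inl a)
    have hax : TEdge (flipped G T) (.inl a) x := ⟨hxa.symm, h, hh, ha, hx⟩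
    rcases x with b | t
    · exact (tedge_flipped_real.1 hax).2.left
    · obtain ⟨ht, hat⟩ := (tedge_flipped_mixed hT).1 hax
      exact ⟨t, ht, hat⟩
  · rintro ⟨t, ht, hat⟩
    exact ((tedge_flipped_mixed hT).2 ⟨ht, hat⟩).left

/-- A triangle-free graph drawn in a sphere on its non-isolated vertices. -/
theorem IsSphere.completable {V : Type*} [DecidableEq V] [Fintype V] {G : SimpleGraph V}
    {T : Finset (Finset V)} (hT : IsSphere T)
    (htf : ∀ a b d, G.Adj a b → G.Adj b d → ¬ G.Adj a d)
    (hTG : ∀ a b, G.Adj a b → TEdge T a b) (hv : ∀ a ∈ verts T, ∃ b, G.Adj a b) :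
    Completable G {a | ∀ b, ¬ G.Adj a b} := by
  have hX : ∀ a, Sum.inl a ∈ verts (flipped G T) ↔ ∃ b, G.Adj a b := by
    intro a
    rw [inl_mem_verts_flipped hT]
    exact ⟨hv a, fun ⟨b, h⟩ => (hTG a b h).left⟩
  have hadj : ∀ a b, TEdge (flipped G T) (.inl a) (.inl b) ↔ G.Adj a b := fun a b => by
    rw [tedge_flipped_real]
    exact ⟨fun h => h.1, fun h => ⟨h, hTG a b h⟩⟩
  have hS := isSphere_flipped (G := G) hT
  have hflag := flipped_flag hT htf fun a ha => by
    obtain ⟨b, h⟩ := hv a ha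
    exact ⟨b, h, hTG a b h⟩
  have hH := hS.host (ρ := Set.range Sum.inl) hflag (by
    rintro _ _ _ ⟨a, rfl⟩ ⟨b, rfl⟩ ⟨d, rfl⟩ h1 h2 h3
    exact htf a b d ((hadj _ _).1 h1) ((hadj _ _).1 h2) ((hadj _ _).1 h3))
  obtain ⟨t, ht⟩ := hT.nonempty
  obtain ⟨u, r, hut, hrt, hur, hn⟩ : ∃ u r, u ∈ t ∧ r ∈ t ∧ u ≠ r ∧ ¬ G.Adj u r := by
    obtain ⟨a, b, d, h1, h2, h3, rfl⟩ := Finset.card_eq_three.1 (hT.card t ht)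
    by_contra! h
    exact htf a b d (h a b (by simp) (by simp) h1) (h b d (by simp) (by simp) h3)
      (h a d (by simp) (by simp) h2)
  have hfront := hS.front hflag (u := .inl u) (r := .inl r) (v := .inr t)
    ((inl_mem_verts_flipped hT).2 ⟨t, ht, hrt⟩) (by simpa using hur.symm)
    (fun h => hn ((hadj _ _).1 h)) ((tedge_flipped_mixed hT).2 ⟨ht, hut⟩)
    ((tedge_flipped_mixed hT).2 ⟨ht, hrt⟩).symm
  have hc := hfront.completable (G := G) Sum.inl_injective (fun a b h => (hadj a b).2 h) hH
    (by simp)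
  refine Completable.eat (S := {a | a = u ∨ G.Adj u a}) ?_ (ForestOn.star u ?_) ?_ hc
  · intro a ha
    refine Or.inr fun h => ?_
    obtain ⟨b, h⟩ := (hX a).1 h
    exact ha b h
  · rintro a (ha | ha) b (hb | hb) hab
    · exact Or.inl ha
    · exact Or.inl ha
    · exact Or.inr hb
    · exact absurd hb (htf u a b ha hab)
  · intro w hw h
    simp only [Set.mem_ofPred_eq, not_forall, not_not] at hw
    have hwX := (hX w).2 hw
    rcases h with (h | h) | ⟨w', h | h, hww⟩
    · rcases h.2.1 with h' | h'
      · exact Or.inl (Sum.inl_injective h')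
      · exact Or.inr ((hadj _ _).1 h')
    · exact absurd hwX h
    · by_contra hcon
      simp only [Set.mem_ofPred_eq, not_or] at hcon
      exact h.2.2 _ hwX (fun h' => hcon.1 (Sum.inl_injective h'))
        (fun h' => hcon.2 ((hadj _ _).1 h')) ((hadj _ _).2 hww.symm)
    · exact absurd ((hX w').2 ⟨w, hww.symm⟩) h

/-- Every triangle-free planar graph admits a forest storyplan. -/
theorem stmt_17 {V : Type*} [Fintype V] (G : SimpleGraph V)
    (htf : G.CliqueFree 3) (hpl : G.IsPlanar) :
    ∃ τ : V ≃ Fin (Fintype.card V), IsForestStoryplan G τ := by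
  classical
  have htri : ∀ a b d, G.Adj a b → G.Adj b d → ¬ G.Adj a d := fun a b d h1 h2 h3 =>
    htf {a, b, d} (SimpleGraph.is3Clique_triple_iff.2 ⟨h1, h3, h2⟩)
  refine Completable.exists_storyplan ?_
  let s : Finset V := Finset.univ.filter fun a => ∃ b, G.Adj a b
  have hs : ∀ a, a ∈ s ↔ ∃ b, G.Adj a b := fun a => by simp [s]
  rcases lt_or_ge s.card 4 with h4 | h4
  · refine Completable.eat (S := Set.univ) (Set.subset_univ _) ?_ (fun _ _ _ => trivial)
      Completable.done
    intro n c hc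
    exfalso
    have h3 := hc.three
    have hmem : ∀ i, c i ∈ s := fun i => (hs _).2 ⟨_, hc.adj i⟩
    rcases h3.eq_or_lt with rfl | hn
    · have h30 := hc.adj 2
      have := hc.per 0
      rw [zero_add] at this
      rw [this] at h30
      exact htri _ _ _ (hc.adj 0) (hc.adj 1) h30.symm
    · have hsub : (Finset.range 4).image c ⊆ s := by
        intro x hx
        obtain ⟨i, _, rfl⟩ := Finset.mem_image.1 hx
        exact hmem i
      have hcard := Finset.card_le_card hsub
      rw [Finset.card_image_of_injOn, Finset.card_range] at hcard
      · omega
      · intro i hi j hj hij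
        simp only [Finset.coe_range, Set.mem_Iio] at hi hj
        exact (hc.eq_iff (m := 0) (by omega) (by omega) (by omega) (by omega)).1 hij
  · obtain ⟨T, hT, hv, hTG⟩ := (hpl.pl (s : Set V)).emb h4
    have hmem : ∀ a, a ∈ verts T ↔ ∃ b, G.Adj a b := fun a => by
      rw [hv, Finset.mem_coe, hs]
    refine Completable.eat (S := {a | ∀ b, ¬ G.Adj a b}) (Set.empty_subset _)
      (fun n c hc => ⟨0, fun h => h _ (hc.adj 0)⟩) ?_
      (hT.completable htri (fun a b h => hTG a ((hs a).2 ⟨b, h⟩) b ((hs b).2 ⟨a, h.symm⟩) h)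
        fun a ha => (hmem a).1 ha)
    rintro w - (h | ⟨w', h, hww⟩)
    · exact h
    · exact absurd hww.symm (h w)
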